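/- arXiv:math/0408371 — 5 statements merged into one kernel-verified Lean document; each statement's English description precedes it below -/
import Mathlib

section
/- Let P and Q be nonzero coprime integers with (P,Q) not equal to (1,1), (-1,1), (2,1) or (-2,1). If U_8(P,Q) is a perfect square (i.e., equals m^2 for some integer m), then (P,Q) = (1,-4) or (P,Q) = (4,-17). Moreover U_8(1,-4) = 21^2 and U_8(4,-17) = 620^2. -/
/-- The Lucas sequence `U n (P, Q)`: `U 0 = 0`, `U 1 = 1`,
    `U n = P * U (n-1) - Q * U (n-2)` for `n ≥ 2`. -/
def lucasU (P Q : ℤ) : ℕ → ℤ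
  | 0 => 0
  | 1 => 1
  | n + 2 => P * lucasU P Q (n + 1) - Q * lucasU P Q n

open WithZero

section Order

variable {L : Type*} [Field L] {v : Valuation L ℤᵐ⁰}

/-- `x` has exact additive order `n` for the valuation `v`. -/
def OrdEq (v : Valuation L ℤᵐ⁰) (n : ℤ) (x : L) : Prop := v x = exp (-n)

/-- `x` has additive order at least `n` for the valuation `v`. -/
def OrdGe (v : Valuation L ℤᵐ⁰) (n : ℤ) (x : L) : Prop := v x ≤ exp (-n)

theorem OrdEq.ne_zero {n : ℤ} {x : L} (h : OrdEq v n x) : x ≠ 0 := by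
  rintro rfl
  simp only [OrdEq, map_zero] at h
  exact exp_ne_zero h.symm

theorem OrdEq.unique {m n : ℤ} {x : L} (h : OrdEq v m x) (h' : OrdEq v n x) : m = n := by
  simp only [OrdEq] at h h'
  rw [h, exp_inj] at h'
  omega

theorem OrdEq.ge {m n : ℤ} {x : L} (h : OrdEq v n x) (hmn : m ≤ n) : OrdGe v m x := by
  simp only [OrdEq, OrdGe] at *
  rw [h, exp_le_exp]
  omega

theorem OrdEq.le {m n : ℤ} {x : L} (h : OrdEq v n x) (h' : OrdGe v m x) : m ≤ n := by
  simp only [OrdEq, OrdGe] at *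
  rw [h, exp_le_exp] at h'
  omega

theorem OrdGe.mono {m n : ℤ} {x : L} (h : OrdGe v n x) (hmn : m ≤ n) : OrdGe v m x :=
  le_trans h (exp_le_exp.2 (by omega))

theorem OrdEq.cast {m n : ℤ} {x : L} (h : OrdEq v m x) (hmn : m = n) : OrdEq v n x := hmn ▸ h

theorem exists_ordEq (v : Valuation L ℤᵐ⁰) {x : L} (hx : x ≠ 0) : ∃ n, OrdEq v n x :=
  ⟨-log (v x), by rw [OrdEq, neg_neg, exp_log ((Valuation.ne_zero_iff v).2 hx)]⟩

theorem ordEq_one : OrdEq v 0 (1 : L) := by simp [OrdEq]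

theorem OrdEq.mul {m n : ℤ} {x y : L} (hx : OrdEq v m x) (hy : OrdEq v n y) :
    OrdEq v (m + n) (x * y) := by
  simp only [OrdEq] at *
  rw [map_mul, hx, hy, ← exp_add, neg_add]

theorem OrdEq.div {m n : ℤ} {x y : L} (hx : OrdEq v m x) (hy : OrdEq v n y) :
    OrdEq v (m - n) (x / y) := by
  simp only [OrdEq] at *
  rw [map_div₀, hx, hy, ← exp_sub]
  congr 1; ring

theorem OrdEq.pow {m : ℤ} {x : L} (hx : OrdEq v m x) (k : ℕ) : OrdEq v (k * m) (x ^ k) := by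
  induction k with
  | zero => simpa using ordEq_one
  | succ k ih =>
    rw [pow_succ]
    exact (ih.mul hx).cast (by push_cast; ring)

theorem OrdEq.sq {m : ℤ} {x : L} (hx : OrdEq v m x) : OrdEq v (2 * m) (x ^ 2) := hx.pow 2

theorem OrdEq.neg {m : ℤ} {x : L} (hx : OrdEq v m x) : OrdEq v m (-x) := by
  rwa [OrdEq, Valuation.map_neg]

theorem OrdGe.neg {m : ℤ} {x : L} (hx : OrdGe v m x) : OrdGe v m (-x) := by
  rwa [OrdGe, Valuation.map_neg]

theorem OrdEq.of_sq {m : ℤ} {x : L} (hx : OrdEq v m (x ^ 2)) : ∃ n, m = 2 * n ∧ OrdEq v n x := by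
  have h0 : x ≠ 0 := fun h => hx.ne_zero (by rw [h]; ring)
  obtain ⟨n, hn⟩ := exists_ordEq v h0
  exact ⟨n, hx.unique hn.sq, hn⟩

theorem OrdGe.add {m : ℤ} {x y : L} (hx : OrdGe v m x) (hy : OrdGe v m y) : OrdGe v m (x + y) :=
  Valuation.map_add_le v hx hy

theorem OrdGe.sub {m : ℤ} {x y : L} (hx : OrdGe v m x) (hy : OrdGe v m y) : OrdGe v m (x - y) := by
  rw [sub_eq_add_neg]; exact hx.add hy.neg

theorem OrdGe.mul {m n : ℤ} {x y : L} (hx : OrdGe v m x) (hy : OrdGe v n y) :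
    OrdGe v (m + n) (x * y) := by
  simp only [OrdGe] at *
  rw [map_mul, neg_add, exp_add]
  exact mul_le_mul' hx hy

theorem OrdEq.add_ge {m n : ℤ} {x y : L} (hx : OrdEq v m x) (hy : OrdGe v n y) (h : m < n) :
    OrdEq v m (x + y) := by
  simp only [OrdEq, OrdGe] at *
  rw [Valuation.map_add_eq_of_lt_left v, hx]
  rw [hx]
  exact lt_of_le_of_lt hy (exp_lt_exp.2 (by omega))

theorem OrdGe.add_eq {m n : ℤ} {x y : L} (hx : OrdGe v m x) (hy : OrdEq v n y) (h : n < m) :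
    OrdEq v n (x + y) := by
  rw [add_comm]; exact hy.add_ge hx h

theorem OrdEq.add {m n : ℤ} {x y : L} (hx : OrdEq v m x) (hy : OrdEq v n y) (h : m < n) :
    OrdEq v m (x + y) := hx.add_ge (hy.ge le_rfl) h

theorem OrdEq.add' {m n : ℤ} {x y : L} (hx : OrdEq v m x) (hy : OrdEq v n y) (h : n < m) :
    OrdEq v n (x + y) := (hx.ge le_rfl).add_eq hy h

theorem OrdEq.add_self_ge (hres : ∀ z, v z = 1 → v (z - 1) < 1) {m : ℤ} {x y : L}
    (hx : OrdEq v m x) (hy : OrdEq v m y) : OrdGe v (m + 1) (x + y) := by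
  have hy0 := hy.ne_zero
  have h1 : v (-(x / y)) = 1 := by
    have := hx.div hy
    rw [Valuation.map_neg]
    simpa [OrdEq] using this
  have h2 := hres _ h1
  have h3 : OrdGe v 1 (-(x / y) - 1) := by
    rw [OrdGe]
    by_cases h0 : (-(x / y) - 1) = 0
    · rw [h0]; simp
    · obtain ⟨n, hn⟩ := exists_ordEq v h0
      rw [OrdEq] at hn
      rw [hn] at h2 ⊢
      rw [← exp_zero, exp_lt_exp] at h2
      rw [exp_le_exp]; omega
  have h4 : x + y = -(y * (-(x / y) - 1)) := by field_simp; ring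
  rw [h4]
  exact ((hy.ge le_rfl).mul h3).neg

theorem OrdEq.sub_self_ge (hres : ∀ z, v z = 1 → v (z - 1) < 1) {m : ℤ} {x y : L}
    (hx : OrdEq v m x) (hy : OrdEq v m y) : OrdGe v (m + 1) (x - y) := by
  rw [sub_eq_add_neg]; exact hx.add_self_ge hres hy.neg

/-- An element which is congruent to `1` to an odd order `< 9` cannot be a square when `2` has
order `4`. -/
theorem ordEq_sq_sub_one (hres : ∀ z, v z = 1 → v (z - 1) < 1) (h2 : OrdEq v 4 (2 : L))
    {n : ℤ} {z : L} (hn : 1 ≤ n) (h : OrdEq v n (z ^ 2 - 1)) :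
    n = 2 ∨ n = 4 ∨ n = 6 ∨ 8 ≤ n := by
  have hz2 : OrdEq v 0 (z ^ 2) := by
    have := (ordEq_one (v := v)).add h (by omega)
    rwa [add_sub_cancel] at this
  obtain ⟨k, hk, hz⟩ := hz2.of_sq
  obtain rfl : k = 0 := by omega
  have hfac : z ^ 2 - 1 = (z - 1) * (z + 1) := by ring
  rw [hfac] at h
  have h1 : z - 1 ≠ 0 := fun h0 => h.ne_zero (by rw [h0]; ring)
  obtain ⟨i, hi⟩ := exists_ordEq v h1
  have hi1 : 0 + 1 ≤ i := hi.le (hz.sub_self_ge hres ordEq_one)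
  have hplus : z + 1 = (z - 1) + 2 := by ring
  rcases lt_trichotomy i 4 with hlt | rfl | hgt
  · have := hi.add h2 hlt
    rw [← hplus] at this
    have := h.unique (hi.mul this)
    omega
  · have := hi.add_self_ge hres h2
    rw [← hplus] at this
    have h3 : z + 1 ≠ 0 := fun h0 => h.ne_zero (by rw [h0]; ring)
    obtain ⟨j, hj⟩ := exists_ordEq v h3
    have h4 := hj.le this
    have := h.unique (hi.mul hj)
    omega
  · have := hi.add' h2 hgt
    rw [← hplus] at this
    have := h.unique (hi.mul this)
    omega

end Order

section EvenOff

variable {L : Type*} [Field L]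

/-- `x` has even order at every discrete valuation of `L` for which `2` is a unit. -/
def EvenOff (x : L) : Prop :=
  ∀ w : Valuation L ℤᵐ⁰, w 2 = 1 → ∃ k : ℤ, w x = exp (2 * k)

theorem exists_exp_two_mul_of_sq {w : Valuation L ℤᵐ⁰} {x : L} {r : ℤᵐ⁰} (hx : x ≠ 0)
    (h : w x = r ^ 2) : ∃ k : ℤ, w x = exp (2 * k) := by
  have hr : r ≠ 0 := by
    rintro rfl
    exact (Valuation.ne_zero_iff w).2 hx (by simpa using h)
  refine ⟨log r, ?_⟩
  rw [h, two_mul, exp_add, exp_log hr, sq]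

theorem evenOff_of_curve {x y a b : L} (hx : x ≠ 0) (hxy : y ^ 2 = x * (x ^ 2 + a * x + b))
    (ha : ∀ w : Valuation L ℤᵐ⁰, w 2 = 1 → w a ≤ 1)
    (hb : ∀ w : Valuation L ℤᵐ⁰, w 2 = 1 → w b = 1) : EvenOff x := by
  intro w hw
  have hx0 : w x ≠ 0 := (Valuation.ne_zero_iff w).2 hx
  have hy := congrArg w hxy
  rw [map_pow, map_mul] at hy
  rcases lt_trichotomy (w x) 1 with hlt | heq | hgt
  · have h1 : w (x ^ 2 + a * x) < w b := by
      rw [hb w hw]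
      refine Valuation.map_add_lt w ?_ ?_
      · rw [map_pow]; exact pow_lt_one₀ zero_le hlt two_ne_zero
      · rw [map_mul]; exact lt_of_le_of_lt (mul_le_of_le_one_left' (ha w hw)) hlt
    rw [Valuation.map_add_eq_of_lt_right w h1, hb w hw, mul_one] at hy
    exact exists_exp_two_mul_of_sq hx hy.symm
  · exact ⟨0, by simpa using heq⟩
  · have h1 : w (a * x + b) < w (x ^ 2) := by
      rw [map_pow]
      have h2 : w x < w x ^ 2 := by
        rw [sq]; exact lt_mul_of_one_lt_left (zero_lt_iff.2 hx0) hgt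
      refine Valuation.map_add_lt w ?_ ?_
      · rw [map_mul]; exact lt_of_le_of_lt (mul_le_of_le_one_left' (ha w hw)) h2
      · rw [hb w hw]; exact hgt.trans h2
    rw [add_assoc, Valuation.map_add_eq_of_lt_left w h1, map_pow] at hy
    refine exists_exp_two_mul_of_sq (r := w y / w x) hx ?_
    rw [div_pow, hy]
    field_simp

theorem EvenOff.mul {x y : L} (hx : EvenOff x) (hy : EvenOff y) : EvenOff (x * y) := by
  intro w hw
  obtain ⟨k, hk⟩ := hx w hw
  obtain ⟨l, hl⟩ := hy w hw
  exact ⟨k + l, by rw [map_mul, hk, hl, ← exp_add, mul_add]⟩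

end EvenOff

section UnitAwayFromTwo

variable {L : Type*} [Field L] {t : L} (ht : t ^ 4 = 1 - 2 * t ^ 2) {w : Valuation L ℤᵐ⁰}
  (hw : w 2 = 1)
include ht hw

theorem valuation_eq_one_of_pow_four : w t = 1 := by
  have h : t ^ 2 * (t ^ 2 + 2) = 1 := by linear_combination ht
  have h' := congrArg w h
  rw [map_mul, map_pow, map_one] at h'
  rcases lt_trichotomy (w t) 1 with hlt | heq | hgt
  · exfalso
    have h1 : w t ^ 2 < 1 := pow_lt_one₀ zero_le hlt (by norm_num)
    have h2 : w (t ^ 2) < w 2 := by rwa [map_pow, hw]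
    rw [Valuation.map_add_eq_of_lt_right w h2, hw, mul_one] at h'
    exact h1.ne h'
  · exact heq
  · exfalso
    have h1 : 1 < w t ^ 2 := one_lt_pow₀ hgt (by norm_num)
    have h2 : w 2 < w (t ^ 2) := by rwa [map_pow, hw]
    rw [Valuation.map_add_eq_of_lt_left w h2, map_pow] at h'
    exact (one_lt_mul'' h1 h1).ne' h'

theorem valuation_one_add_sq_eq_one : w (1 + t ^ 2) = 1 := by
  have h' := congrArg w (show (1 + t ^ 2) ^ 2 = 2 by linear_combination ht)
  rw [map_pow, hw] at h'
  exact (pow_eq_one_iff_of_nonneg zero_le (by norm_num)).1 h'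

theorem valuation_one_sub_eq_one : w (1 - t) = 1 := by
  have h1 := valuation_eq_one_of_pow_four ht hw
  have h2 : w (1 - t) * w (1 + t) = 1 := by
    rw [← map_mul, show (1 - t) * (1 + t) = (1 + t ^ 2) * t ^ 2 by linear_combination -ht, map_mul,
      map_pow, valuation_one_add_sq_eq_one ht hw, h1]
    simp
  refine le_antisymm (Valuation.map_sub_le (v := w) (by rw [map_one]) h1.le) ?_
  rw [← h2]
  exact mul_le_of_le_one_right' (Valuation.map_add_le w (by simp) h1.le)

end UnitAwayFromTwo

/-- The arithmetic of the quartic field `L = ℚ(√(√2 - 1))` needed for the descent: a generator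
`τ`, the valuation over `2`, two real embeddings, and representatives for the classes of elements
that have even order away from `2`, modulo squares. -/
structure QuarticData (L : Type*) [Field L] where
  τ : L
  τ_pow : τ ^ 4 = 1 - 2 * τ ^ 2
  v : Valuation L ℤᵐ⁰
  v_two : v 2 = exp (-4)
  v_one_sub : v (1 - τ) = exp (-1)
  residue : ∀ z, v z = 1 → v (z - 1) < 1
  p : L →+* ℝ
  q : L →+* ℝ
  p_pos : 0 < p τ
  q_neg : q τ < 0
  exists_class : ∀ x : L, x ≠ 0 → EvenOff x → ∃ i < 2, ∃ j < 2, ∃ k < 2, ∃ l < 2, ∃ z : L, z ≠ 0 ∧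
    x = (-1) ^ i * τ ^ j * ((1 + τ) / (1 - τ)) ^ k * (1 - τ) ^ l * z ^ 2

namespace QuarticData

variable {L : Type*} [Field L] (D : QuarticData L)

/-- The unit `(1 + τ) / (1 - τ)`. -/
def ε : L := (1 + D.τ) / (1 - D.τ)

/-- The square root `1 + τ²` of `2`. -/
def θ : L := 1 + D.τ ^ 2

theorem θ_sq : D.θ ^ 2 = 2 := by
  rw [θ]; linear_combination D.τ_pow

theorem ord_two : OrdEq D.v 4 (2 : L) := D.v_two

theorem ord_four : OrdEq D.v 8 (4 : L) := by
  have := D.ord_two.sq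
  norm_num at this
  exact this

theorem ord_one_sub : OrdEq D.v 1 (1 - D.τ) := D.v_one_sub

theorem ord_one_add : OrdEq D.v 1 (1 + D.τ) := by
  have := D.ord_one_sub.neg.add D.ord_two (by norm_num)
  convert this using 1; ring

theorem ord_τ : OrdEq D.v 0 D.τ := by
  have := ordEq_one.add D.ord_one_sub.neg (by norm_num)
  convert this using 1; ring

theorem ord_θ : OrdEq D.v 2 D.θ := by
  have h := D.ord_two
  rw [← D.θ_sq] at h
  obtain ⟨n, hn, h⟩ := h.of_sq
  exact h.cast (by omega)

theorem τ_ne_zero : D.τ ≠ 0 := D.ord_τ.ne_zero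
theorem one_sub_ne_zero : 1 - D.τ ≠ 0 := D.ord_one_sub.ne_zero
theorem one_add_ne_zero : 1 + D.τ ≠ 0 := D.ord_one_add.ne_zero

theorem ord_ε : OrdEq D.v 0 D.ε := (D.ord_one_add.div D.ord_one_sub).cast (by norm_num)

theorem ord_ε_sub_one : OrdEq D.v 3 (D.ε - 1) := by
  have h := ((D.ord_two.mul D.ord_τ).div D.ord_one_sub).cast (show _ = (3 : ℤ) by norm_num)
  convert h using 1
  have := D.one_sub_ne_zero
  rw [ε]; field_simp; ring

theorem ord_neg_ε_sub_one : OrdEq D.v 3 (-D.ε - 1) := by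
  have h := (D.ord_two.div D.ord_one_sub).neg.cast (show _ = (3 : ℤ) by norm_num)
  convert h using 1
  have := D.one_sub_ne_zero
  rw [ε]; field_simp; ring

theorem ord_τ_ε_sub_one : OrdEq D.v 1 (D.τ * D.ε - 1) := by
  have h1 := (D.ord_one_sub.mul D.ord_one_add).neg.add (D.ord_two.mul D.ord_τ) (by norm_num)
  have h := (h1.div D.ord_one_sub).cast (show _ = (1 : ℤ) by norm_num)
  convert h using 1
  have := D.one_sub_ne_zero
  rw [ε]; field_simp; ring

theorem ord_neg_τ_ε_sub_one : OrdEq D.v 1 (-(D.τ * D.ε) - 1) := by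
  have h := (D.ord_θ.div D.ord_one_sub).neg.cast (show _ = (1 : ℤ) by norm_num)
  convert h using 1
  have := D.one_sub_ne_zero
  rw [ε, θ]; field_simp; ring

section Places

variable {w : Valuation L ℤᵐ⁰} (hw : w 2 = 1)
include hw

theorem place_τ : w D.τ = 1 := valuation_eq_one_of_pow_four D.τ_pow hw

theorem place_θ : w D.θ = 1 := valuation_one_add_sq_eq_one D.τ_pow hw

theorem place_one_sub : w (1 - D.τ) = 1 := valuation_one_sub_eq_one D.τ_pow hw

theorem place_one_add : w (1 + D.τ) = 1 := by
  have h := valuation_one_sub_eq_one (t := -D.τ) (by linear_combination D.τ_pow) hw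
  rwa [sub_neg_eq_add] at h

theorem place_ε : w D.ε = 1 := by
  rw [ε, map_div₀, D.place_one_add hw, D.place_one_sub hw, div_one]

end Places

section Real

theorem real_bounds (f : L →+* ℝ) : 0 < f (1 + D.τ) ∧ 0 < f (1 - D.τ) := by
  have h := congrArg f D.τ_pow
  simp only [map_add, map_sub, map_one, map_mul, map_pow, map_ofNat] at h ⊢
  have h1 : f D.τ ^ 2 < 1 := by nlinarith [sq_nonneg (f D.τ), sq_nonneg (f D.τ ^ 2)]
  have := abs_lt.1 ((sq_lt_one_iff_abs_lt_one _).1 h1)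
  constructor <;> linarith

theorem real_ε (f : L →+* ℝ) : 0 < f D.ε := by
  rw [ε, map_div₀]
  exact div_pos (D.real_bounds f).1 (D.real_bounds f).2

theorem exists_class_of_pos {x : L} (hx : x ≠ 0) (he : EvenOff x) (hp : 0 < D.p x)
    (hq : 0 < D.q x) : ∃ k < 2, ∃ l < 2, ∃ z : L, z ≠ 0 ∧
      x = D.ε ^ k * (1 - D.τ) ^ l * z ^ 2 := by
  obtain ⟨i, hi, j, hj, k, hk, l, hl, z, hz, h⟩ := D.exists_class x hx he
  change x = (-1) ^ i * D.τ ^ j * D.ε ^ k * (1 - D.τ) ^ l * z ^ 2 at h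
  have key : ∀ f : L →+* ℝ, 0 < f x → 0 < (-1) ^ i * f D.τ ^ j := by
    intro f hf
    rw [h] at hf
    simp only [map_mul, map_pow, map_neg, map_one] at hf
    have h1 := pow_pos (D.real_ε f) k
    have h2 := pow_pos (D.real_bounds f).2 l
    have h3 : 0 < f z ^ 2 := by have := (map_ne_zero f).2 hz; positivity
    exact pos_of_mul_pos_left (pos_of_mul_pos_left (pos_of_mul_pos_left hf h3.le) h2.le) h1.le
  have hP := key D.p hp
  have hQ := key D.q hq
  have := D.p_pos
  have := D.q_neg
  refine ⟨k, hk, l, hl, z, hz, ?_⟩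
  interval_cases i <;> interval_cases j
  · simpa using h
  all_goals (exfalso; simp at hP hQ; linarith)

end Real

theorem not_near_one {W d u : L} {k : ℤ} (hW : OrdGe D.v 5 (W - 1)) (hd : OrdEq D.v 0 d)
    (hk : OrdEq D.v k (d - 1)) (hk' : k = 1 ∨ k = 3) (h : W = d * u ^ 2) : False := by
  have h1 : OrdEq D.v k ((d - 1) + -(W - 1)) := hk.add_ge hW.neg (by omega)
  have h2 : u ^ 2 - 1 = -(((d - 1) + -(W - 1)) / d) := by
    have := hd.ne_zero
    rw [h]; field_simp; ring
  have h3 := (h1.div hd).neg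
  rw [← h2] at h3
  have := ordEq_sq_sub_one D.residue D.ord_two (by omega) h3
  omega

/-- The conditions on the coefficients of a curve `y² = x (x² + a x + ε f²)` under which the orders
of its points at the place over `2` are controlled. -/
structure CurveData (a f c : L) : Prop where
  ord_a : OrdEq D.v 5 a
  ord_f : OrdEq D.v 4 f
  ord_c : OrdEq D.v 5 c
  disc : a ^ 2 - 4 * (D.ε * f ^ 2) = -c ^ 2
  place_a : ∀ w : Valuation L ℤᵐ⁰, w 2 = 1 → w a ≤ 1
  place_f : ∀ w : Valuation L ℤᵐ⁰, w 2 = 1 → w f = 1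
  place_c : ∀ w : Valuation L ℤᵐ⁰, w 2 = 1 → w c = 1

namespace CurveData

variable {D} {a f c : L} (C : D.CurveData a f c)
include C

theorem ord_b : OrdEq D.v 8 (D.ε * f ^ 2) := (D.ord_ε.mul C.ord_f.sq).cast (by norm_num)

theorem real_pos {x y : L} (hx : x ≠ 0) (h : y ^ 2 = x * (x ^ 2 + a * x + D.ε * f ^ 2))
    (g : L →+* ℝ) : 0 < g x := by
  have h1 : 4 * (x ^ 2 + a * x + D.ε * f ^ 2) = (2 * x + a) ^ 2 + c ^ 2 := by
    linear_combination -C.disc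
  have h2 := congrArg g h
  have h3 := congrArg g h1
  have hc : g c ≠ 0 := (map_ne_zero g).2 C.ord_c.ne_zero
  have hx' : g x ≠ 0 := (map_ne_zero g).2 hx
  rw [map_mul] at h2
  set W := g (x ^ 2 + a * x + D.ε * f ^ 2) with hW
  simp only [map_add, map_mul, map_pow, map_ofNat, ← hW] at h2 h3
  have h4 : 0 < W := by
    have : 4 * W = (2 * g x + g a) ^ 2 + g c ^ 2 := by rw [← h3, hW]
    have := sq_nonneg (2 * g x + g a)
    have : 0 < g c ^ 2 := by positivity
    linarith
  have h5 : 0 ≤ g x := by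
    by_contra! h6
    nlinarith [sq_nonneg (g y), mul_neg_of_neg_of_pos h6 h4]
  exact lt_of_le_of_ne h5 hx'.symm

theorem evenOff {x y : L} (hx : x ≠ 0) (h : y ^ 2 = x * (x ^ 2 + a * x + D.ε * f ^ 2)) :
    EvenOff x :=
  evenOff_of_curve hx h C.place_a fun w hw => by
    rw [map_mul, map_pow, D.place_ε hw, C.place_f w hw]; simp

theorem isSquare_of_ord {x y : L} {n : ℤ} (hn : 0 ≤ n) (hx : OrdEq D.v (-n) x)
    (h : y ^ 2 = x * (x ^ 2 + a * x + D.ε * f ^ 2)) :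
    Even n ∧ 4 ≤ n ∧ ∃ s, x = s ^ 2 := by
  have hx0 := hx.ne_zero
  have hax := C.ord_a.div hx
  have hbx := C.ord_b.div hx.sq
  have hW := hax.add hbx (by linarith)
  have hW1 := hx.mul ((ordEq_one.add hW (by linarith)).mul hx.sq)
  have hy2 : x * ((1 + (a / x + D.ε * f ^ 2 / x ^ 2)) * x ^ 2) = y ^ 2 := by
    rw [h]; field_simp; ring
  rw [hy2] at hW1
  obtain ⟨j, hj, -⟩ := hW1.of_sq
  have hev : Even n := ⟨-j - n, by linarith⟩
  obtain ⟨k, hk, l, hl, z, hz, hxz⟩ := D.exists_class_of_pos hx0 (C.evenOff hx0 h)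
    (C.real_pos hx0 h D.p) (C.real_pos hx0 h D.q)
  have hl0 : l = 0 := by
    by_contra hl0
    obtain rfl : l = 1 := by omega
    obtain ⟨i, hi⟩ := exists_ordEq D.v hz
    have := ((D.ord_ε.pow k).mul (D.ord_one_sub.pow 1)).mul hi.sq
    rw [← hxz] at this
    have := hx.unique this
    obtain ⟨m, hm⟩ := hev
    push_cast at this
    omega
  subst hl0
  have hy1 : (1 + (a / x + D.ε * f ^ 2 / x ^ 2)) * x = (y / x) ^ 2 := by
    rw [div_pow, h]; field_simp; ring
  have hε := D.ord_ε.ne_zero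
  interval_cases k
  · simp only [pow_zero, one_mul] at hxz
    refine ⟨hev, ?_, z, hxz⟩
    have hsq : (y / x / z) ^ 2 - 1 = a / x + D.ε * f ^ 2 / x ^ 2 := by
      rw [div_pow (y / x), ← hxz, ← hy1]; field_simp; ring
    rw [← hsq] at hW
    have := ordEq_sq_sub_one D.residue D.ord_two (by linarith) hW
    obtain ⟨m, hm⟩ := hev
    omega
  · exfalso
    simp only [pow_one, pow_zero, mul_one] at hxz
    refine D.not_near_one (W := 1 + (a / x + D.ε * f ^ 2 / x ^ 2)) (d := D.ε)
      (u := y / x / (D.ε * z)) ?_ D.ord_ε D.ord_ε_sub_one (Or.inr rfl) ?_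
    · rw [add_sub_cancel_left]; exact hW.ge (by linarith)
    · rw [div_pow (y / x), ← hy1]
      generalize 1 + (a / x + D.ε * f ^ 2 / x ^ 2) = W
      rw [hxz]
      field_simp

theorem isSquare_of_mul_eq {s X : L} {m : ℤ} (hm : m ≤ 4) (hme : Even m) (hX : OrdEq D.v m X)
    (h : (2 * s * X) ^ 2 = X * (X ^ 2 - 2 * a * X - c ^ 2)) :
    ∃ r, r ^ 2 = X ∨ r ^ 2 = -c ^ 2 / X := by
  have hX0 := hX.ne_zero
  have hev : EvenOff X := by
    refine evenOff_of_curve (y := 2 * s * X) (a := -(2 * a)) (b := -c ^ 2) hX0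
      (by rw [h]; ring) ?_ ?_
    · intro w hw
      rw [Valuation.map_neg, map_mul, hw, one_mul]; exact C.place_a w hw
    · intro w hw
      rw [Valuation.map_neg, map_pow, C.place_c w hw, one_pow]
  obtain ⟨i, hi, j, hj, k, hk, l, hl, z, hz, hXz⟩ := D.exists_class X hX0 hev
  change X = (-1) ^ i * D.τ ^ j * D.ε ^ k * (1 - D.τ) ^ l * z ^ 2 at hXz
  have hl0 : l = 0 := by
    by_contra hl0
    obtain rfl : l = 1 := by omega
    obtain ⟨e, he⟩ := exists_ordEq D.v hz
    have := (((((ordEq_one (v := D.v)).neg.pow i).mul (D.ord_τ.pow j)).mul (D.ord_ε.pow k)).mul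
      (D.ord_one_sub.pow 1)).mul he.sq
    rw [← hXz] at this
    have := hX.unique this
    obtain ⟨m, hm⟩ := hme
    push_cast at this
    omega
  subst hl0
  have hκ := C.ord_c.div hX
  have hκ1 := ordEq_one.add hκ.neg (by linarith)
  set κ := c / X with hκdef
  have hκ10 := hκ1.ne_zero
  set W := (2 * s) ^ 2 / X / (1 + -κ) ^ 2 with hW
  have hnear : OrdGe D.v 5 (W - 1) := by
    have h1 : OrdGe D.v 5 (-(2 * (a / X)) - 2 * κ ^ 2 + 2 * κ) := by
      refine OrdGe.add (OrdGe.sub ?_ ?_) ?_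
      · exact (D.ord_two.mul (C.ord_a.div hX)).neg.ge (by linarith)
      · exact (D.ord_two.mul hκ.sq).ge (by linarith)
      · exact (D.ord_two.mul hκ).ge (by linarith)
    have h2 : W - 1 = (-(2 * (a / X)) - 2 * κ ^ 2 + 2 * κ) * (1 / (1 + -κ) ^ 2) := by
      have h3 : (2 * s) ^ 2 / X = 1 - 2 * (a / X) - κ ^ 2 := by
        rw [hκdef]; field_simp
        refine mul_left_cancel₀ hX0 ?_
        linear_combination h
      rw [hW, h3]; field_simp; ring
    rw [h2]
    have := h1.mul ((ordEq_one.div hκ1.sq).ge (m := 0) (by norm_num))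
    simpa using this
  have hWd : ∀ d : L, X = d * z ^ 2 → d ≠ 0 → W = d * (2 * s / (d * z * (1 + -κ))) ^ 2 := by
    intro d hd hd0
    rw [hW, hd]; field_simp
  have hτ := D.τ_ne_zero
  have hε := D.ord_ε.ne_zero
  have excl : ∀ (d : L) (e : ℤ), X = d * z ^ 2 → OrdEq D.v 0 d → OrdEq D.v e (d - 1) →
      (e = 1 ∨ e = 3) → False := fun d e hd hd0 hd1 he =>
    D.not_near_one hnear hd0 hd1 he (hWd d hd hd0.ne_zero)
  have hτ1 : OrdEq D.v 1 (D.τ - 1) := by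
    have := D.ord_one_sub.neg; rwa [neg_sub] at this
  have hτ2 : OrdEq D.v 1 (-D.τ - 1) := by
    have := D.ord_one_add.neg; rwa [neg_add_rev, ← sub_eq_add_neg] at this
  have hτε : OrdEq D.v 0 (D.τ * D.ε) := D.ord_τ.mul D.ord_ε
  interval_cases i <;> interval_cases j <;> interval_cases k <;>
    simp only [pow_zero, pow_one, one_mul, mul_one, neg_mul] at hXz
  · exact ⟨z, Or.inl hXz.symm⟩
  · exact (excl _ 3 (by rw [hXz]) D.ord_ε D.ord_ε_sub_one (Or.inr rfl)).elim
  · exact (excl _ 1 (by rw [hXz]) D.ord_τ hτ1 (Or.inl rfl)).elim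
  · exact (excl _ 1 (by rw [hXz]) hτε D.ord_τ_ε_sub_one (Or.inl rfl)).elim
  · refine ⟨c / z, Or.inr ?_⟩
    rw [hXz]; field_simp
  · exact (excl (-D.ε) 3 (by rw [hXz]; ring) D.ord_ε.neg D.ord_neg_ε_sub_one (Or.inr rfl)).elim
  · exact (excl (-D.τ) 1 (by rw [hXz]; ring) D.ord_τ.neg hτ2 (Or.inl rfl)).elim
  · exact (excl (-(D.τ * D.ε)) 1 (by rw [hXz]; ring) hτε.neg D.ord_neg_τ_ε_sub_one
      (Or.inl rfl)).elim

theorem no_point_of_ord_four {T r : L} {m : ℤ} (hm : Even m) (hr : OrdEq D.v m (r ^ 2))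
    (hT : OrdEq D.v 4 T) (h : r ^ 2 * T = T ^ 2 + a * T + D.ε * f ^ 2) : False := by
  have hg := hT.div C.ord_f
  have hf := C.ord_f.ne_zero
  have h1 := hg.sub_self_ge D.residue (ordEq_one.cast (by norm_num))
  have h2 : OrdGe D.v 1 (T / f + 1) := by
    have : T / f + 1 = (T / f - 1) + 2 := by ring
    rw [this]
    exact (h1.mono (by norm_num)).add (D.ord_two.ge (by norm_num))
  have h3 : OrdGe D.v 2 ((T / f - 1) * (T / f + 1) + (D.ε - 1) + 2) :=
    (((h1.mul h2).mono (by norm_num)).add (D.ord_ε_sub_one.ge (by norm_num))).add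
      (D.ord_two.ge (by norm_num))
  have h4 : OrdGe D.v 10 (T ^ 2 + D.ε * f ^ 2) := by
    have : T ^ 2 + D.ε * f ^ 2 = f ^ 2 * ((T / f - 1) * (T / f + 1) + (D.ε - 1) + 2) := by
      field_simp; ring
    rw [this]
    exact ((C.ord_f.sq.ge le_rfl).mul h3).mono (by norm_num)
  have h5 := (C.ord_a.mul hT).add_ge h4 (by norm_num)
  have h6 : a * T + (T ^ 2 + D.ε * f ^ 2) = r ^ 2 * T := by rw [h]; ring
  rw [h6] at h5
  have := h5.unique (hr.mul hT)
  obtain ⟨k, hk⟩ := hm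
  omega

/-- Descent by the `2`-isogeny and its dual. -/
theorem exists_smaller {s y : L} {n : ℤ} (hn : 4 ≤ n) (hne : Even n) (hs : OrdEq D.v (-n) (s ^ 2))
    (h : y ^ 2 = s ^ 2 * ((s ^ 2) ^ 2 + a * s ^ 2 + D.ε * f ^ 2)) :
    ∃ T u, OrdEq D.v (8 - n) T ∧ n ≠ 4 ∧ u ^ 2 = T * (T ^ 2 + a * T + D.ε * f ^ 2) := by
  have hs0 : s ≠ 0 := fun h0 => hs.ne_zero (by rw [h0]; ring)
  have h20 := D.ord_two.ne_zero
  have hc0 := C.ord_c.ne_zero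
  obtain ⟨q, rfl⟩ : ∃ q, y = q * s := ⟨y / s, by field_simp⟩
  have hq : q ^ 2 = (s ^ 2) ^ 2 + a * s ^ 2 + D.ε * f ^ 2 := by
    refine mul_left_cancel₀ (pow_ne_zero 2 hs0) ?_
    rw [← h]; ring
  have hprod : (2 * s ^ 2 + a + 2 * q) * (2 * s ^ 2 + a - 2 * q) = -c ^ 2 := by
    linear_combination C.disc - 4 * hq
  have hord := C.ord_c.sq.neg
  rw [← hprod] at hord
  have hsum := (D.ord_four.mul hs).add (D.ord_two.mul C.ord_a) (by linarith)
  have hsum' : 4 * s ^ 2 + 2 * a = (2 * s ^ 2 + a + 2 * q) + (2 * s ^ 2 + a - 2 * q) := by ring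
  rw [hsum'] at hsum
  have hX1 : 2 * s ^ 2 + a + 2 * q ≠ 0 := fun h0 => hord.ne_zero (by rw [h0, zero_mul])
  have hX2 : 2 * s ^ 2 + a - 2 * q ≠ 0 := fun h0 => hord.ne_zero (by rw [h0, mul_zero])
  obtain ⟨m1, hm1⟩ := exists_ordEq D.v hX1
  obtain ⟨m2, hm2⟩ := exists_ordEq D.v hX2
  have hm := hord.unique (hm1.mul hm2)
  obtain ⟨q', hq', hX⟩ : ∃ q', q' ^ 2 = q ^ 2 ∧ OrdEq D.v (8 - n) (2 * s ^ 2 + a + 2 * q') := by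
    rcases lt_trichotomy m1 m2 with hlt | heq | hgt
    · exact ⟨q, rfl, hm1.cast (by have := hsum.unique (hm1.add hm2 hlt); omega)⟩
    · subst heq
      have := hsum.le (hm1.add_self_ge D.residue hm2)
      omega
    · refine ⟨-q, by ring, ?_⟩
      have := hm2.cast (by have := hsum.unique (hm1.add' hm2 hgt); omega : m2 = 8 - n)
      convert this using 1; ring
  rw [← hq'] at hq
  clear hprod hord hsum hsum' hX1 hX2 hm1 hm2 hm
  set X := 2 * s ^ 2 + a + 2 * q' with hXdef
  have hX0 := hX.ne_zero
  have hmev : Even (8 - n) := by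
    obtain ⟨k, hk⟩ := hne; exact ⟨4 - k, by omega⟩
  have hXeq : X ^ 2 - 2 * a * X - c ^ 2 = 4 * s ^ 2 * X := by
    rw [hXdef]; linear_combination 4 * hq - C.disc
  obtain ⟨r, hr⟩ := C.isSquare_of_mul_eq (s := s) (by omega) hmev hX (by rw [hXeq]; ring)
  have hr4 : r ^ 4 - 2 * a * r ^ 2 - c ^ 2 = (2 * s * r) ^ 2 := by
    rcases hr with hr | hr
    · have : r ^ 4 = X ^ 2 := by rw [← hr]; ring
      rw [this, mul_pow, hr]; linear_combination hXeq
    · have h1 : r ^ 4 = (-c ^ 2 / X) ^ 2 := by rw [← hr]; ring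
      rw [h1, mul_pow, hr]; field_simp; linear_combination -hXeq
  have hr0 : r ≠ 0 := by
    rintro rfl
    rcases hr with hr | hr
    · exact hX0 (by rw [← hr]; ring)
    · have : c ^ 2 / X = 0 := by linear_combination hr
      exact div_ne_zero (pow_ne_zero 2 hc0) hX0 this
  have hTmul : (r ^ 2 - a + 2 * s * r) / 2 * ((r ^ 2 - a - 2 * s * r) / 2) = D.ε * f ^ 2 := by
    have : (4 : L) ≠ 0 := D.ord_four.ne_zero
    refine mul_left_cancel₀ this ?_
    field_simp
    linear_combination hr4 + C.disc
  have hTadd : (r ^ 2 - a + 2 * s * r) / 2 + (r ^ 2 - a - 2 * s * r) / 2 = r ^ 2 - a := by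
    field_simp; ring
  generalize (r ^ 2 - a + 2 * s * r) / 2 = T at hTmul hTadd
  generalize (r ^ 2 - a - 2 * s * r) / 2 = T' at hTmul hTadd
  have hT1 : r ^ 2 * T = T ^ 2 + a * T + D.ε * f ^ 2 := by
    rw [← hTmul]; linear_combination -T * hTadd
  have hT2 : r ^ 2 * T' = T' ^ 2 + a * T' + D.ε * f ^ 2 := by
    rw [← hTmul]; linear_combination -T' * hTadd
  have hb := C.ord_b
  rw [← hTmul] at hb
  obtain ⟨t, ht⟩ := exists_ordEq D.v (fun h0 : T = 0 => hb.ne_zero (by rw [h0, zero_mul]))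
  obtain ⟨t', ht'⟩ := exists_ordEq D.v (fun h0 : T' = 0 => hb.ne_zero (by rw [h0, mul_zero]))
  have htt := hb.unique (ht.mul ht')
  rcases hr with hr | hr
  · have hrX := hX
    rw [← hr] at hrX
    have hsum := hrX.add C.ord_a.neg (by linarith)
    rw [← sub_eq_add_neg, ← hTadd] at hsum
    rcases lt_trichotomy t t' with hlt | heq | hgt
    · have := hsum.unique (ht.add ht' hlt)
      exact ⟨T, r * T, ht.cast this.symm, by omega, by rw [← hT1]; ring⟩
    · subst heq
      have := hsum.le (ht.add_self_ge D.residue ht')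
      omega
    · have := hsum.unique (ht.add' ht' hgt)
      exact ⟨T', r * T', ht'.cast this.symm, by omega, by rw [← hT2]; ring⟩
  · exfalso
    have hrX := C.ord_c.sq.neg.div hX
    rw [← hr] at hrX
    have hsum := hrX.add' C.ord_a.neg (by linarith)
    rw [← sub_eq_add_neg, ← hTadd] at hsum
    have h4 : t = 4 := by
      rcases lt_trichotomy t t' with hlt | heq | hgt
      · have := hsum.unique (ht.add ht' hlt); omega
      · omega
      · have := hsum.unique (ht.add' ht' hgt); omega
    subst h4
    refine C.no_point_of_ord_four ?_ hrX ht hT1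
    obtain ⟨k, hk⟩ := hne
    exact ⟨k + 1, by omega⟩

theorem ord_mod_eight (n : ℕ) : ∀ x y : L, OrdEq D.v (-n) x →
    y ^ 2 = x * (x ^ 2 + a * x + D.ε * f ^ 2) → n % 8 = 6 := by
  induction n using Nat.strong_induction_on with
  | _ n ih =>
    intro x y hx h
    obtain ⟨hev, h4, s, rfl⟩ := C.isSquare_of_ord (by positivity) hx h
    obtain ⟨T, u, hT, hn4, hTu⟩ := C.exists_smaller h4 hev hx h
    by_cases h8 : n < 8
    · obtain ⟨k, hk⟩ := hev
      omega
    · have := ih (n - 8) (by omega) T u (hT.cast (by omega)) hTu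
      omega

end CurveData

end QuarticData

/-- The third intersection point of a line with a cubic `y² = x (x² + a x + b)`. -/
theorem third_point {L : Type*} [Field L] {a b x₀ y₀ x₁ ℓ : L} (hx : x₁ - x₀ ≠ 0)
    (h₀ : y₀ ^ 2 = x₀ * (x₀ ^ 2 + a * x₀ + b))
    (h₁ : (ℓ * (x₁ - x₀) + y₀) ^ 2 = x₁ * (x₁ ^ 2 + a * x₁ + b)) :
    (ℓ * (ℓ ^ 2 - a - x₀ - x₁ - x₀) + y₀) ^ 2 = (ℓ ^ 2 - a - x₀ - x₁) *
      ((ℓ ^ 2 - a - x₀ - x₁) ^ 2 + a * (ℓ ^ 2 - a - x₀ - x₁) + b) := by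
  refine mul_left_cancel₀ hx ?_
  linear_combination (x₁ - (ℓ ^ 2 - a - x₀ - x₁)) * h₀ + ((ℓ ^ 2 - a - x₀ - x₁) - x₀) * h₁

theorem Valuation.map_intCast_le {L : Type*} [Field L] (w : Valuation L ℤᵐ⁰) (n : ℤ) :
    w (n : L) ≤ 1 := intCast_mem w.integer n

namespace QuarticData

variable {L : Type*} [Field L] (D : QuarticData L)

theorem ord_of_odd {n : ℤ} (hn : Odd n) : OrdEq D.v 0 (n : L) := by
  obtain ⟨j, rfl⟩ := hn
  have h1 : OrdGe D.v 0 (j : L) := by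
    rw [OrdGe]; simpa using D.v.map_intCast_le j
  have := (((D.ord_two.ge le_rfl).mul h1).mono (show 1 ≤ (4 + 0 : ℤ) by norm_num)).add_eq
    (ordEq_one (v := D.v)) (by norm_num)
  simpa using this

theorem exists_ord_int {n : ℤ} (hn : n ≠ 0) (he : Even n) :
    ∃ k : ℤ, 1 ≤ k ∧ OrdEq D.v (4 * k) (n : L) := by
  obtain ⟨k, m, hm, h⟩ := Nat.exists_eq_two_pow_mul_odd (Int.natAbs_ne_zero.2 hn)
  have hk : k ≠ 0 := by
    rintro rfl
    rw [← Int.natAbs_even] at he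
    rw [h, pow_zero, one_mul] at he
    exact (Nat.not_even_iff_odd.2 hm) he
  have h1 : OrdEq D.v (4 * k) ((n.natAbs : ℤ) : L) := by
    rw [h]
    have := (D.ord_two.pow k).mul (D.ord_of_odd (n := m) (by exact_mod_cast hm))
    push_cast
    push_cast at this
    exact this.cast (by ring)
  refine ⟨k, by omega, ?_⟩
  rcases Int.natAbs_eq n with h2 | h2
  · rwa [← h2] at h1
  · rw [h2, Int.cast_neg]; exact h1.neg

/-- A square root `ρ` of `√2 ∓ 1` in `L` together with its inverse `σ`. -/
structure Root (ρ σ : L) : Prop where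
  mul_eq : ρ * σ = 1
  add_eq : ρ ^ 2 + σ ^ 2 = 2 * D.θ
  ord : OrdEq D.v 0 ρ
  ord_one_sub : OrdEq D.v 1 (1 - ρ)
  place : ∀ w : Valuation L ℤᵐ⁰, w 2 = 1 → w ρ = 1

theorem root_τ : D.Root D.τ D.τ⁻¹ := by
  have := D.τ_ne_zero
  refine ⟨mul_inv_cancel₀ this, ?_, D.ord_τ, D.ord_one_sub, fun w hw => D.place_τ hw⟩
  rw [θ]; field_simp; linear_combination -D.τ_pow

theorem root_inv_τ : D.Root D.τ⁻¹ D.τ := by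
  have := D.τ_ne_zero
  refine ⟨inv_mul_cancel₀ this, by rw [add_comm]; exact D.root_τ.add_eq, ?_, ?_, fun w hw => ?_⟩
  · have := (ordEq_one (v := D.v)).div D.ord_τ
    simpa using this
  · have h := (D.ord_one_sub.div D.ord_τ).neg
    rwa [← neg_div, neg_sub, sub_div, div_self this, one_div, sub_zero] at h
  · rw [map_inv₀, D.place_τ hw, inv_one]

namespace Root

variable {D} {ρ σ : L} (R : D.Root ρ σ)
include R

theorem ord_inv : OrdEq D.v 0 σ := by
  have h := ordEq_one.div R.ord
  have h0 := R.ord.ne_zero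
  have : 1 / ρ = σ := by field_simp; exact R.mul_eq.symm
  rwa [this] at h

theorem place_inv {w : Valuation L ℤᵐ⁰} (hw : w 2 = 1) : w σ = 1 := by
  have := congrArg w R.mul_eq
  rwa [map_mul, R.place w hw, one_mul, map_one] at this

theorem curveData {u : L} (hu : OrdEq D.v 1 u)
    (hu' : ∀ w : Valuation L ℤᵐ⁰, w 2 = 1 → w u = 1) :
    D.CurveData (-(2 * ρ * u)) (2 * D.τ * u / (1 + D.τ)) (2 * u * σ) where
  ord_a := ((D.ord_two.mul R.ord).mul hu).neg
  ord_f := (((D.ord_two.mul D.ord_τ).mul hu).div D.ord_one_add).cast (by norm_num)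
  ord_c := ((D.ord_two.mul hu).mul R.ord_inv).cast (by norm_num)
  disc := by
    have h1 := D.one_sub_ne_zero
    have h2 := D.one_add_ne_zero
    have h3 : D.ε * (2 * D.τ * u / (1 + D.τ)) ^ 2 = 2 * D.θ * u ^ 2 := by
      rw [ε, θ]; field_simp; linear_combination 2 * u ^ 2 * D.τ_pow
    rw [h3]; linear_combination 4 * u ^ 2 * R.add_eq
  place_a w hw := by
    rw [Valuation.map_neg, map_mul, map_mul, hw, R.place w hw, hu' w hw]; simp
  place_f w hw := by
    rw [map_div₀, map_mul, map_mul, hw, D.place_τ hw, hu' w hw, D.place_one_add hw]; simp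
  place_c w hw := by
    rw [map_mul, map_mul, hw, R.place_inv hw, hu' w hw]; simp

theorem curve_eq {u t y : L} (h : y ^ 2 = u ^ 3 * (t + ρ) * (t ^ 2 + σ ^ 2)) :
    y ^ 2 = u * (t + ρ) * ((u * (t + ρ)) ^ 2 + -(2 * ρ * u) * (u * (t + ρ)) +
      D.ε * (2 * D.τ * u / (1 + D.τ)) ^ 2) := by
  have h1 := D.one_sub_ne_zero
  have h2 := D.one_add_ne_zero
  have h3 : D.ε * (2 * D.τ * u / (1 + D.τ)) ^ 2 = 2 * D.θ * u ^ 2 := by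
    rw [ε, θ]; field_simp; linear_combination 2 * u ^ 2 * D.τ_pow
  rw [h3, h]; linear_combination u ^ 3 * (t + ρ) * R.add_eq

theorem not_close {u t₀ t y₀ y : L} {k : ℤ} (hu : OrdEq D.v 1 u)
    (hu' : ∀ w : Valuation L ℤᵐ⁰, w 2 = 1 → w u = 1)
    (h₀ : y₀ ^ 2 = u ^ 3 * (t₀ + ρ) * (t₀ ^ 2 + σ ^ 2))
    (h : y ^ 2 = u ^ 3 * (t + ρ) * (t ^ 2 + σ ^ 2))
    (ht₀ : OrdEq D.v 0 t₀) (hy₀ : OrdEq D.v 3 y₀) (htρ : OrdEq D.v 1 (t₀ + ρ))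
    (hder : OrdEq D.v 2 (3 * t₀ ^ 2 + 2 * ρ * t₀ + σ ^ 2)) (hk : 3 ≤ k)
    (ht : OrdEq D.v (4 * k) (t - t₀)) : False := by
  have h3 : OrdGe D.v 0 (3 : L) := by
    have := (D.ord_of_odd (n := 3) (by decide)).ge le_rfl
    simpa using this
  have hB : OrdEq D.v 2 ((3 * t₀ ^ 2 + 2 * ρ * t₀ + σ ^ 2) +
      (t - t₀) * (3 * t₀ + ρ + (t - t₀))) := by
    have h4 : OrdGe D.v 0 (3 * t₀ + ρ + (t - t₀)) :=
      ((h3.mul (ht₀.ge le_rfl)).add (R.ord.ge le_rfl)).add (ht.ge (by linarith))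
    exact hder.add_ge ((ht.ge le_rfl).mul h4) (by linarith)
  have hdiff := ((hu.pow 3).mul ht).mul hB
  have hfac : u ^ 3 * (t - t₀) * ((3 * t₀ ^ 2 + 2 * ρ * t₀ + σ ^ 2) +
      (t - t₀) * (3 * t₀ + ρ + (t - t₀))) = (y - y₀) * (y + y₀) := by
    linear_combination h₀ - h
  rw [hfac] at hdiff
  have h2y := D.ord_two.mul hy₀
  obtain ⟨y₁, hy₁, hy₁'⟩ : ∃ y₁, y₁ ^ 2 = y₀ ^ 2 ∧ OrdEq D.v 7 (y - y₁) := by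
    obtain ⟨e, he⟩ := exists_ordEq D.v
      (fun h0 : y - y₀ = 0 => hdiff.ne_zero (by rw [h0, zero_mul]))
    obtain ⟨e', he'⟩ := exists_ordEq D.v
      (fun h0 : y + y₀ = 0 => hdiff.ne_zero (by rw [h0, mul_zero]))
    have hsum := hdiff.unique (he.mul he')
    have hplus : y + y₀ = (y - y₀) + 2 * y₀ := by ring
    rcases lt_trichotomy e 7 with hlt | rfl | hgt
    · have := he.add h2y (by linarith)
      rw [← hplus] at this
      have := this.unique he'
      push_cast at hsum
      omega
    · exact ⟨y₀, rfl, he⟩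
    · have := he.add' h2y (by linarith)
      rw [← hplus] at this
      exact ⟨-y₀, by ring, by rw [sub_neg_eq_add]; exact this⟩
  have hx : OrdEq D.v (1 + 4 * k) (u * (t + ρ) - u * (t₀ + ρ)) := by
    convert hu.mul ht using 1; ring
  have hℓ := hy₁'.div hx
  set ℓ := (y - y₁) / (u * (t + ρ) - u * (t₀ + ρ)) with hℓdef
  have hx₀ := hu.mul htρ
  have hx₁ : OrdGe D.v 2 (u * (t + ρ)) := by
    have : u * (t + ρ) = u * (t₀ + ρ) + (u * (t + ρ) - u * (t₀ + ρ)) := by ring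
    rw [this]
    exact (hx₀.ge (by norm_num)).add (hx.ge (by linarith))
  have C := R.curveData hu hu'
  rw [← hy₁] at h₀
  have hx0 := hx.ne_zero
  have hpt := third_point (ℓ := ℓ) hx0 (R.curve_eq h₀)
    (by rw [hℓdef, div_mul_cancel₀ _ hx0, sub_add_cancel]; exact R.curve_eq h)
  have hord : OrdEq D.v (12 - 8 * k)
      (ℓ ^ 2 - -(2 * ρ * u) - u * (t₀ + ρ) - u * (t + ρ)) := by
    have h1 : OrdGe D.v 2 (2 * ρ * u - u * (t₀ + ρ) - u * (t + ρ)) :=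
      ((((D.ord_two.mul R.ord).mul hu).ge (by norm_num)).sub (hx₀.ge (by norm_num))).sub hx₁
    have h2 := (hℓ.sq.add_ge h1 (by linarith)).cast (show _ = 12 - 8 * k by ring)
    convert h2 using 1; ring
  have := C.ord_mod_eight (8 * k - 12).toNat _ _ (hord.cast (by omega)) hpt
  omega

/-- The descent on the quartic curve `(t² - ρ²)(t² + σ²) = ± 2 c²`: a point in the same class as
`t₀` and congruent to it modulo `2` is equal to it. -/
theorem not_same_class {s g t₀ c₀ t c z : L} {k : ℤ} (hs : s ^ 2 = 1) (hg : OrdEq D.v 0 g)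
    (hu' : ∀ w : Valuation L ℤᵐ⁰, w 2 = 1 → w (s * (t₀ - ρ) * g ^ 2) = 1)
    (htρ : OrdEq D.v 1 (t₀ - ρ)) (ht₀ : OrdEq D.v 0 t₀) (hc₀ : OrdEq D.v 0 c₀)
    (h₀ : (t₀ ^ 2 - ρ ^ 2) * (t₀ ^ 2 + σ ^ 2) = 2 * s * c₀ ^ 2)
    (h : (t ^ 2 - ρ ^ 2) * (t ^ 2 + σ ^ 2) = 2 * s * c ^ 2)
    (hz : t - ρ = (t₀ - ρ) * z ^ 2) (hk : 1 ≤ k) (ht : OrdEq D.v (4 * k) (t - t₀)) : False := by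
  have htρ0 := htρ.ne_zero
  have hs0 : OrdEq D.v 0 s := by
    have h1 := ordEq_one (v := D.v)
    rw [← hs] at h1
    obtain ⟨n, hn, h2⟩ := h1.of_sq
    exact h2.cast (by omega)
  have hu := ((hs0.mul htρ).mul hg.sq).cast (show _ = (1 : ℤ) by norm_num)
  have hk3 : 3 ≤ k := by
    have h1 := ht.div htρ
    have h2 : (t - t₀) / (t₀ - ρ) = z ^ 2 - 1 := by
      field_simp; linear_combination hz
    rw [h2] at h1
    have := ordEq_sq_sub_one D.residue D.ord_two (by omega) h1
    omega
  have hz0 : z ≠ 0 := by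
    rintro rfl
    have h1 : t - t₀ = -(t₀ - ρ) := by linear_combination hz
    rw [h1] at ht
    have := ht.unique htρ.neg
    omega
  have htρ' : OrdEq D.v 1 (t₀ + ρ) := by
    have := htρ.add (D.ord_two.mul R.ord) (by norm_num)
    convert this using 1; ring
  have hq : OrdEq D.v 2 (t₀ ^ 2 + σ ^ 2) := by
    have h1 := ((D.ord_two.mul hs0).mul hc₀.sq).div (htρ.mul htρ')
    have h2 : 2 * s * c₀ ^ 2 / ((t₀ - ρ) * (t₀ + ρ)) = t₀ ^ 2 + σ ^ 2 := by
      rw [← h₀]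
      have := htρ'.ne_zero
      field_simp; ring
    rw [h2] at h1
    exact h1.cast (by norm_num)
  have hder : OrdEq D.v 2 (3 * t₀ ^ 2 + 2 * ρ * t₀ + σ ^ 2) := by
    have h1 := hq.add (D.ord_two.mul (ht₀.mul htρ')) (by norm_num)
    convert h1 using 1; ring
  have hy₀ := (((hu.mul D.ord_θ).mul hc₀).mul hg).cast (show _ = (3 : ℤ) by norm_num)
  refine R.not_close (y₀ := s * (t₀ - ρ) * g ^ 2 * D.θ * c₀ * g)
    (y := s * (t₀ - ρ) * g ^ 2 * D.θ * c * g / z) hu hu' ?_ ?_ ht₀ hy₀ htρ' hder hk3 ht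
  · have hs3 : s ^ 3 = s := by rw [pow_succ, hs, one_mul]
    simp only [mul_pow, D.θ_sq, hs3, hs]
    linear_combination -s * (t₀ - ρ) ^ 2 * (g ^ 2) ^ 3 * h₀ - 2 * (t₀ - ρ) ^ 2 * g ^ 6 * c₀ ^ 2 * hs
  · have hs3 : s ^ 3 = s := by rw [pow_succ, hs, one_mul]
    simp only [mul_pow, div_pow, D.θ_sq, hs3, hs]
    rw [div_eq_iff (pow_ne_zero 2 hz0)]
    linear_combination -s * (t₀ - ρ) ^ 2 * (g ^ 2) ^ 3 * h - 2 * (t₀ - ρ) ^ 2 * g ^ 6 * c ^ 2 * hs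
      + s * (t₀ - ρ) ^ 2 * (g ^ 2) ^ 3 * (t + ρ) * (t ^ 2 + σ ^ 2) * hz

end Root
include D in
theorem intCast_ne_zero {n : ℤ} (hn : n ≠ 0) : (n : L) ≠ 0 := by
  intro h
  have h1 := congrArg D.p h
  rw [map_intCast, map_zero] at h1
  exact hn (by exact_mod_cast h1)

namespace Root

variable {D} {ρ σ : L} (R : D.Root ρ σ)
include R

theorem evenOff_sub {b A c s : ℤ} (hs : s ^ 2 = 1) (hc : c ≠ 0) (hcop : IsCoprime b A)
    (h : ((b : L) ^ 2 - ρ ^ 2 * A ^ 2) * (b ^ 2 + σ ^ 2 * A ^ 2) = 2 * s * c ^ 2) :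
    EvenOff ((b : L) - ρ * A) := by
  intro w hw
  have hb := w.map_intCast_le b
  have hA := w.map_intCast_le A
  have hρ := R.place w hw
  have hσ := R.place_inv hw
  have hx : w ((b : L) - ρ * A) ≤ 1 :=
    Valuation.map_sub_le (v := w) hb (by rwa [map_mul, hρ, one_mul])
  rcases hx.lt_or_eq with hlt | heq
  swap
  · exact ⟨0, by simpa using heq⟩
  have hcop' : ¬ (w (b : L) < 1 ∧ w (A : L) < 1) := by
    rintro ⟨h1, h2⟩
    obtain ⟨m, n, hmn⟩ := hcop
    have h3 := congrArg (fun j : ℤ => (j : L)) hmn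
    push_cast at h3
    have h4 : w ((m : L) * b + n * A) < 1 := by
      refine Valuation.map_add_lt w ?_ ?_
      · rw [map_mul]; exact lt_of_le_of_lt (mul_le_of_le_one_left' (w.map_intCast_le m)) h1
      · rw [map_mul]; exact lt_of_le_of_lt (mul_le_of_le_one_left' (w.map_intCast_le n)) h2
    rw [h3, map_one] at h4
    exact h4.false
  have hA1 : w (A : L) = 1 := by
    by_contra hA1
    have hA2 := lt_of_le_of_ne hA hA1
    refine hcop' ⟨?_, hA2⟩
    have : (b : L) = (b - ρ * A) + ρ * A := by ring
    rw [this]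
    exact Valuation.map_add_lt w hlt (by rwa [map_mul, hρ, one_mul])
  have hplus : w ((b : L) + ρ * A) = 1 := by
    have h1 : (b : L) + ρ * A = (b - ρ * A) + 2 * ρ * A := by ring
    have h2 : w (2 * ρ * (A : L)) = 1 := by rw [map_mul, map_mul, hw, hρ, hA1]; simp
    rw [h1, Valuation.map_add_eq_of_lt_right w (by rwa [h2]), h2]
  have hquad : w ((b : L) ^ 2 + σ ^ 2 * A ^ 2) = 1 := by
    have h1 : (b : L) ^ 2 + σ ^ 2 * A ^ 2 = (b - ρ * A) * (b + ρ * A) + 2 * D.θ * A ^ 2 := by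
      linear_combination (A : L) ^ 2 * R.add_eq
    have h2 : w (2 * D.θ * (A : L) ^ 2) = 1 := by
      rw [map_mul, map_mul, map_pow, hw, D.place_θ hw, hA1]; simp
    rw [h1, Valuation.map_add_eq_of_lt_right w (by rwa [h2, map_mul, hplus, mul_one]), h2]
  have hs1 : w (s : L) = 1 := by
    have h1 : (s : L) ^ 2 = 1 := by rw [← Int.cast_pow, hs, Int.cast_one]
    have h2 := congrArg w h1
    rw [map_pow, map_one] at h2
    exact (pow_eq_one_iff_of_nonneg zero_le (by norm_num)).1 h2
  have hfac : ((b : L) - ρ * A) * ((b + ρ * A) * (b ^ 2 + σ ^ 2 * A ^ 2)) = 2 * s * c ^ 2 := by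
    rw [← h]; ring
  have := congrArg w hfac
  rw [map_mul, map_mul, hplus, hquad, map_mul, map_mul, hw, hs1, map_pow] at this
  simp only [mul_one, one_mul] at this
  refine exists_exp_two_mul_of_sq ?_ this
  intro h0
  rw [h0, map_zero] at this
  exact D.intCast_ne_zero hc ((map_eq_zero w).1 ((pow_eq_zero_iff (by norm_num)).1 this.symm))

theorem ord_sub {b A : ℤ} (hb : Odd b) (hA : Odd A) : OrdEq D.v 1 ((b : L) - ρ * A) := by
  obtain ⟨j, hj⟩ := hb.sub_odd hA
  have h1 : OrdGe D.v 0 (j : L) := by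
    rw [OrdGe]; simpa using D.v.map_intCast_le j
  have h2 : (b : L) - ρ * A = 2 * j + (1 - ρ) * A := by
    have : ((b - A : ℤ) : L) = ((j + j : ℤ) : L) := by rw [hj]
    push_cast at this
    linear_combination this
  rw [h2]
  exact (((D.ord_two.ge le_rfl).mul h1).add_eq (R.ord_one_sub.mul (D.ord_of_odd hA))
    (by norm_num)).cast (by norm_num)

theorem eq_of_class {b a c s t₀ c₀ : ℤ} {g z : L} (hs : s ^ 2 = 1) (hb : Odd b) (ha : Odd a)
    (h : ((b : L) ^ 2 - ρ ^ 2 * a ^ 4) * (b ^ 2 + σ ^ 2 * a ^ 4) = 2 * s * c ^ 2)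
    (hg : OrdEq D.v 0 g)
    (hu' : ∀ w : Valuation L ℤᵐ⁰, w 2 = 1 → w (s * (t₀ - ρ) * g ^ 2) = 1)
    (ht₀ : Odd t₀) (hc₀ : Odd c₀)
    (h₀ : ((t₀ : L) ^ 2 - ρ ^ 2) * (t₀ ^ 2 + σ ^ 2) = 2 * s * c₀ ^ 2)
    (hz : (b : L) - ρ * a ^ 2 = (t₀ - ρ) * z ^ 2) : b = t₀ * a ^ 2 := by
  by_contra hne
  have ha0 := (D.ord_of_odd ha).ne_zero
  obtain ⟨k, hk, hk'⟩ := D.exists_ord_int (sub_ne_zero.2 hne) (hb.sub_odd (ht₀.mul ha.pow))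
  have ht₀ρ : OrdEq D.v 1 ((t₀ : L) - ρ) := by
    have := R.ord_sub ht₀ odd_one
    simpa using this
  refine R.not_same_class (s := s) (g := g) (t₀ := t₀) (c₀ := c₀) (t := b / a ^ 2) (c := c / a ^ 4)
    (z := z / a) (k := k) ?_ hg hu' ht₀ρ (D.ord_of_odd ht₀) (D.ord_of_odd hc₀) h₀ ?_ ?_ hk ?_
  · rw [← Int.cast_pow, hs, Int.cast_one]
  · field_simp
    linear_combination h
  · field_simp
    linear_combination hz
  · have h1 := hk'.div (D.ord_of_odd ha).sq
    have h2 : ((b - t₀ * a ^ 2 : ℤ) : L) / (a : L) ^ 2 = b / a ^ 2 - t₀ := by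
      push_cast; field_simp
    rw [h2] at h1
    exact h1.cast (by ring)

end Root

theorem exists_class_of_ord_one {x : L} (hx : OrdEq D.v 1 x) (he : EvenOff x)
    (hp : 0 < D.p x) (hq : 0 < D.q x) :
    ∃ z : L, x = (1 - D.τ) * z ^ 2 ∨ x = (1 + D.τ) * z ^ 2 := by
  obtain ⟨k, hk, l, hl, z, hz, h⟩ := D.exists_class_of_pos hx.ne_zero he hp hq
  obtain ⟨e, hze⟩ := exists_ordEq D.v hz
  have h1 := ((D.ord_ε.pow k).mul (D.ord_one_sub.pow l)).mul hze.sq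
  rw [← h] at h1
  have h2 := hx.unique h1
  obtain rfl : l = 1 := by
    interval_cases l
    · push_cast at h2; omega
    · rfl
  have h0 := D.one_sub_ne_zero
  refine ⟨z, ?_⟩
  interval_cases k
  · exact Or.inl (by rw [h]; ring)
  · refine Or.inr ?_
    rw [h, ε]; field_simp

include D in
/-- The positive coprime odd solutions of `b⁴ + 2 a⁴ b² - a⁸ = 2 c²`. -/
theorem quartic_pos {a b c : ℤ} (ha : Odd a) (hb : Odd b) (hb0 : 0 < b) (hc : c ≠ 0)
    (hcop : IsCoprime b (a ^ 2)) (h : 2 * c ^ 2 = b ^ 4 + 2 * a ^ 4 * b ^ 2 - a ^ 8) :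
    b = a ^ 2 ∨ b = 3 * a ^ 2 := by
  have hτ0 := D.τ_ne_zero
  have hL : 2 * (c : L) ^ 2 = b ^ 4 + 2 * a ^ 4 * b ^ 2 - a ^ 8 := by
    have := congrArg (Int.cast : ℤ → L) h
    push_cast at this
    exact this
  have hfac : ((b : L) ^ 2 - D.τ ^ 2 * a ^ 4) * (b ^ 2 + D.τ⁻¹ ^ 2 * a ^ 4) =
      2 * (1 : ℤ) * c ^ 2 := by
    push_cast
    field_simp
    linear_combination -D.τ ^ 2 * hL - (b : L) ^ 2 * a ^ 4 * D.τ_pow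
  have hfac' : ((b : L) ^ 2 - D.τ ^ 2 * (a ^ 2 : ℤ) ^ 2) * (b ^ 2 + D.τ⁻¹ ^ 2 * (a ^ 2 : ℤ) ^ 2) =
      2 * (1 : ℤ) * c ^ 2 := by
    rw [← hfac]; push_cast; ring
  have he := D.root_τ.evenOff_sub (one_pow 2) hc hcop hfac'
  have ho := D.root_τ.ord_sub hb (ha.pow (n := 2))
  have ha0 : a ≠ 0 := by rintro rfl; simp at ha
  have hpos : ∀ f : L →+* ℝ, 0 < f ((b : L) - D.τ * (a ^ 2 : ℤ)) := by
    intro f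
    have h1 := congrArg f hfac
    simp only [map_mul, map_sub, map_add, map_pow, map_intCast, map_ofNat, map_inv₀] at h1
    push_cast at h1
    have h2 : (0 : ℝ) < b := by exact_mod_cast hb0
    have h3 : (0 : ℝ) < (a : ℝ) ^ 2 := by exact_mod_cast sq_pos_of_ne_zero ha0
    have h4 : (0 : ℝ) < (c : ℝ) ^ 2 := by exact_mod_cast sq_pos_of_ne_zero hc
    have h5 : 0 < (b : ℝ) ^ 2 + (f D.τ)⁻¹ ^ 2 * a ^ 4 := by positivity
    have h6 : 0 < ((b : ℝ) ^ 2 - f D.τ ^ 2 * a ^ 4) := by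
      by_contra! h6
      nlinarith [mul_nonpos_of_nonpos_of_nonneg h6 h5.le]
    have h7 : |f D.τ * (a : ℝ) ^ 2| < |(b : ℝ)| := by
      rw [← sq_lt_sq]; nlinarith
    rw [abs_of_pos h2] at h7
    simp only [map_sub, map_mul, map_intCast]
    push_cast
    linarith [(abs_lt.1 h7).2]
  obtain ⟨z, hz | hz⟩ := D.exists_class_of_ord_one ho he (hpos _) (hpos _)
  · left
    have := D.root_τ.eq_of_class (g := 1) (z := z) (t₀ := 1) (c₀ := 1) (one_pow 2) hb ha hfac
      ordEq_one ?_ odd_one odd_one ?_ ?_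
    · rwa [one_mul] at this
    · intro w hw
      simpa using D.place_one_sub hw
    · push_cast
      field_simp
      linear_combination -D.τ_pow
    · push_cast at hz ⊢; exact hz
  · right
    obtain ⟨ζ, hz₀⟩ : ∃ ζ, (1 + D.τ) * ζ ^ 2 = 3 - D.τ :=
      ⟨-1 + 3 * D.τ + D.τ ^ 3, by
        linear_combination (D.τ ^ 3 + D.τ ^ 2 + 4 * D.τ + 2) * D.τ_pow⟩
    have h30 : OrdEq D.v 1 (3 - D.τ) := by
      have := D.root_τ.ord_sub (b := 3) (A := 1) (by decide) odd_one
      simpa using this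
    have hz₀0 : ζ ≠ 0 := by
      intro h0
      rw [h0] at hz₀
      exact h30.ne_zero (by rw [← hz₀]; ring)
    obtain ⟨e, he⟩ := exists_ordEq D.v hz₀0
    have h1 := D.ord_one_add.mul he.sq
    rw [hz₀] at h1
    have h2 := h30.unique h1
    obtain rfl : e = 0 := by omega
    refine D.root_τ.eq_of_class (g := 1 / ζ)
      (z := z / ζ) (t₀ := 3) (c₀ := 7) (one_pow 2) hb ha hfac
      ((ordEq_one.div he).cast (by norm_num)) ?_ (by decide) (by decide) ?_ ?_
    · intro w hw
      push_cast
      rw [← hz₀]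
      have h3 : (1 : L) * ((1 + D.τ) * ζ ^ 2) *
          (1 / ζ) ^ 2 = 1 + D.τ := by field_simp
      rw [h3, D.place_one_add hw]
    · push_cast
      field_simp
      linear_combination -9 * D.τ_pow
    · push_cast at hz ⊢
      rw [← hz₀, hz]; field_simp

include D in
/-- The coprime odd solutions of `b⁴ - 2 a⁴ b² - a⁸ = -2 c²`. -/
theorem quartic_neg {a b c : ℤ} (ha : Odd a) (hb : Odd b) (hc : c ≠ 0)
    (hcop : IsCoprime b (a ^ 2)) (h : -(2 * c ^ 2) = b ^ 4 - 2 * a ^ 4 * b ^ 2 - a ^ 8) :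
    b = a ^ 2 ∨ b = -a ^ 2 := by
  have hτ0 := D.τ_ne_zero
  have hL : -(2 * (c : L) ^ 2) = b ^ 4 - 2 * a ^ 4 * b ^ 2 - a ^ 8 := by
    have := congrArg (Int.cast : ℤ → L) h
    push_cast at this
    exact this
  have hfac : ((b : L) ^ 2 - D.τ⁻¹ ^ 2 * a ^ 4) * (b ^ 2 + D.τ ^ 2 * a ^ 4) =
      2 * (-1 : ℤ) * c ^ 2 := by
    push_cast
    field_simp
    linear_combination -D.τ ^ 2 * hL + (b : L) ^ 2 * a ^ 4 * D.τ_pow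
  have hfac' : ((b : L) ^ 2 - D.τ⁻¹ ^ 2 * (a ^ 2 : ℤ) ^ 2) *
      (b ^ 2 + D.τ ^ 2 * (a ^ 2 : ℤ) ^ 2) = 2 * (-1 : ℤ) * c ^ 2 := by
    rw [← hfac]; push_cast; ring
  have he : EvenOff (-D.τ * ((b : L) - D.τ⁻¹ * (a ^ 2 : ℤ))) := by
    refine EvenOff.mul (fun w hw => ⟨0, ?_⟩)
      (D.root_inv_τ.evenOff_sub (by norm_num) hc hcop hfac')
    rw [Valuation.map_neg, D.place_τ hw]; simp
  have ho := D.ord_τ.neg.mul (D.root_inv_τ.ord_sub hb (ha.pow (n := 2)))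
  rw [zero_add] at ho
  have hx : -D.τ * ((b : L) - D.τ⁻¹ * (a ^ 2 : ℤ)) = a ^ 2 - D.τ * b := by
    push_cast; field_simp; ring
  rw [hx] at he ho
  have ha0 : a ≠ 0 := by rintro rfl; simp at ha
  have hpos : ∀ f : L →+* ℝ, 0 < f ((a : L) ^ 2 - D.τ * b) := by
    intro f
    have h0 : f D.τ ≠ 0 := (map_ne_zero f).2 hτ0
    have h1 := congrArg f hfac
    simp only [map_mul, map_sub, map_add, map_pow, map_intCast, map_ofNat, map_inv₀] at h1
    push_cast at h1
    have h3 : (0 : ℝ) < (a : ℝ) ^ 2 := by exact_mod_cast sq_pos_of_ne_zero ha0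
    have h4 : (0 : ℝ) < (c : ℝ) ^ 2 := by exact_mod_cast sq_pos_of_ne_zero hc
    have h2 : 0 < f D.τ ^ 2 := by positivity
    have h5 : 0 < (b : ℝ) ^ 2 + (f D.τ) ^ 2 * a ^ 4 := by
      have : 0 < f D.τ ^ 2 * ((a : ℝ) ^ 2) ^ 2 := by positivity
      nlinarith [sq_nonneg (b : ℝ)]
    have h6 : ((b : ℝ) ^ 2 - (f D.τ)⁻¹ ^ 2 * a ^ 4) < 0 := by
      by_contra! h6
      nlinarith [mul_nonneg h6 h5.le]
    have h6' : f D.τ ^ 2 * (b : ℝ) ^ 2 - a ^ 4 < 0 := by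
      have := mul_neg_of_pos_of_neg h2 h6
      have h8 : f D.τ ^ 2 * ((b : ℝ) ^ 2 - (f D.τ)⁻¹ ^ 2 * a ^ 4) =
        f D.τ ^ 2 * (b : ℝ) ^ 2 - a ^ 4 := by field_simp
      linarith
    have h7 : |f D.τ * (b : ℝ)| < |(a : ℝ) ^ 2| := by
      rw [← sq_lt_sq]; nlinarith
    rw [abs_of_pos h3] at h7
    simp only [map_sub, map_mul, map_intCast, map_pow]
    linarith [(abs_lt.1 h7).2]
  obtain ⟨z, hz | hz⟩ := D.exists_class_of_ord_one ho he (hpos _) (hpos _)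
  · left
    have := D.root_inv_τ.eq_of_class (g := 1) (z := z) (t₀ := 1) (c₀ := 1) (s := -1) (by norm_num)
      hb ha hfac ordEq_one ?_ odd_one odd_one ?_ ?_
    · rwa [one_mul] at this
    · intro w hw
      have h1 : ((-1 : ℤ) : L) * ((1 : ℤ) - D.τ⁻¹) * 1 ^ 2 = (1 - D.τ) / D.τ := by
        push_cast; field_simp; ring
      rw [h1, map_div₀, D.place_one_sub hw, D.place_τ hw, div_one]
    · push_cast
      field_simp
      linear_combination D.τ_pow
    · push_cast
      field_simp
      linear_combination -hz
  · right
    have := D.root_inv_τ.eq_of_class (g := 1) (z := z) (t₀ := -1) (c₀ := 1) (s := -1) (by norm_num)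
      hb ha hfac ordEq_one ?_ (by decide) odd_one ?_ ?_
    · rwa [neg_one_mul] at this
    · intro w hw
      have h1 : ((-1 : ℤ) : L) * ((-1 : ℤ) - D.τ⁻¹) * 1 ^ 2 = (1 + D.τ) / D.τ := by
        push_cast; field_simp; ring
      rw [h1, map_div₀, D.place_one_add hw, D.place_τ hw, div_one]
    · push_cast
      field_simp
      linear_combination D.τ_pow
    · push_cast
      field_simp
      linear_combination -hz

end QuarticData

namespace SqrtTwo

/-- The square root of `2` in `ℤ√2`. -/
def root : ℤ√2 := ⟨0, 1⟩

/-- The fundamental unit `1 + √2` of `ℤ√2`. -/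
def η : ℤ√2 := ⟨1, 1⟩

theorem root_sq : root ^ 2 = 2 := by ext <;> simp [root, sq]

theorem η_eq : η = 1 + root := by ext <;> simp [root, η]

theorem η_mul : η * (root - 1) = 1 := by rw [η_eq]; linear_combination root_sq

theorem isUnit_η : IsUnit η := .of_mul_eq_one _ η_mul

theorem norm_eq_zero {a : ℤ√2} : a.norm = 0 ↔ a = 0 := by
  refine Zsqrtd.norm_eq_zero (fun n h => ?_) a
  have h1 : n < 2 := by nlinarith
  have h2 : -2 < n := by nlinarith
  interval_cases n <;> omega

instance : NoZeroDivisors (ℤ√2) where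
  eq_zero_or_eq_zero_of_mul_eq_zero {a b} h := by
    rw [← norm_eq_zero, Zsqrtd.norm_mul, mul_eq_zero, norm_eq_zero, norm_eq_zero] at h
    exact h

instance : IsDomain (ℤ√2) := NoZeroDivisors.to_isDomain _

theorem exists_norm_sub_mul_lt (x : ℤ√2) {y : ℤ√2} (hy : y ≠ 0) :
    ∃ q : ℤ√2, (x - y * q).norm.natAbs < y.norm.natAbs := by
  have hn : y.norm ≠ 0 := norm_eq_zero.not.mpr hy
  have key : ∀ (u n : ℤ), n ≠ 0 → ∃ p : ℤ, 4 * (u - p * n) ^ 2 ≤ n ^ 2 := by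
    intro u n hn
    refine ⟨round ((u : ℚ) / n), ?_⟩
    have hn' : (n : ℚ) ≠ 0 := by exact_mod_cast hn
    have h := abs_sub_round ((u : ℚ) / n)
    have h2 : ((u : ℚ) / n - round ((u : ℚ) / n)) ^ 2 ≤ (1 / 2) ^ 2 := sq_le_sq' (by
      linarith [neg_abs_le ((u : ℚ) / n - round ((u : ℚ) / n))]) ((le_abs_self _).trans h)
    have h3 : (u : ℚ) - round ((u : ℚ) / n) * n = ((u : ℚ) / n - round ((u : ℚ) / n)) * n := by
      field_simp
    have h4 : 4 * ((u : ℚ) - round ((u : ℚ) / n) * n) ^ 2 ≤ n ^ 2 := by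
      rw [h3, mul_pow]
      nlinarith [sq_nonneg (n : ℚ)]
    exact_mod_cast h4
  obtain ⟨p, hp⟩ := key (x * star y).re y.norm hn
  obtain ⟨r, hr⟩ := key (x * star y).im y.norm hn
  refine ⟨⟨p, r⟩, ?_⟩
  have hN : (x - y * ⟨p, r⟩).norm * y.norm =
      ((x * star y).re - p * y.norm) ^ 2 - 2 * ((x * star y).im - r * y.norm) ^ 2 := by
    simp only [Zsqrtd.norm_def, Zsqrtd.re_sub, Zsqrtd.im_sub, Zsqrtd.re_mul, Zsqrtd.im_mul,
      Zsqrtd.re_star, Zsqrtd.im_star]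
    ring
  set s := (x * star y).re - p * y.norm
  set t := (x * star y).im - r * y.norm
  have h1 : |(x - y * ⟨p, r⟩).norm * y.norm| * 2 ≤ y.norm ^ 2 := by
    rw [hN]
    rcases abs_cases (s ^ 2 - 2 * t ^ 2) with ⟨h, -⟩ | ⟨h, -⟩ <;> rw [h] <;>
      nlinarith [sq_nonneg s, sq_nonneg t]
  have h2 : 0 < |y.norm| := abs_pos.mpr hn
  rw [abs_mul, ← sq_abs] at h1
  zify
  nlinarith

theorem isPrincipalIdealRing : IsPrincipalIdealRing (ℤ√2) := by
  refine ⟨fun I => ?_⟩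
  by_cases hI : I = ⊥
  · subst hI; exact bot_isPrincipal
  obtain ⟨z, hz, hz0⟩ := Submodule.exists_mem_ne_zero_of_ne_bot hI
  obtain ⟨y, ⟨hy, hy0⟩, hmin⟩ := (measure fun x : ℤ√2 => x.norm.natAbs).wf.has_min
    {x | x ∈ I ∧ x ≠ 0} ⟨z, hz, hz0⟩
  refine ⟨y, le_antisymm (fun x hx => ?_) ?_⟩
  · obtain ⟨q, hq⟩ := exists_norm_sub_mul_lt x hy0
    rw [Submodule.mem_span_singleton]
    by_contra hc
    refine hmin (x - y * q) ⟨I.sub_mem hx (I.mul_mem_right _ hy), fun h => hc ⟨q, ?_⟩⟩ hq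
    rw [smul_eq_mul, mul_comm, ← sub_eq_zero.mp h]
  · rw [Submodule.span_singleton_le_iff_mem]; exact hy

instance : IsPrincipalIdealRing (ℤ√2) := isPrincipalIdealRing

theorem exists_unit_sq_of_norm_eq_one {t : ℤ√2} (h : t.norm = 1) :
    ∃ c, t = c ^ 2 ∨ t = -c ^ 2 := by
  have hf : Pell.IsFundamental (Pell.Solution₁.mk 3 2 (by norm_num) : Pell.Solution₁ 2) := by
    refine ⟨by simp, by simp, fun {b} hb => ?_⟩
    simp only [Pell.Solution₁.x_mk]
    by_contra hc
    have hx : b.x = 2 := by omega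
    have := b.prop
    rw [hx] at this
    omega
  obtain ⟨n, hn⟩ := hf.eq_zpow_or_neg_zpow ⟨t, Zsqrtd.norm_eq_one_iff_mem_unitary.mp h⟩
  let f : Pell.Solution₁ 2 →* (ℤ√2)ˣ := Unitary.toUnits
  have hval : ∀ a : Pell.Solution₁ 2, (f a : ℤ√2) = a := fun _ => rfl
  have h1 : f (Pell.Solution₁.mk 3 2 (by norm_num)) = isUnit_η.unit ^ 2 := by
    ext1
    rw [hval, Pell.Solution₁.coe_mk, Units.val_pow_eq_pow_val, IsUnit.unit_spec]
    ext <;> simp [η, sq]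
  have key : ((Pell.Solution₁.mk 3 2 (by norm_num) ^ n : Pell.Solution₁ 2) : ℤ√2) =
      ((isUnit_η.unit ^ n : (ℤ√2)ˣ) : ℤ√2) ^ 2 := by
    rw [← hval, map_zpow, h1, ← zpow_natCast, zpow_comm, zpow_natCast, Units.val_pow_eq_pow_val]
  refine ⟨((isUnit_η.unit ^ n : (ℤ√2)ˣ) : ℤ√2), hn.imp (fun h => ?_) fun h => ?_⟩
  · rw [← key, ← h]
  · rw [← key]
    exact congrArg Subtype.val h

theorem exists_of_isUnit {t : ℤ√2} (h : IsUnit t) :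
    ∃ i < 2, ∃ j < 2, ∃ c : ℤ√2, t = (-1) ^ i * η ^ j * c ^ 2 := by
  rcases Int.natAbs_eq_iff.mp (Zsqrtd.norm_eq_one_iff.mpr h) with h1 | h1
  · obtain ⟨c, rfl | rfl⟩ := exists_unit_sq_of_norm_eq_one h1
    · exact ⟨0, by simp, 0, by simp, c, by simp⟩
    · exact ⟨1, by simp, 0, by simp, c, by simp⟩
  · have h2 : (t * η).norm = 1 := by rw [Zsqrtd.norm_mul, h1]; simp [η, Zsqrtd.norm_def]
    obtain ⟨c, hc⟩ := exists_unit_sq_of_norm_eq_one h2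
    have e : t = t * η * η * (root - 1) ^ 2 := by
      linear_combination (-t * (1 + η * (root - 1))) * η_mul
    rcases hc with hc | hc
    · exact ⟨0, by simp, 1, by simp, c * (root - 1), by rw [e, hc]; ring⟩
    · exact ⟨1, by simp, 1, by simp, c * (root - 1), by rw [e, hc]; ring⟩

theorem root_dvd_iff {a : ℤ√2} : root ∣ a ↔ 2 ∣ a.re := by
  constructor
  · rintro ⟨c, rfl⟩
    simp [root]
  · rintro ⟨k, hk⟩
    exact ⟨⟨a.im, k⟩, by ext <;> simp [root, hk]⟩

theorem prime_root : Prime root := by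
  refine ⟨fun h => by simpa [root] using congrArg Zsqrtd.im h, fun h => ?_, fun a b h => ?_⟩
  · have := Zsqrtd.norm_eq_one_iff.mpr h
    simp [root, Zsqrtd.norm_def] at this
  · rw [root_dvd_iff] at *
    rw [root_dvd_iff]
    simp only [Zsqrtd.re_mul] at h
    exact Int.Prime.dvd_mul' Nat.prime_two ((dvd_add_left ⟨a.im * b.im, by ring⟩).mp h)

theorem two_dvd_sub_one {a : ℤ√2} (h : ¬root ∣ a) : 2 ∣ a ^ 2 - 1 := by
  rw [root_dvd_iff, ← even_iff_two_dvd, Int.not_even_iff_odd] at h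
  obtain ⟨k, hk⟩ := h
  refine ⟨⟨2 * k ^ 2 + 2 * k + a.im ^ 2, a.re * a.im⟩, ?_⟩
  ext <;> simp [sq, hk] <;> ring

noncomputable section

/-- The field `ℚ(√2)`. -/
abbrev BaseField : Type := FractionRing (ℤ√2)

theorem sqrt_two_mul_self : √(2 : ℝ) * √2 = ((2 : ℤ) : ℝ) := by
  rw [Real.mul_self_sqrt (by norm_num)]; norm_num

theorem not_isSquare_two (n : ℤ) : (2 : ℤ) ≠ n * n := by
  intro h
  have h1 : n < 2 := by nlinarith
  have h2 : -2 < n := by nlinarith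
  interval_cases n <;> omega

/-- The real embedding of `ℚ(√2)` that sends a square root of `2` to `r`. -/
def realPlace (r : { r : ℝ // r * r = ((2 : ℤ) : ℝ) }) : BaseField →+* ℝ :=
  IsFractionRing.lift (Zsqrtd.lift_injective r not_isSquare_two)

theorem realPlace_root (r : { r : ℝ // r * r = ((2 : ℤ) : ℝ) }) :
    realPlace r (algebraMap (ℤ√2) BaseField root) = r := by
  rw [realPlace, IsFractionRing.lift_algebraMap]
  simp [root, Zsqrtd.lift]

/-- The real embedding of `ℚ(√2)` with `√2 > 0`. -/
def realPlus : BaseField →+* ℝ := realPlace ⟨√2, sqrt_two_mul_self⟩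

/-- The real embedding of `ℚ(√2)` with `√2 < 0`. -/
def realMinus : BaseField →+* ℝ := realPlace ⟨-√2, by rw [neg_mul_neg, sqrt_two_mul_self]⟩

theorem realPlus_root : realPlus (algebraMap (ℤ√2) BaseField root) = √2 := realPlace_root _

theorem realMinus_root : realMinus (algebraMap (ℤ√2) BaseField root) = -√2 := realPlace_root _

/-- The element `√2 - 1` of `ℚ(√2)`. -/
abbrev δ : BaseField := algebraMap (ℤ√2) BaseField (root - 1)

theorem realPlus_δ : realPlus δ = √2 - 1 := by rw [δ, map_sub, map_sub, realPlus_root]; simp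

theorem realMinus_δ : realMinus δ = -√2 - 1 := by rw [δ, map_sub, map_sub, realMinus_root]; simp

theorem one_lt_sqrt_two : 1 < √(2 : ℝ) := by
  rw [Real.lt_sqrt (by norm_num)]; norm_num

instance : Fact (∀ r : BaseField, r ^ 2 ≠ δ + 0 * r) := by
  refine ⟨fun r h => ?_⟩
  have h1 := congrArg realMinus h
  rw [zero_mul, add_zero, map_pow, realMinus_δ] at h1
  nlinarith [sq_nonneg (realMinus r), one_lt_sqrt_two]

/-- The quartic field `ℚ(√(√2 - 1))`. -/
abbrev QuarticField : Type := QuadraticAlgebra BaseField δ 0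

/-- The square root of `√2 - 1`. -/
abbrev τ : QuarticField := QuadraticAlgebra.omega

theorem τ_sq : τ ^ 2 = algebraMap (ℤ√2) QuarticField (root - 1) := by
  rw [sq, QuadraticAlgebra.omega_mul_omega_eq_mk]
  rfl

theorem algebraMap_root : algebraMap (ℤ√2) QuarticField root = 1 + τ ^ 2 := by
  rw [τ_sq, map_sub, map_one]; ring

theorem algebraMap_η : algebraMap (ℤ√2) QuarticField η = 2 + τ ^ 2 := by
  rw [η_eq, map_add, map_one, algebraMap_root]; ring

theorem τ_pow : τ ^ 4 = 1 - 2 * τ ^ 2 := by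
  have h := congrArg (algebraMap (ℤ√2) QuarticField) root_sq
  rw [map_pow, algebraMap_root, map_ofNat] at h
  linear_combination h

/-- The real embedding of the quartic field over `realPlus` sending `τ` to `r`. -/
def quarticPlace (r : ℝ) (hr : r * r = √2 - 1) : QuarticField →+* ℝ :=
  letI := realPlus.toAlgebra
  (QuadraticAlgebra.lift ⟨r, by
    rw [hr, zero_smul, add_zero, Algebra.smul_def, mul_one]
    exact realPlus_δ.symm⟩ : QuarticField →ₐ[BaseField] ℝ).toRingHom

theorem quarticPlace_τ (r : ℝ) (hr : r * r = √2 - 1) : quarticPlace r hr τ = r := by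
  let := realPlus.toAlgebra
  simp [quarticPlace, QuadraticAlgebra.lift]

instance : IsScalarTower (ℤ√2) BaseField QuarticField := by
  infer_instance

theorem root_dvd_of_sq_eq {α β n : ℤ√2} (h : α ^ 2 = 2 * n + β ^ 2 * (root - 1)) :
    root ∣ α ∧ root ∣ β := by
  have hβ : root ∣ β := by
    by_contra hβ
    have hα : ¬root ∣ α := by
      intro hα
      have h1 : root ∣ β ^ 2 * (root - 1) := by
        have h2 : root ∣ α ^ 2 := dvd_pow hα two_ne_zero
        have h3 : root ∣ 2 * n := Dvd.dvd.mul_right ⟨root, by rw [← root_sq, sq]⟩ n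
        rw [h] at h2
        exact (dvd_add_right h3).mp h2
      rcases prime_root.dvd_or_dvd h1 with h2 | h2
      · exact hβ (prime_root.dvd_of_dvd_pow h2)
      · rw [root_dvd_iff] at h2; simp [root] at h2
    obtain ⟨x, hx⟩ := two_dvd_sub_one hα
    obtain ⟨y, hy⟩ := two_dvd_sub_one hβ
    have h1 : root = 2 * (x - n - y * (root - 1) + 1) := by
      linear_combination (-1 : ℤ√2) * h + hx - (root - 1) * hy
    have := congrArg Zsqrtd.im h1
    simp only [root, Zsqrtd.im_mul, Zsqrtd.re_ofNat, Zsqrtd.im_ofNat] at this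
    omega
  refine ⟨prime_root.dvd_of_dvd_pow (n := 2) ?_, hβ⟩
  rw [h]
  exact dvd_add (Dvd.dvd.mul_right ⟨root, by rw [← root_sq, sq]⟩ n)
    ((dvd_pow hβ two_ne_zero).mul_right _)

theorem two_dvd_of_sq_eq {α β n : ℤ√2} (h : α ^ 2 = 4 * n + β ^ 2 * (root - 1)) :
    2 ∣ α ∧ 2 ∣ β := by
  obtain ⟨⟨x, rfl⟩, ⟨y, rfl⟩⟩ := root_dvd_of_sq_eq (α := α) (β := β) (n := 2 * n) (by rw [h]; ring)
  have h2 : (2 : ℤ√2) ≠ 0 := by rw [← root_sq]; exact pow_ne_zero _ prime_root.ne_zero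
  obtain ⟨hx, hy⟩ := root_dvd_of_sq_eq (α := x) (β := y) (n := n) (by
    apply mul_left_cancel₀ h2
    linear_combination h - (x ^ 2 - y ^ 2 * (root - 1)) * root_sq)
  rw [← root_sq, sq]
  exact ⟨mul_dvd_mul_left _ hx, mul_dvd_mul_left _ hy⟩

theorem isIntegral_star {z : QuarticField} (hz : IsIntegral (ℤ√2) z) :
    IsIntegral (ℤ√2) (star z) := by
  refine hz.map_of_comp_eq (RingHom.id _) (starRingEnd QuarticField) ?_
  refine RingHom.ext fun r => ?_
  simp only [RingHom.comp_apply, RingHom.id_apply, starRingEnd_apply,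
    IsScalarTower.algebraMap_apply (ℤ√2) BaseField QuarticField]
  ext <;> simp

/-- The ring of integers of the quartic field. -/
abbrev 𝒪 : Subalgebra (ℤ√2) QuarticField := integralClosure (ℤ√2) QuarticField

theorem mem_of_isIntegral_algebraMap {x : BaseField}
    (h : IsIntegral (ℤ√2) (algebraMap BaseField QuarticField x)) :
    ∃ r : ℤ√2, algebraMap (ℤ√2) BaseField r = x := by
  rw [isIntegral_algebraMap_iff (algebraMap BaseField QuarticField).injective] at h
  exact IsIntegrallyClosed.isIntegral_iff.mp h

theorem isIntegral_τ : IsIntegral (ℤ√2) τ := by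
  refine IsIntegral.of_pow (n := 2) (by norm_num) ?_
  rw [τ_sq]
  exact isIntegral_algebraMap

theorem exists_coords {z : QuarticField} (hz : IsIntegral (ℤ√2) z) :
    ∃ a b : ℤ√2, z = algebraMap _ _ a + algebraMap _ _ b * τ := by
  have hs := isIntegral_star hz
  obtain ⟨α, hα⟩ := mem_of_isIntegral_algebraMap (x := 2 * z.re) (by
    have e : algebraMap BaseField QuarticField (2 * z.re) = z + star z := by
      ext <;> simp [two_mul]
    rw [e]
    exact hz.add hs)
  obtain ⟨β, hβ⟩ := mem_of_isIntegral_algebraMap (x := 2 * z.im) (by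
    have h : algebraMap (ℤ√2) BaseField η * (algebraMap (ℤ√2) BaseField root - 1) = 1 := by
      rw [← map_one (algebraMap (ℤ√2) BaseField), ← map_sub, ← map_mul, η_mul]
    have e : algebraMap BaseField QuarticField (2 * z.im) =
        (z - star z) * τ * algebraMap (ℤ√2) QuarticField η := by
      rw [IsScalarTower.algebraMap_apply (ℤ√2) BaseField QuarticField]
      ext
      · simp
        linear_combination (-2 * z.im) * h
      · simp
    rw [e]
    exact ((hz.sub hs).mul isIntegral_τ).mul isIntegral_algebraMap)
  obtain ⟨n, hn⟩ := mem_of_isIntegral_algebraMap (x := z.norm) (by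
    rw [QuadraticAlgebra.algebraMap_norm_eq_mul_star]
    exact hz.mul hs)
  obtain ⟨⟨a, rfl⟩, ⟨b, rfl⟩⟩ := two_dvd_of_sq_eq (α := α) (β := β) (n := n) (by
    apply IsFractionRing.injective (ℤ√2) BaseField
    rw [map_add, map_mul, map_mul, map_pow, map_pow, hα, hβ, hn, map_ofNat,
      QuadraticAlgebra.norm_def]
    ring)
  rw [map_mul, map_ofNat] at hα hβ
  refine ⟨a, b, ?_⟩
  have ha := mul_left_cancel₀ two_ne_zero hα
  have hb := mul_left_cancel₀ two_ne_zero hβ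
  rw [IsScalarTower.algebraMap_apply (ℤ√2) BaseField QuarticField,
    IsScalarTower.algebraMap_apply (ℤ√2) BaseField QuarticField, ha, hb]
  ext <;> simp

theorem coords_injective {a b c d : ℤ√2} (h : algebraMap (ℤ√2) QuarticField a +
    algebraMap _ _ b * τ = algebraMap _ _ c + algebraMap _ _ d * τ) : a = c ∧ b = d := by
  rw [IsScalarTower.algebraMap_apply (ℤ√2) BaseField QuarticField,
    IsScalarTower.algebraMap_apply (ℤ√2) BaseField QuarticField,
    IsScalarTower.algebraMap_apply (ℤ√2) BaseField QuarticField,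
    IsScalarTower.algebraMap_apply (ℤ√2) BaseField QuarticField] at h
  have h1 := congrArg QuadraticAlgebra.re h
  have h2 := congrArg QuadraticAlgebra.im h
  simp at h1 h2
  exact ⟨h1, h2⟩

end

end SqrtTwo

namespace IsDedekindDomain

variable {A F : Type*} [CommRing A] [IsDedekindDomain A] [Field F] [Algebra A F]
  [IsFractionRing A F]

/-- A principal prime with residue field `𝔽₂` gives a normalized valuation with residue field
`𝔽₂`. -/
theorem exists_valuation_of_dvd_or_dvd_sub_one {ϖ : A} (h0 : ϖ ≠ 0) (hu : ¬IsUnit ϖ)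
    (h : ∀ z, ϖ ∣ z ∨ ϖ ∣ z - 1) :
    ∃ v : Valuation F ℤᵐ⁰, v (algebraMap A F ϖ) = exp (-1) ∧ (∀ z : A, v (algebraMap A F z) ≤ 1) ∧
      ∀ z, v z = 1 → v (z - 1) < 1 := by
  have hmax : (Ideal.span {ϖ}).IsMaximal := by
    rw [Ideal.isMaximal_iff]
    refine ⟨by rwa [Ideal.mem_span_singleton, ← isUnit_iff_dvd_one], fun J x hJ hx hxJ => ?_⟩
    rw [Ideal.mem_span_singleton] at hx
    have h1 := (h x).resolve_left hx
    have h2 := hJ (Ideal.mem_span_singleton.mpr h1)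
    simpa using J.sub_mem hxJ h2
  let P : HeightOneSpectrum A := ⟨Ideal.span {ϖ}, hmax.isPrime, by simpa using h0⟩
  have hϖ : P.valuation F (algebraMap A F ϖ) = exp (-1) := by
    rw [P.valuation_of_algebraMap, P.intValuation_singleton h0 rfl]
  refine ⟨P.valuation F, hϖ, P.valuation_le_one, fun z hz => ?_⟩
  obtain ⟨s, t, ht, rfl⟩ := IsFractionRing.div_surjective (A := A) z
  have ht0 : t ≠ 0 := nonZeroDivisors.ne_zero ht
  have hs0 : s ≠ 0 := by rintro rfl; simp at hz
  have hst : P.intValuation s = P.intValuation t := by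
    rw [map_div₀, P.valuation_of_algebraMap, P.valuation_of_algebraMap] at hz
    exact eq_of_div_eq_one hz
  set n := (Associates.mk P.asIdeal).count (Associates.mk (Ideal.span {t})).factors
  have hn : P.intValuation t = exp (-(n : ℤ)) := P.intValuation_if_neg ht0
  have key : ∀ x : A, P.intValuation x = exp (-(n : ℤ)) → ∃ y, x = ϖ ^ n * y ∧ ϖ ∣ y - 1 := by
    intro x hx
    have h1 := (P.intValuation_le_pow_iff_mem x n).mp hx.le
    rw [Ideal.span_singleton_pow, Ideal.mem_span_singleton] at h1
    obtain ⟨y, rfl⟩ := h1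
    refine ⟨y, rfl, (h y).resolve_left ?_⟩
    rintro ⟨c, rfl⟩
    have h2 := (P.intValuation_le_pow_iff_mem (ϖ ^ n * (ϖ * c)) (n + 1)).mpr (by
      rw [Ideal.span_singleton_pow, Ideal.mem_span_singleton]
      exact ⟨c, by ring⟩)
    rw [hx, exp_le_exp] at h2
    push_cast at h2
    omega
  obtain ⟨s', hs', h1⟩ := key s (hst.trans hn)
  obtain ⟨t', ht', h2⟩ := key t hn
  have hϖ0 : algebraMap A F ϖ ≠ 0 := by simpa using h0
  have ht1 : P.valuation F (algebraMap A F t') = 1 := by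
    rw [P.valuation_eq_one_iff_notMem, Ideal.mem_span_singleton]
    intro h3
    exact hu (isUnit_iff_dvd_one.mpr (by simpa using dvd_sub h3 h2))
  have ht'0 : algebraMap A F t' ≠ 0 := by
    intro h3
    rw [h3, map_zero] at ht1
    exact zero_ne_one ht1
  have e : algebraMap A F s / algebraMap A F t - 1 =
      algebraMap A F (s' - t') / algebraMap A F t' := by
    rw [hs', ht', map_mul, map_mul, map_pow, map_sub]
    field_simp
  rw [e, map_div₀, ht1, div_one, P.valuation_lt_one_iff_mem, Ideal.mem_span_singleton]
  simpa using dvd_sub h1 h2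

/-- A prime `π` of a principal ideal domain that is unramified in `A` has order one at some
valuation. -/
theorem exists_valuation_of_radical {R : Type*} [CommRing R] [IsDomain R] [IsPrincipalIdealRing R]
    [Algebra R A] {π : R} (hπ : Prime π) (h0 : algebraMap R A π ≠ 0)
    (hu : ¬IsUnit (algebraMap R A π))
    (h : ∀ z : A, algebraMap R A π ∣ z ^ 2 → algebraMap R A π ∣ z) :
    ∃ v : Valuation F ℤᵐ⁰, v (algebraMap A F (algebraMap R A π)) = exp (-1) ∧
      ∀ r : R, ¬π ∣ r → v (algebraMap A F (algebraMap R A r)) = 1 := by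
  set ϖ := algebraMap R A π with hϖ
  obtain ⟨M, hM, hle⟩ := Ideal.exists_le_maximal (Ideal.span {ϖ}) (by
    rwa [Ne, Ideal.span_singleton_eq_top])
  have hmem : ϖ ∈ M := hle (Ideal.mem_span_singleton_self ϖ)
  let P : HeightOneSpectrum A := ⟨M, hM.isPrime, fun hb => h0 (by rwa [hb] at hmem)⟩
  refine ⟨P.valuation F, ?_, fun r hr => ?_⟩
  · have h1 := (P.intValuation_le_pow_iff_mem ϖ 1).mpr (by rwa [pow_one])
    have h2 : ¬ϖ ∈ M ^ 2 := by
      intro hc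
      rw [← Ideal.span_singleton_le_iff_mem, ← Ideal.dvd_iff_le] at hc
      obtain ⟨J, hJ⟩ := hc
      have h3 : M * J ≤ M ^ 2 * J := by
        intro x hx
        rw [← hJ, Ideal.mem_span_singleton]
        apply h
        rw [← Ideal.mem_span_singleton, hJ]
        have h4 : x ^ 2 ∈ (M * J) * (M * J) := by
          rw [sq]; exact Ideal.mul_mem_mul hx hx
        rw [show M * J * (M * J) = M ^ 2 * J * J by ring] at h4
        exact Ideal.mul_le_left h4
      have hJ0 : J ≠ ⊥ := by
        rintro rfl
        rw [Ideal.mul_bot, Ideal.span_singleton_eq_bot] at hJ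
        exact h0 hJ
      have h5 : M * M * J ∣ 1 * M * J := Ideal.dvd_iff_le.mpr (by rwa [one_mul, ← sq])
      have h6 := (mul_dvd_mul_iff_right P.ne_bot).mp ((mul_dvd_mul_iff_right hJ0).mp h5)
      exact hM.ne_top (by simpa using isUnit_of_dvd_one h6)
    rw [← P.intValuation_le_pow_iff_mem, P.intValuation_if_neg h0, exp_le_exp] at h2
    rw [P.intValuation_if_neg h0, exp_le_exp] at h1
    rw [P.valuation_of_algebraMap, P.intValuation_if_neg h0]
    congr 1
    push_cast at h1 h2
    omega
  · rw [P.valuation_eq_one_iff_notMem]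
    intro hc
    obtain ⟨a, b, hab⟩ := (hπ.coprime_iff_not_dvd (n := r)).mpr hr
    apply hM.ne_top
    rw [Ideal.eq_top_iff_one, ← map_one (algebraMap R A), ← hab, map_add, map_mul, map_mul]
    exact M.add_mem (M.mul_mem_left _ hmem) (M.mul_mem_left _ hc)

end IsDedekindDomain

namespace SqrtTwo

noncomputable section

instance : IsDedekindDomain 𝒪 := integralClosure.isDedekindDomain (ℤ√2) BaseField QuarticField

instance : IsFractionRing 𝒪 QuarticField :=
  integralClosure.isFractionRing_of_finite_extension BaseField QuarticField

/-- `τ` as an algebraic integer. -/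
def intτ : 𝒪 := ⟨τ, isIntegral_τ⟩

theorem exists_int_coords (z : 𝒪) :
    ∃ a b : ℤ√2, z = algebraMap _ _ a + algebraMap _ _ b * intτ := by
  obtain ⟨a, b, h⟩ := exists_coords z.2
  exact ⟨a, b, Subtype.ext h⟩

theorem int_coords_injective {a b c d : ℤ√2} (h : algebraMap (ℤ√2) 𝒪 a +
    algebraMap _ _ b * intτ = algebraMap _ _ c + algebraMap _ _ d * intτ) : a = c ∧ b = d :=
  coords_injective (congrArg Subtype.val h)

theorem intτ_sq : intτ ^ 2 = algebraMap (ℤ√2) 𝒪 (root - 1) := Subtype.ext τ_sq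

theorem intτ_pow : intτ ^ 4 = 1 - 2 * intτ ^ 2 := Subtype.ext τ_pow

theorem algebraMap_int_root : algebraMap (ℤ√2) 𝒪 root = 1 + intτ ^ 2 := Subtype.ext algebraMap_root

theorem not_isUnit_one_sub : ¬IsUnit (1 - intτ) := by
  rw [isUnit_iff_exists_inv]
  rintro ⟨z, hz⟩
  obtain ⟨a, b, rfl⟩ := exists_int_coords z
  obtain ⟨h1, h2⟩ := int_coords_injective (a := a - b * (root - 1)) (b := b - a) (c := 1)
    (d := 0) (by
    simp only [map_sub, map_mul, map_one, map_zero] at hz ⊢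
    have := intτ_sq
    simp only [map_sub, map_one] at this
    linear_combination hz + algebraMap (ℤ√2) 𝒪 b * this)
  apply prime_root.not_isUnit
  rw [sub_eq_zero] at h2
  exact .of_mul_eq_one (b * (root - 1)) (by linear_combination h1 + h2 + b * root_sq)

theorem one_sub_dvd_two : 1 - intτ ∣ 2 := by
  refine ⟨(1 + intτ) * (1 + intτ ^ 2) + 2 * (1 + intτ), ?_⟩
  linear_combination intτ_pow

theorem one_sub_ne_zero : 1 - intτ ≠ 0 := by
  intro h
  have := (int_coords_injective (a := 1) (b := -1) (c := 0) (d := 0) (by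
    simp only [map_neg, map_one, map_zero]; linear_combination h)).1
  exact one_ne_zero this

theorem one_sub_dvd_or (z : 𝒪) : 1 - intτ ∣ z ∨ 1 - intτ ∣ z - 1 := by
  have hr : ∀ r : ℤ√2, 1 - intτ ∣ algebraMap (ℤ√2) 𝒪 r ∨ 1 - intτ ∣ algebraMap (ℤ√2) 𝒪 r - 1 := by
    have h0 : 1 - intτ ∣ algebraMap (ℤ√2) 𝒪 root := by
      have e : algebraMap (ℤ√2) 𝒪 root = 2 - (1 - intτ) * (1 + intτ) := by
        rw [algebraMap_int_root]; ring
      rw [e]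
      exact dvd_sub one_sub_dvd_two (Dvd.intro _ rfl)
    intro r
    by_cases h : root ∣ r
    · exact .inl (h0.trans (map_dvd _ h))
    · have h1 : root ∣ r - 1 := by
        rw [root_dvd_iff] at h ⊢
        simp only [Zsqrtd.re_sub, Zsqrtd.re_one]
        omega
      right
      simpa using h0.trans (map_dvd (algebraMap (ℤ√2) 𝒪) h1)
  obtain ⟨a, b, rfl⟩ := exists_int_coords z
  rcases hr (a + b) with ⟨c, hc⟩ | ⟨c, hc⟩
  · rw [map_add] at hc
    exact .inl ⟨c - algebraMap _ _ b, by linear_combination hc⟩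
  · rw [map_add] at hc
    exact .inr ⟨c - algebraMap _ _ b, by linear_combination hc⟩

theorem one_sub_τ_sq : (1 - τ) ^ 2 = (1 + τ ^ 2) * (1 - (1 + τ ^ 2) * τ) := by
  linear_combination τ * τ_pow

theorem exists_dyadic_valuation : ∃ v : Valuation QuarticField ℤᵐ⁰, v 2 = exp (-4) ∧
    v (1 - τ) = exp (-1) ∧ ∀ z, v z = 1 → v (z - 1) < 1 := by
  obtain ⟨v, hv, hle, hres⟩ := IsDedekindDomain.exists_valuation_of_dvd_or_dvd_sub_one
    (F := QuarticField) one_sub_ne_zero not_isUnit_one_sub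
    one_sub_dvd_or
  replace hv : v (1 - τ) = exp (-1) := hv
  refine ⟨v, ?_, hv, hres⟩
  have hτ : v τ ≤ 1 := hle intτ
  have h2 : v 2 < 1 := by
    obtain ⟨c, hc⟩ := one_sub_dvd_two
    have e : (2 : QuarticField) = (1 - τ) * c := congrArg Subtype.val hc
    rw [e, map_mul, hv]
    refine (mul_le_of_le_one_right' (hle c)).trans_lt ?_
    rw [← exp_zero, exp_lt_exp]; norm_num
  have hsq : v (1 + τ ^ 2) ^ 2 = v 2 := by
    rw [← map_pow]; congr 1; linear_combination τ_pow
  have hθ : v (1 + τ ^ 2) < 1 := by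
    rw [← hsq] at h2
    exact (pow_lt_one_iff two_ne_zero).mp h2
  have h1 : v (1 - (1 + τ ^ 2) * τ) = 1 := by
    apply v.map_one_sub_of_lt
    rw [map_mul]
    exact (mul_le_of_le_one_right' hτ).trans_lt hθ
  have h3 := congrArg v one_sub_τ_sq
  rw [map_pow, map_mul, h1, mul_one, hv] at h3
  rw [← hsq, ← h3, ← pow_mul, ← exp_nsmul]
  norm_num

theorem exists_valuation_of_prime {π : ℤ√2} (hπ : Prime π) (h2 : ¬π ∣ 2) :
    ∃ v : Valuation QuarticField ℤᵐ⁰, v (algebraMap (ℤ√2) QuarticField π) = exp (-1) ∧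
      ∀ r : ℤ√2, ¬π ∣ r → v (algebraMap (ℤ√2) QuarticField r) = 1 := by
  have hinj : ∀ r : ℤ√2, algebraMap (ℤ√2) 𝒪 r = 0 → r = 0 := fun r h =>
    (int_coords_injective (a := r) (b := 0) (c := 0) (d := 0) (by simp [h])).1
  refine IsDedekindDomain.exists_valuation_of_radical (A := 𝒪) hπ (fun h => hπ.ne_zero (hinj _ h))
    (fun h => ?_) fun z hz => ?_
  · obtain ⟨z, hz⟩ := isUnit_iff_exists_inv.mp h
    obtain ⟨a, b, rfl⟩ := exists_int_coords z
    refine hπ.not_isUnit (.of_mul_eq_one a (int_coords_injective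
      (a := π * a) (b := π * b) (c := 1) (d := 0) ?_).1)
    simp only [map_mul, map_one, map_zero]
    linear_combination hz
  · obtain ⟨a, b, rfl⟩ := exists_int_coords z
    obtain ⟨w, hw⟩ := hz
    obtain ⟨c, d, rfl⟩ := exists_int_coords w
    obtain ⟨h3, h4⟩ := int_coords_injective (a := a ^ 2 + b ^ 2 * (root - 1)) (b := 2 * a * b)
      (c := π * c) (d := π * d) (by
        have := intτ_sq
        simp only [map_sub, map_mul, map_one, map_add, map_pow, map_ofNat] at hw this ⊢
        linear_combination hw - algebraMap (ℤ√2) 𝒪 b ^ 2 * this)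
    have h5 : π ∣ a ∨ π ∣ b := by
      have h6 : π ∣ 2 * a * b := ⟨d, h4⟩
      rcases hπ.dvd_or_dvd h6 with h6 | h6
      · exact .inl ((hπ.dvd_or_dvd h6).resolve_left h2)
      · exact .inr h6
    have h6 : π ∣ a ^ 2 + b ^ 2 * (root - 1) := ⟨c, h3⟩
    have h7 : π ∣ a ∧ π ∣ b := by
      rcases h5 with h | h
      · refine ⟨h, ?_⟩
        have h8 := (dvd_add_right (dvd_pow h two_ne_zero)).mp h6
        have h9 := h8.mul_right η
        rw [mul_assoc, mul_comm _ η, η_mul, mul_one] at h9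
        exact hπ.dvd_of_dvd_pow h9
      · refine ⟨?_, h⟩
        have h8 := (dvd_add_left ((dvd_pow h two_ne_zero).mul_right (root - 1))).mp h6
        exact hπ.dvd_of_dvd_pow h8
    exact dvd_add (map_dvd _ h7.1) ((map_dvd _ h7.2).mul_right _)

end

end SqrtTwo

section EvenOff

variable {L : Type*} [Field L]

theorem evenOff_sq {z : L} (hz : z ≠ 0) : EvenOff (z ^ 2) := fun w _ =>
  exists_exp_two_mul_of_sq (pow_ne_zero 2 hz) (map_pow w z 2)

theorem evenOff_of_valuation_eq_one {x : L} (h : ∀ w : Valuation L ℤᵐ⁰, w 2 = 1 → w x = 1) :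
    EvenOff x := fun w hw => ⟨0, by rw [h w hw]; simp⟩

theorem EvenOff.of_mul_right {x y : L} (hy : y ≠ 0) (h : EvenOff (x * y)) (hy' : EvenOff y) :
    EvenOff x := by
  have := (h.mul hy').mul (evenOff_sq (inv_ne_zero hy))
  rwa [show x * y * y * y⁻¹ ^ 2 = x by field_simp] at this

end EvenOff

namespace SqrtTwo

noncomputable section

theorem algebraMap_int_injective : Function.Injective (algebraMap (ℤ√2) QuarticField) := by
  rw [IsScalarTower.algebraMap_eq (ℤ√2) BaseField QuarticField]
  exact (algebraMap BaseField QuarticField).injective.comp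
    (IsFractionRing.injective (ℤ√2) BaseField)

theorem valuation_root {w : Valuation QuarticField ℤᵐ⁰} (hw : w 2 = 1) :
    w (algebraMap (ℤ√2) QuarticField root) = 1 := by
  rw [algebraMap_root]
  exact valuation_one_add_sq_eq_one τ_pow hw

theorem dvd_of_evenOff {π t : ℤ√2} (hπ : Prime π) (h2 : ¬π ∣ 2)
    (h : EvenOff (algebraMap (ℤ√2) QuarticField (π * t))) : π ∣ t := by
  by_contra hc
  obtain ⟨w, h1, h3⟩ := exists_valuation_of_prime hπ h2
  obtain ⟨k, hk⟩ := h w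
    ((congrArg w (map_ofNat (algebraMap (ℤ√2) QuarticField) 2)).symm.trans (h3 2 h2))
  rw [map_mul, map_mul, h1, h3 t hc, mul_one] at hk
  have := exp_injective hk
  omega

theorem exists_class_int (t : ℤ√2) (h0 : t ≠ 0) (h : EvenOff (algebraMap (ℤ√2) QuarticField t)) :
    ∃ i < 2, ∃ j < 2, ∃ k < 2, ∃ c : ℤ√2, t = (-1) ^ i * η ^ j * root ^ k * c ^ 2 := by
  induction t using (IsWellFounded.wf (r := DvdNotUnit (α := ℤ√2))).induction with
  | _ t ih =>
  by_cases hu : IsUnit t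
  · obtain ⟨i, hi, j, hj, c, hc⟩ := exists_of_isUnit hu
    exact ⟨i, hi, j, hj, 0, by norm_num, c, by rw [hc, pow_zero, mul_one]⟩
  obtain ⟨π, hπ, s, rfl⟩ := WfDvdMonoid.exists_irreducible_factor hu h0
  have hs0 : s ≠ 0 := right_ne_zero_of_mul h0
  by_cases h2 : π ∣ 2
  · rw [← root_sq] at h2
    obtain ⟨u, hu⟩ : Associated π root := (hπ.prime.dvd_prime_iff_associated prime_root).mp
      (hπ.prime.dvd_of_dvd_pow h2)
    have e : π * s = root * (↑u⁻¹ * s) := by rw [← hu]; rw [mul_assoc, Units.mul_inv_cancel_left]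
    rw [e] at h h0 ih ⊢
    set r := ↑u⁻¹ * s
    have hr0 : r ≠ 0 := right_ne_zero_of_mul h0
    obtain ⟨i, hi, j, hj, k, hk, c, hc⟩ :=
      ih r ⟨hr0, root, prime_root.not_isUnit, mul_comm _ _⟩ hr0 (by
      rw [map_mul, mul_comm] at h
      exact h.of_mul_right (by simpa using prime_root.ne_zero)
        (evenOff_of_valuation_eq_one fun w hw => valuation_root hw))
    interval_cases k
    · exact ⟨i, hi, j, hj, 1, by norm_num, c, by rw [hc]; ring⟩
    · exact ⟨i, hi, j, hj, 0, by norm_num, root * c, by rw [hc]; ring⟩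
  · obtain ⟨r, rfl⟩ := dvd_of_evenOff hπ.prime h2 h
    have hr0 : r ≠ 0 := right_ne_zero_of_mul hs0
    obtain ⟨i, hi, j, hj, k, hk, c, hc⟩ := ih r ⟨hr0, π * π, fun h => hπ.not_isUnit
      (isUnit_of_mul_isUnit_left h), by ring⟩ hr0 (by
      have hπ0 : algebraMap (ℤ√2) QuarticField π ≠ 0 := by simpa using hπ.ne_zero
      rw [← mul_assoc, ← sq, map_mul, mul_comm, map_pow] at h
      exact h.of_mul_right (pow_ne_zero 2 hπ0) (evenOff_sq hπ0))
    exact ⟨i, hi, j, hj, k, hk, π * c, by rw [hc]; ring⟩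

theorem exists_class_base {x : BaseField} (h0 : x ≠ 0)
    (h : EvenOff (algebraMap BaseField QuarticField x)) :
    ∃ i < 2, ∃ j < 2, ∃ k < 2, ∃ c : BaseField, c ≠ 0 ∧
      x = (-1) ^ i * algebraMap _ _ η ^ j * algebraMap _ _ root ^ k * c ^ 2 := by
  obtain ⟨r, s, hs, rfl⟩ := IsFractionRing.div_surjective (A := ℤ√2) x
  have hs0 : algebraMap (ℤ√2) BaseField s ≠ 0 := by simpa using nonZeroDivisors.ne_zero hs
  have hr0 : algebraMap (ℤ√2) BaseField r ≠ 0 := by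
    intro hr
    rw [hr, zero_div] at h0
    exact h0 rfl
  obtain ⟨i, hi, j, hj, k, hk, c, hc⟩ := exists_class_int (r * s)
    (mul_ne_zero (by simpa using hr0) (nonZeroDivisors.ne_zero hs)) (by
      have := h.mul (evenOff_sq (z := algebraMap BaseField QuarticField (algebraMap _ _ s))
        (by simpa using hs0))
      rw [← map_pow, ← map_mul] at this
      rw [IsScalarTower.algebraMap_apply (ℤ√2) BaseField QuarticField]
      convert this using 2
      rw [map_mul]
      field_simp)
  have hc' := congrArg (algebraMap (ℤ√2) BaseField) hc
  simp only [map_mul, map_pow, map_neg, map_one] at hc'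
  refine ⟨i, hi, j, hj, k, hk, algebraMap _ _ c / algebraMap _ _ s, ?_, ?_⟩
  · refine div_ne_zero ?_ hs0
    intro hc0
    rw [hc0] at hc'
    exact mul_ne_zero hr0 hs0 (by rw [hc']; ring)
  · rw [div_pow, ← mul_div_assoc, ← hc']
    field_simp

theorem EvenOff.star {x : QuarticField} (h : EvenOff x) : EvenOff (star x) := by
  intro w hw
  obtain ⟨k, hk⟩ := h (w.comap (starRingEnd QuarticField)) (by
    rw [Valuation.comap_apply, map_ofNat, hw])
  exact ⟨k, hk⟩

theorem norm_pos (x : QuarticField) (h0 : x ≠ 0) : 0 < realMinus x.norm := by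
  have h : realMinus x.norm = realMinus x.re ^ 2 + (√2 + 1) * realMinus x.im ^ 2 := by
    rw [QuadraticAlgebra.norm_def]
    simp only [zero_mul, add_zero, map_sub realMinus (x.re * x.re), map_mul, realMinus_δ]
    ring
  have h1 : 0 ≤ realMinus x.norm := by rw [h]; positivity
  refine lt_of_le_of_ne h1 fun h2 => h0 ?_
  rw [← QuadraticAlgebra.norm_eq_zero_iff_eq_zero]
  exact (map_eq_zero realMinus).mp h2.symm

theorem realMinus_η : realMinus (algebraMap _ _ η) = 1 - √2 := by
  rw [η_eq, map_add, map_add, realMinus_root, map_one, map_one]; ring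

theorem norm_τ : QuadraticAlgebra.norm τ = -δ := by
  simp [QuadraticAlgebra.norm_def]

theorem norm_one_sub_τ : QuadraticAlgebra.norm (1 - τ) = 1 - δ := by
  simp [QuadraticAlgebra.norm_def, QuadraticAlgebra.re_one, QuadraticAlgebra.im_one]

/-- Hilbert's theorem 90 for the quartic field over `ℚ(√2)`, for elements of square norm. -/
theorem exists_eq_mul_sq_of_norm {x : QuarticField} {r : BaseField}
    (h : x.norm = r ^ 2) : ∃ (s : BaseField) (z : QuarticField), z ≠ 0 ∧
      x = algebraMap _ _ s * z ^ 2 := by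
  by_cases hw : algebraMap _ _ r + x = 0
  · refine ⟨-r, 1, one_ne_zero, ?_⟩
    rw [map_neg]
    linear_combination hw
  · set W : QuarticField := algebraMap _ _ r + x with hW
    have h1 : x * star x = algebraMap _ _ r ^ 2 := by
      rw [← QuadraticAlgebra.algebraMap_norm_eq_mul_star, h, map_pow]
    have h2 : star W = algebraMap _ _ r + star x := by
      rw [hW, star_add]
      congr 1
      ext <;> simp
    have hN : algebraMap BaseField QuarticField W.norm ≠ 0 := by
      rw [Ne, map_eq_zero, QuadraticAlgebra.norm_eq_zero_iff_eq_zero]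
      exact hw
    have h3 : x * algebraMap BaseField QuarticField W.norm = algebraMap _ _ r * W ^ 2 := by
      rw [QuadraticAlgebra.algebraMap_norm_eq_mul_star, h2, hW]
      linear_combination (algebraMap _ _ r + x) * h1
    refine ⟨r / W.norm, W, hw, ?_⟩
    rw [map_div₀]
    field_simp
    linear_combination h3

theorem exists_twist_norm {x : QuarticField} (h0 : x ≠ 0) (h : EvenOff x) :
    ∃ a < 2, ∃ b < 2, ∃ r, (x * τ ^ a * (1 - τ) ^ b).norm = r ^ 2 := by
  have hN : algebraMap BaseField QuarticField x.norm = x * star x :=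
    QuadraticAlgebra.algebraMap_norm_eq_mul_star _
  have hpos := norm_pos x h0
  obtain ⟨i, hi, j, hj, k, hk, c, hc0, hc⟩ := exists_class_base (x := x.norm)
    (by rwa [Ne, QuadraticAlgebra.norm_eq_zero_iff_eq_zero]) (by
      rw [hN]; exact h.mul (EvenOff.star h))
  have hη : realMinus (algebraMap _ _ η) < 0 := by
    rw [realMinus_η]; linarith [one_lt_sqrt_two]
  have hr : realMinus (algebraMap _ _ root) < 0 := by
    rw [realMinus_root]; linarith [one_lt_sqrt_two]
  have hc2 : 0 < realMinus c ^ 2 := by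
    have := (map_ne_zero realMinus).mpr hc0
    positivity
  have hrt : algebraMap (ℤ√2) BaseField root ^ 2 = 2 := by
    rw [← map_pow, root_sq, map_ofNat]
  have hη' : algebraMap (ℤ√2) BaseField η = 1 + algebraMap (ℤ√2) BaseField root := by
    rw [η_eq, map_add, map_one]
  have hδ : δ = algebraMap (ℤ√2) BaseField root - 1 := by rw [δ, map_sub, map_one]
  rw [hc] at hpos
  simp only [map_mul, map_pow, map_neg, map_one] at hpos
  replace hpos := pos_of_mul_pos_left hpos hc2.le
  simp only [map_mul, map_pow, norm_τ, norm_one_sub_τ]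
  rw [hc, hη', hδ]
  set e := realMinus (algebraMap _ _ η)
  set f := realMinus (algebraMap _ _ root)
  set g := algebraMap (ℤ√2) BaseField root
  have hef := mul_pos_of_neg_of_neg hη hr
  interval_cases i <;> interval_cases j <;> interval_cases k <;> norm_num at hpos <;>
    first
    | exact absurd hpos (by linarith)
    | skip
  · exact ⟨0, by norm_num, 0, by norm_num, c, by ring⟩
  · refine ⟨0, by norm_num, 1, by norm_num, g * c, ?_⟩
    linear_combination (-g) * c ^ 2 * hrt
  · refine ⟨1, by norm_num, 1, by norm_num, g * (g - 1) * c, ?_⟩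
    linear_combination (-(g * (g - 1) * c ^ 2)) * hrt
  · refine ⟨1, by norm_num, 0, by norm_num, c, ?_⟩
    linear_combination c ^ 2 * hrt

theorem τ_ne_zero : τ ≠ 0 := by
  intro h
  have := τ_pow
  rw [h] at this
  norm_num at this

theorem one_sub_τ_ne_zero : 1 - τ ≠ 0 := fun h =>
  one_sub_ne_zero (Subtype.ext h)

theorem one_add_τ_ne_zero : 1 + τ ≠ 0 := by
  intro h
  have h1 : τ = -1 := by linear_combination h
  have := τ_pow
  rw [h1] at this
  norm_num at this

theorem exists_class {x : QuarticField} (h0 : x ≠ 0) (h : EvenOff x) :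
    ∃ i < 2, ∃ j < 2, ∃ k < 2, ∃ l < 2, ∃ z : QuarticField, z ≠ 0 ∧
      x = (-1) ^ i * τ ^ j * ((1 + τ) / (1 - τ)) ^ k * (1 - τ) ^ l * z ^ 2 := by
  have hτ := τ_ne_zero
  have hm := one_sub_τ_ne_zero
  have hp := one_add_τ_ne_zero
  obtain ⟨a, ha, b, hb, r, hr⟩ := exists_twist_norm h0 h
  have hne : x * τ ^ a * (1 - τ) ^ b ≠ 0 :=
    mul_ne_zero (mul_ne_zero h0 (pow_ne_zero _ hτ)) (pow_ne_zero _ hm)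
  obtain ⟨s, z, hz, hs⟩ := exists_eq_mul_sq_of_norm hr
  have hs0 : s ≠ 0 := by
    rintro rfl
    rw [map_zero, zero_mul] at hs
    exact hne hs
  have heven : EvenOff (x * τ ^ a * (1 - τ) ^ b) := by
    refine (h.mul ?_).mul ?_ <;> refine evenOff_of_valuation_eq_one fun w hw => ?_
    · rw [map_pow, valuation_eq_one_of_pow_four τ_pow hw, one_pow]
    · rw [map_pow, valuation_one_sub_eq_one τ_pow hw, one_pow]
  rw [hs] at heven
  obtain ⟨i, hi, j, hj, k, hk, c, hc0, rfl⟩ :=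
    exists_class_base hs0 (heven.of_mul_right (pow_ne_zero 2 hz) (evenOff_sq hz))
  have hη : algebraMap BaseField QuarticField (algebraMap _ _ η) = τ⁻¹ ^ 2 := by
    rw [← IsScalarTower.algebraMap_apply (ℤ√2) BaseField QuarticField, algebraMap_η]
    field_simp
    linear_combination τ_pow
  have hroot : algebraMap BaseField QuarticField (algebraMap _ _ root) =
      (1 + τ) / (1 - τ) * ((1 + τ ^ 2) * τ / (1 + τ)) ^ 2 := by
    rw [← IsScalarTower.algebraMap_apply (ℤ√2) BaseField QuarticField, algebraMap_root]
    field_simp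
    linear_combination (-1 - τ ^ 2) * τ_pow
  simp only [map_mul, map_pow, map_neg, map_one, hη, hroot] at hs
  refine ⟨i, hi, a, ha, k, hk, b, hb, τ⁻¹ ^ a * (1 - τ)⁻¹ ^ b * τ⁻¹ ^ j *
    ((1 + τ ^ 2) * τ / (1 + τ)) ^ k * algebraMap _ _ c * z, ?_, ?_⟩
  · have hθ : 1 + τ ^ 2 ≠ 0 := by
      rw [← algebraMap_root]
      exact (map_ne_zero_iff _ algebraMap_int_injective).mpr prime_root.ne_zero
    have hc : algebraMap BaseField QuarticField c ≠ 0 := by simpa using hc0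
    positivity
  · have e : x = x * τ ^ a * (1 - τ) ^ b * (τ ^ a * (1 - τ) ^ b) *
        (τ⁻¹ ^ a * (1 - τ)⁻¹ ^ b) ^ 2 := by
      rw [inv_pow, inv_pow]
      field_simp
    rw [e, hs, mul_pow _ _ k, ← pow_mul _ 2 k]
    ring

theorem exists_quarticData : Nonempty (QuarticData QuarticField) := by
  obtain ⟨v, h2, h1, hres⟩ := exists_dyadic_valuation
  have h0 : 0 < √2 - (1 : ℝ) := by linarith [one_lt_sqrt_two]
  have hsq := Real.mul_self_sqrt h0.le
  exact ⟨{
    τ := τ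
    τ_pow := τ_pow
    v := v
    v_two := h2
    v_one_sub := h1
    residue := hres
    p := quarticPlace (√(√2 - 1)) hsq
    q := quarticPlace (-√(√2 - 1)) (by rw [neg_mul_neg, hsq])
    p_pos := by rw [quarticPlace_τ]; exact Real.sqrt_pos.mpr h0
    q_neg := by rw [quarticPlace_τ]; exact neg_neg_of_pos (Real.sqrt_pos.mpr h0)
    exists_class := fun _ => exists_class }⟩

end

end SqrtTwo

theorem eq_pow_of_isCoprime_of_pos {a b c : ℤ} {k : ℕ} (hk : Even k) (h : IsCoprime a b)
    (ha : 0 < a) (heq : a * b = c ^ k) : ∃ d, a = d ^ k := by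
  obtain ⟨d, hd⟩ := exists_associated_pow_of_mul_eq_pow
    (gcd_isUnit_iff_isRelPrime.mpr h.isRelPrime) heq
  rcases Int.associated_iff.mp hd with hd | hd
  · exact ⟨d, hd.symm⟩
  · have := hk.pow_nonneg d
    omega

theorem exists_coprime_pows {a b c : ℤ} {k : ℕ} (hk : Even k) (h : IsCoprime a b)
    (ha : 0 ≤ a) (hc : c ≠ 0) (heq : a * b = c ^ k) :
    ∃ d e, d ≠ 0 ∧ e ≠ 0 ∧ a = d ^ k ∧ b = e ^ k := by
  have hck : 0 < c ^ k := hk.pow_pos hc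
  have ha' : 0 < a := lt_of_le_of_ne ha (by rintro rfl; simp at heq; omega)
  have hb' : 0 < b := pos_of_mul_pos_right (heq ▸ hck) ha
  obtain ⟨d, rfl⟩ := eq_pow_of_isCoprime_of_pos hk h ha' heq
  obtain ⟨e, rfl⟩ := eq_pow_of_isCoprime_of_pos hk h.symm hb' (by rw [mul_comm, heq])
  rcases eq_or_ne k 0 with rfl | hk0
  · exact ⟨1, 1, one_ne_zero, one_ne_zero, by simp, by simp⟩
  · exact ⟨d, e, by rintro rfl; simp [hk0] at ha', by rintro rfl; simp [hk0] at hb', rfl, rfl⟩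

theorem PythagoreanTriple.exists_of_isCoprime {x y z : ℤ} (h : x ^ 2 + y ^ 2 = z ^ 2)
    (hcop : IsCoprime x y) (hx : Odd x) (hz : 0 < z) :
    ∃ m n, x = m ^ 2 - n ^ 2 ∧ y = 2 * m * n ∧ z = m ^ 2 + n ^ 2 ∧ IsCoprime m n ∧ 0 ≤ m := by
  obtain ⟨m, n, h1, h2, h3, h4, -, h5⟩ := PythagoreanTriple.coprime_classification'
    (show PythagoreanTriple x y z by unfold PythagoreanTriple; linear_combination h)
    (Int.isCoprime_iff_gcd_eq_one.mp hcop) (Int.odd_iff.mp hx) hz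
  exact ⟨m, n, h1, h2, h3, Int.isCoprime_iff_gcd_eq_one.mpr h4, h5⟩

/-- A nonzero solution of `y² = 2 m n` and `x² = m² + n²` yields a smaller difference of fourth
powers. -/
theorem exists_smaller_fourth_sub_fourth {m n x y : ℤ} (hmn : IsCoprime m n) (hm : 0 ≤ m)
    (hn : Even n) (hx : 0 < x) (hy : y ≠ 0) (hxy : x ^ 2 = m ^ 2 + n ^ 2)
    (h : y ^ 2 = 2 * m * n) :
    ∃ u v s : ℤ, v ≠ 0 ∧ v ^ 2 < y ^ 2 ∧ Odd s ∧ IsCoprime u v ∧ u ^ 4 - v ^ 4 = s ^ 2 := by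
  obtain ⟨n, rfl⟩ := hn.two_dvd
  obtain ⟨y, rfl⟩ : 2 ∣ y := Int.prime_two.dvd_of_dvd_pow (n := 2) ⟨2 * m * n, by
    rw [h]; ring⟩
  have hy0 : y ≠ 0 := by rintro rfl; simp at hy
  obtain ⟨s, t, hs0, ht0, rfl, rfl⟩ := exists_coprime_pows even_two
    hmn.of_mul_right_right hm hy0 (show m * n = y ^ 2 by linarith)
  have hst : IsCoprime s (2 * t ^ 2) := (IsCoprime.pow_left_iff two_pos).mp hmn
  have hsodd : Odd s := Int.isCoprime_two_right.mp hst.of_mul_right_left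
  obtain ⟨M, N, h1, h2, -, h4, h5⟩ := PythagoreanTriple.exists_of_isCoprime
    hxy.symm hmn hsodd.pow hx
  obtain ⟨u, v, -, hv0, rfl, rfl⟩ := exists_coprime_pows even_two h4 h5 ht0
    (show M * N = t ^ 2 by linarith)
  refine ⟨u, v, s, hv0, ?_, hsodd,
    (IsCoprime.pow_iff two_pos two_pos).mp h4, by rw [h1]; ring⟩
  have e : t ^ 2 = u ^ 2 * v ^ 2 := by linarith
  have hs2 : 0 < s ^ 2 := by positivity
  have ht2 : 0 < t ^ 2 := by positivity
  have hv2 : 0 < v ^ 2 := by positivity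
  have hu2 : 0 < u ^ 2 := by
    by_contra! hu
    nlinarith
  have hvt : v ^ 2 ≤ t ^ 2 := by rw [e]; nlinarith
  nlinarith

theorem eq_zero_of_fourth_sub_fourth_eq_odd_sq {x y z : ℤ} (hz : Odd z) (hxy : IsCoprime x y)
    (h : x ^ 4 - y ^ 4 = z ^ 2) : y = 0 := by
  induction hN : (y ^ 2).toNat using Nat.strong_induction_on generalizing x y z with
  | _ N ih =>
    by_contra hy
    have hx0 : x ≠ 0 := by
      rintro rfl
      have : 0 < y ^ 4 := by positivity
      nlinarith [sq_nonneg z]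
    have hcop : IsCoprime z (y ^ 2) := by
      have : IsCoprime (x ^ 4) (y ^ 4) := hxy.pow
      rw [show x ^ 4 = z ^ 2 + 1 * y ^ 4 by linarith, IsCoprime.add_mul_right_left_iff,
        show y ^ 4 = (y ^ 2) ^ 2 by ring] at this
      exact (IsCoprime.pow_iff two_pos two_pos).mp this
    obtain ⟨m, n, h1, h2, h3, h4, h5⟩ := PythagoreanTriple.exists_of_isCoprime
      (z := x ^ 2) (by linarith) hcop hz (by positivity)
    have hx' : 0 < |x| := abs_pos.mpr hx0
    have key : ∃ u v s : ℤ, v ≠ 0 ∧ v ^ 2 < y ^ 2 ∧ Odd s ∧ IsCoprime u v ∧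
        u ^ 4 - v ^ 4 = s ^ 2 := by
      rcases Int.even_or_odd n with hn | hn
      · exact exists_smaller_fourth_sub_fourth h4 h5 hn hx' hy (by rw [sq_abs, h3]) h2
      · have hm : Even m := by
          rw [h1, Int.odd_sub'] at hz
          simpa [Int.even_pow] using hz.mp hn.pow
        have hn0 : 0 ≤ n := by
          by_contra! hn0
          have : 0 < y ^ 2 := by positivity
          nlinarith
        exact exists_smaller_fourth_sub_fourth h4.symm hn0 hm hx' hy
          (by rw [sq_abs, h3]; ring) (by rw [h2]; ring)
    obtain ⟨u, v, s, hv, hlt, hs, huv, he⟩ := key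
    exact hv (ih _ (by rw [← hN]; have := sq_nonneg v; omega) hs huv he rfl)

/-- Fermat: a difference of two coprime fourth powers is a square only trivially. -/
theorem fourth_sub_fourth_eq_sq {x y z : ℤ} (hx : Odd x) (hxy : IsCoprime x y)
    (h : x ^ 4 - y ^ 4 = z ^ 2) : y = 0 ∨ z = 0 := by
  rcases Int.even_or_odd z with hz | hz
  · right
    by_contra hz0
    have hy : Odd y := by
      have h1 : Even (x ^ 4 - y ^ 4) := by rw [h]; exact hz.pow_of_ne_zero two_ne_zero
      rw [Int.even_sub'] at h1
      simpa [Int.odd_pow] using h1.mp hx.pow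
    have hcop : IsCoprime (y ^ 2) z := by
      have : IsCoprime (x ^ 4) (y ^ 4) := hxy.pow
      rw [show x ^ 4 = z ^ 2 + 1 * y ^ 4 by linarith, IsCoprime.add_mul_right_left_iff,
        show y ^ 4 = (y ^ 2) ^ 2 by ring] at this
      exact ((IsCoprime.pow_iff two_pos two_pos).mp this).symm
    have hx0 : x ≠ 0 := by rintro rfl; simp at hx
    obtain ⟨m, n, h1, h2, h3, h4, -⟩ := PythagoreanTriple.exists_of_isCoprime
      (x := y ^ 2) (z := x ^ 2) (by linarith) hcop hy.pow (by positivity)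
    have hn := eq_zero_of_fourth_sub_fourth_eq_odd_sq (hx.mul hy) h4
      (by rw [mul_pow, h1, h3]; ring)
    rw [hn, mul_zero] at h2
    exact hz0 h2
  · exact Or.inl (eq_zero_of_fourth_sub_fourth_eq_odd_sq hz hxy h)

theorem exists_sq_eq_eight_mul_add_one {x : ℤ} (h : Odd x) : ∃ k, x ^ 2 = 8 * k + 1 := by
  obtain ⟨k, hk⟩ := Int.eight_dvd_sq_sub_one_of_odd h
  exact ⟨k, by omega⟩

theorem exists_fourth_eq_sixteen_mul_add_one {x : ℤ} (h : Odd x) :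
    ∃ k, x ^ 4 = 16 * k + 1 := by
  obtain ⟨k, hk⟩ := exists_sq_eq_eight_mul_add_one h
  exact ⟨4 * k ^ 2 + k, by linear_combination (x ^ 2 + 8 * k + 1) * hk⟩

theorem exists_eighth_pow_of_mul {u v h : ℤ} {j : ℕ} (hu : Odd u) (huv : IsCoprime u v)
    (hh : h ≠ 0) (heq : u * v = 2 ^ j * h ^ 8) :
    ∃ p q, q ≠ 0 ∧ Odd p ∧ IsCoprime p q ∧ h ^ 4 = p ^ 4 * q ^ 4 ∧
      (u + v = p ^ 8 + 2 ^ j * q ^ 8 ∨ u + v = -(p ^ 8 + 2 ^ j * q ^ 8)) := by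
  have hu2 : IsCoprime (2 ^ j) u := (Int.isCoprime_two_left.mpr hu).pow_left
  obtain ⟨w, rfl⟩ := hu2.dvd_of_dvd_mul_left (Dvd.intro _ heq.symm)
  have huw := huv.of_mul_right_right
  have he : u * w = h ^ 8 := by
    apply mul_left_cancel₀ (pow_ne_zero j two_ne_zero)
    rw [← heq]; ring
  have h8 : Even 8 := by decide
  have fin {p q : ℤ} (hpq : IsCoprime (p ^ 8) (q ^ 8)) (hm : p ^ 8 * q ^ 8 = h ^ 8) :
      IsCoprime p q ∧ h ^ 4 = p ^ 4 * q ^ 4 := by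
    refine ⟨(IsCoprime.pow_iff (by norm_num) (by norm_num)).mp hpq, ?_⟩
    rw [← sq_eq_sq₀ (by positivity) (by positivity)]
    linear_combination -hm
  rcases le_total 0 u with hu0 | hu0
  · obtain ⟨p, q, hp, hq, rfl, rfl⟩ := exists_coprime_pows h8 huw hu0 hh he
    obtain ⟨hpq, hm⟩ := fin huw he
    exact ⟨p, q, hq, (Int.odd_pow' (by norm_num)).mp hu, hpq, hm, Or.inl rfl⟩
  · have he' : -u * -w = h ^ 8 := by rw [neg_mul_neg, he]
    obtain ⟨p, q, hp, hq, h1, h2⟩ := exists_coprime_pows h8 huw.neg_neg (by omega) hh he'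
    have hc := huw.neg_neg
    rw [h1, h2] at hc he'
    obtain ⟨hpq, hm⟩ := fin hc he'
    refine ⟨p, q, hq, (Int.odd_pow' (by norm_num)).mp (h1 ▸ hu.neg), hpq, hm, Or.inr ?_⟩
    linear_combination -h1 - 2 ^ j * h2

theorem exists_eighth_pow_of_sq_sub_sq {K C h : ℤ} {j : ℕ} (hK : Odd K) (hKh : IsCoprime K h)
    (hC : Odd C) (hh : h ≠ 0) (heq : K ^ 2 - C ^ 2 = 4 * (2 ^ j * h ^ 8)) :
    ∃ p q, q ≠ 0 ∧ Odd p ∧ IsCoprime p q ∧ h ^ 4 = p ^ 4 * q ^ 4 ∧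
      (K = p ^ 8 + 2 ^ j * q ^ 8 ∨ K = -(p ^ 8 + 2 ^ j * q ^ 8)) := by
  obtain ⟨u, hu⟩ := (hK.sub_odd hC).two_dvd
  obtain ⟨v, hv⟩ := (hK.add_odd hC).two_dvd
  have hKuv : K = u + v := by omega
  have huv : u * v = 2 ^ j * h ^ 8 := by
    apply mul_left_cancel₀ (four_ne_zero (α := ℤ))
    rw [← heq]
    linear_combination -(K + C) * hu - 2 * u * hv
  have hcop : IsCoprime u v := by
    have : IsCoprime K (u * v) := by
      rw [huv]
      exact (Int.isCoprime_two_right.mpr hK).pow_right.mul_right hKh.pow_right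
    have := this.of_mul_right_left
    rw [hKuv] at this
    exact (IsCoprime.add_mul_left_left_iff (z := 1)).mp (by simpa [add_comm] using this) |>.symm
  subst hKuv
  rcases Int.even_or_odd u with hu' | hu'
  · have hv' : Odd v := by
      rw [Int.odd_add'] at hK
      exact hK.mpr hu'
    obtain ⟨p, q, hpq⟩ := exists_eighth_pow_of_mul hv' hcop.symm hh (by rw [mul_comm, huv])
    exact ⟨p, q, by rwa [add_comm u v]⟩
  · exact exists_eighth_pow_of_mul hu' hcop hh huv

theorem isCoprime_sq_add_mul {x y z : ℤ} {k : ℕ} (hk : k ≠ 0) (h : IsCoprime x y) :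
    IsCoprime (x ^ 2 + z * y ^ k) y := by
  obtain ⟨k, rfl⟩ := Nat.exists_eq_succ_of_ne_zero hk
  rw [pow_succ y, ← mul_assoc]
  exact IsCoprime.add_mul_right_left_iff.mpr h.pow_left

theorem fourth_eq_one_of_quartic {ε g h p : ℤ} (hε : ε = 1 ∨ ε = -1) (hg : Odd g) (hp : Odd p)
    (hgh : IsCoprime g h) (hh : h ≠ 0) (heq : p ^ 4 = (g ^ 4 + 2 * ε * h ^ 4) ^ 2 - 8 * h ^ 8) :
    ε = 1 ∧ g ^ 4 = 1 ∧ h ^ 4 = 1 := by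
  have hK : Odd (g ^ 4 + 2 * ε * h ^ 4) := by
    rw [mul_assoc]; exact hg.pow.add_even (even_two_mul _)
  have hKh : IsCoprime (g ^ 4 + 2 * ε * h ^ 4) h := by
    rw [show g ^ 4 = (g ^ 2) ^ 2 by ring]
    exact isCoprime_sq_add_mul four_ne_zero hgh.pow_left
  obtain ⟨i, j, hj0, hi, hij, hm, hs⟩ := exists_eighth_pow_of_sq_sub_sq (j := 1) hK hKh hp.pow hh
    (C := p ^ 2) (by linear_combination -heq)
  have hpos : g ^ 4 + 2 * ε * h ^ 4 = i ^ 8 + 2 ^ 1 * j ^ 8 := by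
    refine hs.resolve_right fun hs => ?_
    obtain ⟨d, hd⟩ := exists_fourth_eq_sixteen_mul_add_one hi
    obtain ⟨e, he⟩ := exists_fourth_eq_sixteen_mul_add_one hg
    rw [hm, show i ^ 8 = (i ^ 4) ^ 2 by ring, show j ^ 8 = (j ^ 4) ^ 2 by ring, hd, he] at hs
    rcases Int.even_or_odd' j with ⟨k, rfl | hk⟩
    · ring_nf at hs
      omega
    · obtain ⟨f, hf⟩ := exists_fourth_eq_sixteen_mul_add_one (x := j) ⟨k, hk⟩
      rw [hf] at hs
      rcases hε with rfl | rfl <;> ring_nf at hs <;> omega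
  have hgj : IsCoprime g (j ^ 2) := by
    have h1 : IsCoprime (g ^ 4) (i ^ 4 * j ^ 4) := hm ▸ hgh.pow
    have h2 := h1.of_mul_right_right
    exact ((IsCoprime.pow_iff four_pos four_pos).mp h2).pow_right
  have hε2 : ε ^ 2 = 1 := by rcases hε with rfl | rfl <;> rfl
  have hdiff : g ^ 4 - (j ^ 2) ^ 4 = (i ^ 4 - ε * j ^ 4) ^ 2 := by
    linear_combination hpos - 2 * ε * hm - j ^ 8 * hε2
  rcases fourth_sub_fourth_eq_sq hg hgj hdiff with h0 | h0
  · exact absurd (pow_eq_zero_iff two_ne_zero |>.mp h0) hj0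
  · have hi4 : 0 < i ^ 4 := by
      have : i ≠ 0 := by rintro rfl; simp at hi
      positivity
    have hj4 : 0 < j ^ 4 := by positivity
    have hε1 : ε = 1 := hε.resolve_right (by rintro rfl; linarith)
    subst hε1
    have hij4 : i ^ 4 = j ^ 4 := by linarith
    have hu : IsCoprime (j ^ 4) (j ^ 4) := by
      have : IsCoprime (i ^ 4) (j ^ 4) := hij.pow
      rwa [hij4] at this
    have hj1 : j ^ 4 = 1 := by
      have := Int.isUnit_iff.mp (isCoprime_self.mp hu)
      omega
    refine ⟨rfl, ?_, by rw [hm, hij4, hj1]; rfl⟩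
    rw [h0] at hdiff
    linear_combination hdiff + (j ^ 4 + 1) * hj1

theorem exists_quartic_of_sq {ε b p q : ℤ} (hε : ε = 1 ∨ ε = -1) (hp : Odd p)
    (hpq : IsCoprime p q) (hq : q ≠ 0) (hb : b ≠ 0)
    (heq : b ^ 2 = (p ^ 4 - 4 * ε * q ^ 4) ^ 2 + 16 * q ^ 8) :
    ∃ g h : ℤ, h ≠ 0 ∧ Odd g ∧ IsCoprime g h ∧ q ^ 4 = g ^ 4 * h ^ 4 ∧
      p ^ 4 = (g ^ 4 + 2 * ε * h ^ 4) ^ 2 - 8 * h ^ 8 := by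
  have hε2 : ε ^ 2 = 1 := by rcases hε with rfl | rfl <;> rfl
  have hx : Odd (p ^ 4 - 4 * ε * q ^ 4) := by
    rw [mul_assoc]; exact hp.pow.sub_even (Even.mul_right (by decide) _)
  have hcop : IsCoprime (p ^ 4 - 4 * ε * q ^ 4) (4 * q ^ 4) := by
    have h4 : IsCoprime (p ^ 4) (2 ^ 2) := (Int.isCoprime_two_right.mpr hp).pow
    have := IsCoprime.add_mul_right_left_iff (z := -ε) |>.mpr
      (h4.mul_right (hpq.pow (m := 4) (n := 4)))
    rwa [show p ^ 4 + -ε * (2 ^ 2 * q ^ 4) = p ^ 4 - 4 * ε * q ^ 4 by ring] at this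
  obtain ⟨m, n, h1, h2, -, h4, h5⟩ := PythagoreanTriple.exists_of_isCoprime (z := |b|)
    (by rw [sq_abs, heq]; ring) hcop hx (abs_pos.mpr hb)
  obtain ⟨d, hd⟩ := exists_fourth_eq_sixteen_mul_add_one hp
  have hn : Even n := by
    by_contra hn
    rw [Int.not_even_iff_odd] at hn
    obtain ⟨e, he⟩ := exists_sq_eq_eight_mul_add_one hn
    rcases Int.even_or_odd' m with ⟨k, rfl | hk⟩
    · rw [hd, he] at h1
      ring_nf at h1
      omega
    · obtain ⟨f, hf⟩ := exists_sq_eq_eight_mul_add_one (x := m) ⟨k, hk⟩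
      rw [hd, he, hf] at h1
      ring_nf at h1
      omega
  obtain ⟨n, rfl⟩ := hn.two_dvd
  obtain ⟨g, h, hg0, hh0, rfl, rfl⟩ := exists_coprime_pows (k := 4) (by decide)
    h4.of_mul_right_right h5 hq (show m * n = q ^ 4 by linarith)
  have hgh : IsCoprime g (2 * h ^ 4) := (IsCoprime.pow_left_iff four_pos).mp h4
  have hq4 : q ^ 4 = g ^ 4 * h ^ 4 := by linarith
  exact ⟨g, h, hh0, Int.isCoprime_two_right.mp hgh.of_mul_right_left,
    (IsCoprime.pow_right_iff four_pos).mp hgh.of_mul_right_right, hq4,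
    by linear_combination h1 + 4 * ε * hq4 - 4 * h ^ 8 * hε2⟩

theorem eq_of_even_quartic {ε A b c : ℤ} (hε : ε = 1 ∨ ε = -1) (hA : A ≠ 0) (hb : Odd b)
    (hAb : IsCoprime b A) (heq : c ^ 2 = b ^ 4 + 16 * ε * A ^ 4 * b ^ 2 - 64 * A ^ 8) :
    ε = 1 ∧ A ^ 4 = 1 ∧ b ^ 2 = 25 := by
  have hε2 : ε ^ 2 = 1 := by rcases hε with rfl | rfl <;> rfl
  have hb0 : b ≠ 0 := by rintro rfl; simp at hb
  have hK : Odd (b ^ 2 + 8 * ε * A ^ 4) := by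
    rw [mul_assoc]; exact hb.pow.add_even (Even.mul_right (by decide) _)
  have hC : Odd c := by
    have : Odd (c ^ 2) := by
      rw [heq, show b ^ 4 + 16 * ε * A ^ 4 * b ^ 2 - 64 * A ^ 8 =
        b ^ 4 + 2 * (8 * ε * A ^ 4 * b ^ 2 - 32 * A ^ 8) by ring]
      exact hb.pow.add_even (even_two_mul _)
    exact (Int.odd_pow' two_ne_zero).mp this
  obtain ⟨p, q, hq, hp, hpq, hm, hs⟩ := exists_eighth_pow_of_sq_sub_sq (j := 5) hK
    (isCoprime_sq_add_mul four_ne_zero hAb) hC hA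
    (by linear_combination -heq + 64 * A ^ 8 * hε2)
  have hpos : b ^ 2 + 8 * ε * A ^ 4 = p ^ 8 + 2 ^ 5 * q ^ 8 := by
    refine hs.resolve_right fun hs => ?_
    obtain ⟨d, hd⟩ := exists_fourth_eq_sixteen_mul_add_one hp
    obtain ⟨e, he⟩ := exists_sq_eq_eight_mul_add_one hb
    rw [show p ^ 8 = (p ^ 4) ^ 2 by ring, hd, he] at hs
    ring_nf at hs
    omega
  obtain ⟨g, h, hh, hg, hgh, hq4, hp4⟩ := exists_quartic_of_sq hε hp hpq hq hb0
    (b := b) (by linear_combination hpos - 8 * ε * hm - 16 * q ^ 8 * hε2)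
  obtain ⟨rfl, hg1, hh1⟩ := fourth_eq_one_of_quartic hε hg hp hgh hh hp4
  rw [hg1, hh1] at hq4
  rw [hg1, show h ^ 8 = (h ^ 4) ^ 2 by ring, hh1] at hp4
  norm_num at hq4 hp4
  have hA1 : A ^ 4 = 1 := by rw [hm, hp4, hq4, one_mul]
  refine ⟨rfl, hA1, ?_⟩
  linear_combination hpos - 8 * hA1 + (p ^ 4 + 1) * hp4 + 32 * (q ^ 4 + 1) * hq4

theorem lucasU_eight (P Q : ℤ) :
    lucasU P Q 8 = P * ((P ^ 2 - 2 * Q) * (2 * (Q - P ^ 2) ^ 2 - P ^ 4)) := by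
  simp only [lucasU]
  ring

theorem eq_of_odd_signed_squares {a b c Q t : ℤ} (ht : t = 1 ∨ t = -1) (ha : Odd a) (hb : Odd b)
    (hc : c ≠ 0) (hab : IsCoprime b (a ^ 2)) (hV : a ^ 4 - 2 * Q = t * b ^ 2)
    (hW : 2 * (Q - a ^ 4) ^ 2 - a ^ 8 = t * c ^ 2) :
    a ^ 2 = 1 ∧ (Q = 0 ∨ Q = 1 ∨ Q = -4) := by
  obtain ⟨D⟩ := SqrtTwo.exists_quarticData
  have ht2 : t ^ 2 = 1 := by rcases ht with rfl | rfl <;> rfl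
  have key : 2 * (t * c ^ 2) = b ^ 4 + 2 * t * a ^ 4 * b ^ 2 - a ^ 8 := by
    linear_combination -2 * hW + (3 * a ^ 4 + t * b ^ 2 - 2 * Q) * hV + b ^ 4 * ht2
  have ha1 {z : ℤ} (h : b = z * a ^ 2) : a ^ 2 = 1 := by
    have := (hab.symm.isUnit_of_dvd' dvd_rfl ⟨z, by rw [h, mul_comm]⟩)
    have := Int.isUnit_iff.mp this
    have := sq_nonneg a
    omega
  have fin (h1 : a ^ 2 = 1) (hb : b ^ 2 = 1 ∨ t = 1 ∧ b ^ 2 = 9) : Q = 0 ∨ Q = 1 ∨ Q = -4 := by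
    rw [show a ^ 4 = (a ^ 2) ^ 2 by ring, h1] at hV
    rcases hb with hb | ⟨rfl, hb⟩ <;> rw [hb] at hV <;> omega
  rcases ht with rfl | rfl
  · have hb0 : 0 < |b| := abs_pos.mpr (by rintro rfl; simp at hb)
    have hb4 : |b| ^ 4 = b ^ 4 := Even.pow_abs (by decide) b
    rcases D.quartic_pos ha (odd_abs.mpr hb) hb0 hc (hab.abs_left)
      (by rw [hb4, sq_abs]; linear_combination key) with h | h
    · have hb' : b ^ 2 = (a ^ 2) ^ 2 := by rw [← sq_abs b, h]
      have h1 : a ^ 2 = 1 := by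
        rcases abs_choice b with hs | hs <;> rw [hs] at h
        · exact ha1 (z := 1) (by linarith)
        · exact ha1 (z := -1) (by linarith)
      exact ⟨h1, fin h1 (Or.inl (by rw [hb', h1]; rfl))⟩
    · have hb' : b ^ 2 = (3 * a ^ 2) ^ 2 := by rw [← sq_abs b, h]
      have h1 : a ^ 2 = 1 := by
        rcases abs_choice b with hs | hs <;> rw [hs] at h
        · exact ha1 (z := 3) (by linarith)
        · exact ha1 (z := -3) (by linarith)
      exact ⟨h1, fin h1 (Or.inr ⟨rfl, by rw [hb', h1]; rfl⟩)⟩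
  · rcases D.quartic_neg ha hb hc hab (by linear_combination key) with h | h
    · have h1 := ha1 (z := 1) (by rw [h, one_mul])
      exact ⟨h1, fin h1 (Or.inl (by rw [h, h1]; rfl))⟩
    · have h1 := ha1 (z := -1) (by rw [h, neg_one_mul])
      exact ⟨h1, fin h1 (Or.inl (by rw [h, h1]; rfl))⟩

theorem exists_common_sign {a b c Q : ℤ} (hb : Odd b) (hc : Odd c)
    (ha : ∃ k, a = 16 * k + 1) (hV : a - 2 * Q = b ^ 2 ∨ a - 2 * Q = -b ^ 2)
    (hW : 2 * (Q - a) ^ 2 - a ^ 2 = c ^ 2 ∨ 2 * (Q - a) ^ 2 - a ^ 2 = -c ^ 2) :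
    ∃ t : ℤ, (t = 1 ∨ t = -1) ∧ a - 2 * Q = t * b ^ 2 ∧
      2 * (Q - a) ^ 2 - a ^ 2 = t * c ^ 2 := by
  obtain ⟨k, rfl⟩ := ha
  obtain ⟨l, hl⟩ := exists_sq_eq_eight_mul_add_one hb
  obtain ⟨n, hn⟩ := exists_sq_eq_eight_mul_add_one hc
  rcases hV with hV | hV
  · refine ⟨1, Or.inl rfl, by omega, ?_⟩
    obtain rfl : Q = 8 * k - 4 * l := by omega
    rw [one_mul]
    refine hW.resolve_right fun hW => ?_
    rw [hn] at hW
    ring_nf at hW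
    omega
  · refine ⟨-1, Or.inr rfl, by omega, ?_⟩
    obtain rfl : Q = 8 * k + 4 * l + 1 := by omega
    rw [neg_one_mul]
    refine hW.resolve_left fun hW => ?_
    rw [hn] at hW
    ring_nf at hW
    omega

theorem eq_of_odd {P Q m : ℤ} (hP : Odd P) (hcop : IsCoprime P Q)
    (h : P * ((P ^ 2 - 2 * Q) * (2 * (Q - P ^ 2) ^ 2 - P ^ 4)) = m ^ 2) :
    P = 1 ∧ (Q = 0 ∨ Q = 1 ∨ Q = -4) := by
  have hP2 : IsCoprime P 2 := Int.isCoprime_two_right.mpr hP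
  have hVodd : Odd (P ^ 2 - 2 * Q) := hP.pow.sub_even (even_two_mul _)
  have hPV : IsCoprime P (P ^ 2 - 2 * Q) := by
    have := IsCoprime.add_mul_left_right_iff (z := P) |>.mpr (hP2.mul_right hcop).neg_right
    rwa [show -(2 * Q) + P * P = P ^ 2 - 2 * Q by ring] at this
  have hPW : IsCoprime P (2 * (Q - P ^ 2) ^ 2 - P ^ 4) := by
    have := IsCoprime.add_mul_left_right_iff (z := P ^ 3 - 4 * P * Q) |>.mpr
      (hP2.mul_right (hcop.pow_right (n := 2)))
    rwa [show 2 * Q ^ 2 + P * (P ^ 3 - 4 * P * Q) = 2 * (Q - P ^ 2) ^ 2 - P ^ 4 by ring] at this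
  have hVQ : IsCoprime (P ^ 2 - 2 * Q) Q := by
    have := IsCoprime.add_mul_right_left_iff (z := -2) |>.mpr (hcop.pow_left (m := 2))
    rwa [show P ^ 2 + -2 * Q = P ^ 2 - 2 * Q by ring] at this
  have hVW : IsCoprime (P ^ 2 - 2 * Q) (2 * (Q - P ^ 2) ^ 2 - P ^ 4) := by
    have := IsCoprime.add_mul_left_right_iff (z := P ^ 2 - 2 * Q) |>.mpr
      ((Int.isCoprime_two_right.mpr hVodd).mul_right (hVQ.pow_right (n := 2))).neg_right
    rwa [show -(2 * Q ^ 2) + (P ^ 2 - 2 * Q) * (P ^ 2 - 2 * Q) =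
      2 * (Q - P ^ 2) ^ 2 - P ^ 4 by ring] at this
  have hWodd : Odd (2 * (Q - P ^ 2) ^ 2 - P ^ 4) := (even_two_mul _).sub_odd hP.pow
  obtain ⟨a, ha⟩ := Int.sq_of_isCoprime (hPV.mul_right hPW) h
  obtain ⟨b, hb⟩ := Int.sq_of_isCoprime (c := m) (hPV.symm.mul_right hVW) (by rw [← h]; ring)
  obtain ⟨c, hc⟩ := Int.sq_of_isCoprime (c := m) (hPW.symm.mul_right hVW.symm) (by rw [← h]; ring)
  have haodd : Odd a := by
    rcases ha with rfl | rfl <;> simpa [Int.odd_pow, parity_simps] using hP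
  have hbodd : Odd b := by
    rcases hb with hb | hb <;> rw [hb] at hVodd <;>
      simpa [Int.odd_pow, parity_simps] using hVodd
  have hcodd : Odd c := by
    rcases hc with hc | hc <;> rw [hc] at hWodd <;>
      simpa [Int.odd_pow, parity_simps] using hWodd
  have ha0 : a ≠ 0 := by rintro rfl; simp at haodd
  have hb0 : b ≠ 0 := by rintro rfl; simp at hbodd
  have hc0 : c ≠ 0 := by rintro rfl; simp at hcodd
  have hP4 : P ^ 2 = a ^ 4 := by rcases ha with rfl | rfl <;> ring
  have hab : IsCoprime b (a ^ 2) := by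
    have h1 : IsCoprime (a ^ 2) (b ^ 2) := by
      rcases ha with rfl | rfl <;> rcases hb with hb | hb <;> rw [hb] at hPV <;>
        simpa [IsCoprime.neg_left_iff, IsCoprime.neg_right_iff] using hPV
    exact ((IsCoprime.pow_right_iff two_pos).mp h1).symm
  rw [show P ^ 4 = (P ^ 2) ^ 2 by ring] at hc h
  rw [hP4] at hb hc h
  obtain ⟨t, ht, hV, hW⟩ : ∃ t : ℤ, (t = 1 ∨ t = -1) ∧ a ^ 4 - 2 * Q = t * b ^ 2 ∧
      2 * (Q - a ^ 4) ^ 2 - (a ^ 4) ^ 2 = t * c ^ 2 :=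
    exists_common_sign hbodd hcodd
      (exists_fourth_eq_sixteen_mul_add_one haodd) hb hc
  have hPa : P = a ^ 2 := by
    refine ha.resolve_right fun ha => ?_
    have ht2 : t ^ 2 = 1 := by rcases ht with rfl | rfl <;> rfl
    rw [hV, hW, ha] at h
    have h1 : m ^ 2 = -(a ^ 2 * b ^ 2 * c ^ 2) := by
      linear_combination -h - a ^ 2 * b ^ 2 * c ^ 2 * ht2
    have h2 : 0 < a ^ 2 * b ^ 2 * c ^ 2 := by positivity
    nlinarith [sq_nonneg m]
  rw [hPa]
  exact eq_of_odd_signed_squares ht haodd hbodd hc0 hab hV (by rw [← hW]; ring)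

theorem eq_of_even {P Q m : ℤ} (hP : Even P) (hP0 : P ≠ 0) (hcop : IsCoprime P Q)
    (h : P * ((P ^ 2 - 2 * Q) * (2 * (Q - P ^ 2) ^ 2 - P ^ 4)) = m ^ 2) :
    P = 4 ∧ Q = -17 := by
  obtain ⟨p, rfl⟩ := hP.two_dvd
  have hQ : Odd Q := Int.isCoprime_two_left.mp hcop.of_mul_left_left
  have hX : Odd (2 * p ^ 2 - Q) := (even_two_mul _).sub_odd hQ
  obtain ⟨n, rfl⟩ : 4 ∣ m := by
    obtain ⟨m, rfl⟩ : 2 ∣ m := Int.prime_two.dvd_of_dvd_pow (n := 2)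
      (h ▸ (dvd_mul_right 2 p).mul_right _)
    obtain ⟨m, rfl⟩ : 2 ∣ m := Int.prime_two.dvd_of_dvd_pow (n := 2)
      ⟨p * ((2 * p ^ 2 - Q) * (2 * (2 * p ^ 2 - Q) ^ 2 - Q ^ 2)), by linarith⟩
    exact ⟨m, by ring⟩
  have h' : p * ((2 * p ^ 2 - Q) * (2 * (2 * p ^ 2 - Q) ^ 2 - Q ^ 2)) = 2 * n ^ 2 := by
    linarith
  have hW : Odd (2 * (2 * p ^ 2 - Q) ^ 2 - Q ^ 2) := (even_two_mul _).sub_odd hQ.pow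
  obtain ⟨r, rfl⟩ : 2 ∣ p :=
    (Int.isCoprime_two_left.mpr (hX.mul hW)).dvd_of_dvd_mul_right ⟨n ^ 2, h'⟩
  set X := 2 * (2 * r) ^ 2 - Q with hXdef
  set W := 2 * X ^ 2 - Q ^ 2 with hWdef
  have hr : r * (X * W) = n ^ 2 := by linarith
  have hrQ : IsCoprime r Q := hcop.of_mul_left_right.of_mul_left_right
  have hrX : IsCoprime r X := by
    have := IsCoprime.add_mul_left_right_iff (z := 8 * r) |>.mpr hrQ.neg_right
    rwa [show -Q + r * (8 * r) = X by rw [hXdef]; ring] at this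
  have hrW : IsCoprime r W := by
    have := IsCoprime.add_mul_left_right_iff (z := 128 * r ^ 3 - 32 * r * Q) |>.mpr
      (hrQ.pow_right (n := 2))
    rwa [show Q ^ 2 + r * (128 * r ^ 3 - 32 * r * Q) = W by rw [hWdef, hXdef]; ring] at this
  have hXQ : IsCoprime X Q := by
    have := IsCoprime.add_mul_right_left_iff (z := -1) |>.mpr
      (((Int.isCoprime_two_left.mpr hQ).pow_left (m := 3)).mul_left (hrQ.pow_left (m := 2)))
    rwa [show 2 ^ 3 * r ^ 2 + -1 * Q = X by rw [hXdef]; ring] at this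
  have hXW : IsCoprime X W := by
    have := IsCoprime.add_mul_left_right_iff (z := 2 * X) |>.mpr
      (hXQ.pow_right (n := 2)).neg_right
    rwa [show -Q ^ 2 + X * (2 * X) = W by rw [hWdef]; ring] at this
  obtain ⟨A, hA⟩ := Int.sq_of_isCoprime (hrX.mul_right hrW) hr
  obtain ⟨b, hb⟩ := Int.sq_of_isCoprime (c := n) (hrX.symm.mul_right hXW) (by rw [← hr]; ring)
  obtain ⟨c, hc⟩ := Int.sq_of_isCoprime (c := n) (hrW.symm.mul_right hXW.symm)
    (by rw [← hr]; ring)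
  have hA0 : A ≠ 0 := by rintro rfl; simp at hA; simp [hA] at hP0
  have hbodd : Odd b := by
    rcases hb with hb | hb <;> rw [hb] at hX <;> simpa [Int.odd_pow, parity_simps] using hX
  have hcodd : Odd c := by
    rcases hc with hc | hc <;> rw [hc] at hW <;> simpa [Int.odd_pow, parity_simps] using hW
  have hcW : W = c ^ 2 := by
    refine hc.resolve_right fun hc => ?_
    obtain ⟨d, hd⟩ := exists_sq_eq_eight_mul_add_one hX
    obtain ⟨e, he⟩ := exists_sq_eq_eight_mul_add_one hQ
    obtain ⟨f, hf⟩ := exists_sq_eq_eight_mul_add_one hcodd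
    omega
  obtain ⟨ε, hε, hrε, hXε⟩ : ∃ ε : ℤ, (ε = 1 ∨ ε = -1) ∧ r = ε * A ^ 2 ∧ X = ε * b ^ 2 := by
    have hb0 : b ≠ 0 := by rintro rfl; simp at hbodd
    have hc0 : c ≠ 0 := by rintro rfl; simp at hcodd
    have hpos : 0 < A ^ 2 * (b ^ 2 * c ^ 2) := by positivity
    rcases hA with hA | hA <;> rcases hb with hb | hb
    · exact ⟨1, by simp, by omega, by omega⟩
    · rw [hA, hb, hcW] at hr
      nlinarith [sq_nonneg n]
    · rw [hA, hb, hcW] at hr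
      nlinarith [sq_nonneg n]
    · exact ⟨-1, by simp, by omega, by omega⟩
  have hbA : IsCoprime b A := by
    have h1 : IsCoprime (A ^ 2) (b ^ 2) := by
      rw [hrε, hXε] at hrX
      exact hrX.of_mul_left_right.of_mul_right_right
    exact ((IsCoprime.pow_iff two_pos two_pos).mp h1).symm
  have hε2 : ε ^ 2 = 1 := by rcases hε with rfl | rfl <;> rfl
  have hQA : Q = 8 * A ^ 4 - ε * b ^ 2 := by
    linear_combination -hXε + hXdef + 8 * (r + ε * A ^ 2) * hrε + 8 * A ^ 4 * hε2
  obtain ⟨rfl, hA4, hb25⟩ := eq_of_even_quartic hε hA0 hbodd hbA (c := c) (by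
    rw [← hcW, hWdef, hXε, hQA]
    linear_combination b ^ 4 * hε2)
  have hA2 : A ^ 2 = 1 := by nlinarith [sq_nonneg A]
  omega

/-- If `P` and `Q` are nonzero coprime integers, with `(P, Q)` not one of the
degenerate pairs `(1,1)`, `(-1,1)`, `(2,1)`, `(-2,1)`, and the eighth term
`U 8 (P, Q)` is a perfect square, then `(P, Q) = (1, -4)` or `(P, Q) = (4, -17)`.
Moreover `U 8 (1, -4) = 21 ^ 2` and `U 8 (4, -17) = 620 ^ 2`. -/
theorem lucasU_eight_square (P Q : ℤ) (hP : P ≠ 0) (hQ : Q ≠ 0)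
    (hcop : IsCoprime P Q)
    (h1 : ¬(P = 1 ∧ Q = 1)) (h2 : ¬(P = -1 ∧ Q = 1))
    (h3 : ¬(P = 2 ∧ Q = 1)) (h4 : ¬(P = -2 ∧ Q = 1))
    (hsq : ∃ m : ℤ, lucasU P Q 8 = m ^ 2) :
    ((P = 1 ∧ Q = -4) ∨ (P = 4 ∧ Q = -17)) ∧
      lucasU 1 (-4) 8 = 21 ^ 2 ∧ lucasU 4 (-17) 8 = 620 ^ 2 := by
  refine ⟨?_, by rw [lucasU_eight]; norm_num, by rw [lucasU_eight]; norm_num⟩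
  obtain ⟨m, hm⟩ := hsq
  rw [lucasU_eight] at hm
  rcases Int.even_or_odd P with hP2 | hP2
  · exact Or.inr (eq_of_even hP2 hP hcop hm)
  · obtain ⟨hP1, hQ' | hQ' | hQ'⟩ := eq_of_odd hP2 hcop hm
    · exact absurd hQ' hQ
    · exact absurd ⟨hP1, hQ'⟩ h1
    · exact Or.inl ⟨hP1, hQ'⟩
end

section
/- Let P and Q be nonzero coprime integers. Then U_4(P,Q) is a perfect square if and only if there exist integers a, b and δ ∈ {1,−1} such that either P = δ·a^2 and Q = (a^4 − δ·b^2)/2 with a·b odd, or P = 2δ·a^2 and Q = 2a^4 − δ·b^2 with b odd. -/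
theorem lucasU_four (P Q : ℤ) : lucasU P Q 4 = P * (P ^ 2 - 2 * Q) := by
  simp only [lucasU]
  ring

/-- Two coprime integers whose product is a square, the first being nonzero, are squares up to
a common sign. -/
theorem Int.exists_eq_sign_mul_sq_of_isCoprime {x y m : ℤ} (hx : x ≠ 0) (h : IsCoprime x y)
    (hm : x * y = m ^ 2) :
    ∃ a b δ : ℤ, (δ = 1 ∨ δ = -1) ∧ x = δ * a ^ 2 ∧ y = δ * b ^ 2 := by
  obtain ⟨a, ha⟩ := Int.sq_of_isCoprime h hm
  obtain ⟨b, hb⟩ := Int.sq_of_isCoprime h.symm ((mul_comm y x).trans hm)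
  have hxy : 0 ≤ x * y := hm ▸ sq_nonneg m
  rcases ha with rfl | rfl
  · have hy : 0 ≤ y := nonneg_of_mul_nonneg_right hxy (by positivity)
    refine ⟨a, b, 1, Or.inl rfl, by ring, ?_⟩
    rcases hb with hb | hb <;> nlinarith [sq_nonneg b]
  · have hy : 0 ≤ -y := by
      refine nonneg_of_mul_nonneg_right (a := a ^ 2) (by linarith) ?_
      have : a ≠ 0 := by rintro rfl; simp at hx
      positivity
    refine ⟨a, b, -1, Or.inr rfl, by ring, ?_⟩
    rcases hb with hb | hb <;> nlinarith [sq_nonneg b]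

/-- For nonzero coprime integers `P, Q`, the term `U 4 (P, Q)` is a perfect
square if and only if there are integers `a, b` and a sign `δ = ±1` with
either `P = δ a^2`, `Q = (a^4 - δ b^2)/2` and `a * b` odd, or
`P = 2 δ a^2`, `Q = 2 a^4 - δ b^2` and `b` odd. -/
theorem lucasU_four_square (P Q : ℤ) (hP : P ≠ 0) (hQ : Q ≠ 0)
    (hcop : IsCoprime P Q) :
    (∃ m : ℤ, lucasU P Q 4 = m ^ 2) ↔
      ∃ a b δ : ℤ, (δ = 1 ∨ δ = -1) ∧
        ((P = δ * a ^ 2 ∧ 2 * Q = a ^ 4 - δ * b ^ 2 ∧ Odd (a * b)) ∨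
         (P = 2 * δ * a ^ 2 ∧ Q = 2 * a ^ 4 - δ * b ^ 2 ∧ Odd b)) := by
  rw [lucasU_four]
  constructor
  · rintro ⟨m, hm⟩
    rcases Int.even_or_odd P with hev | hodd
    · obtain ⟨p, rfl⟩ := hev.two_dvd
      have hQodd : Odd Q := Int.isCoprime_two_left.mp hcop.of_mul_left_left
      have hp : p ≠ 0 := right_ne_zero_of_mul hP
      obtain ⟨n, rfl⟩ : (2 : ℤ) ∣ m := by
        refine Int.prime_two.dvd_of_dvd_pow (n := 2) ?_
        rw [← hm, mul_assoc]
        exact dvd_mul_right _ _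
      have hpc : IsCoprime p (2 * p ^ 2 - Q) := by
        rw [show 2 * p ^ 2 - Q = -Q + p * (2 * p) by ring]
        exact hcop.of_mul_left_right.neg_right.add_mul_left_right (2 * p)
      obtain ⟨a, b, δ, hδ, ha, hb⟩ :=
        Int.exists_eq_sign_mul_sq_of_isCoprime (m := n) hp hpc (by linarith)
      have hδ2 : δ ^ 2 = 1 := by rcases hδ with rfl | rfl <;> norm_num
      have hQ' : Q = 2 * a ^ 4 - δ * b ^ 2 := by
        rw [ha] at hb
        linear_combination -hb + 2 * a ^ 4 * hδ2
      refine ⟨a, b, δ, hδ, Or.inr ⟨by rw [ha]; ring, hQ', ?_⟩⟩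
      have hδb : Odd (δ * b ^ 2) := by
        rw [show δ * b ^ 2 = 2 * a ^ 4 - Q by linarith]
        exact (even_two_mul _).sub_odd hQodd
      exact (Int.odd_pow' two_ne_zero).mp (Int.odd_mul.mp hδb).2
    · have hPc : IsCoprime P (P ^ 2 - 2 * Q) := by
        have h2 : IsCoprime P 2 := Int.isCoprime_two_right.mpr hodd
        rw [show P ^ 2 - 2 * Q = -(2 * Q) + P * P by ring]
        exact (h2.mul_right hcop).neg_right.add_mul_left_right P
      obtain ⟨a, b, δ, hδ, ha, hb⟩ :=
        Int.exists_eq_sign_mul_sq_of_isCoprime (m := m) hP hPc hm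
      have hδ2 : δ ^ 2 = 1 := by rcases hδ with rfl | rfl <;> norm_num
      have hab : Odd (P * (P ^ 2 - 2 * Q)) := hodd.mul (hodd.pow.sub_even (even_two_mul Q))
      rw [show P * (P ^ 2 - 2 * Q) = (a * b) ^ 2 by
        rw [hb, ha]; linear_combination (a * b) ^ 2 * hδ2] at hab
      refine ⟨a, b, δ, hδ, Or.inl ⟨ha, ?_, (Int.odd_pow' two_ne_zero).mp hab⟩⟩
      rw [ha] at hb
      linear_combination -hb + a ^ 4 * hδ2
  · rintro ⟨a, b, δ, hδ, ⟨hP', hQ', -⟩ | ⟨hP', hQ', -⟩⟩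
    · refine ⟨a * b, ?_⟩
      rw [hQ', hP']
      rcases hδ with rfl | rfl <;> ring
    · refine ⟨2 * a * b, ?_⟩
      rw [hQ', hP']
      rcases hδ with rfl | rfl <;> ring
end

section
/- Let P and Q be nonzero coprime integers such that U_5(P,Q) is a perfect square. Then there exist integers a and b such that one of the following holds: (P,Q) = (2ab, 5a^4 + 6a^2b^2 + b^4) with a, b of opposite parity; (P,Q) = (2ab, −5a^4 + 6a^2b^2 − b^4) with a, b of opposite parity; (P,Q) = (ab, (5a^4 + 6a^2b^2 + b^4)/4) with a, b both odd; or (P,Q) = (ab, (−5a^4 + 6a^2b^2 − b^4)/4) with a, b both odd. -/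
theorem isCoprime_of_mul_eq_five_mul_pow_four {r s p : ℤ} (hp : p ≠ 0)
    (h : r * s = 5 * p ^ 4) (hcop : IsCoprime (r + s) p) : IsCoprime r s := by
  refine isCoprime_of_prime_dvd ?_ fun l hl hr hs => ?_
  · rintro ⟨rfl, -⟩
    have : p ^ 4 ≠ 0 := pow_ne_zero 4 hp
    omega
  · by_cases hlp : l ∣ p
    · exact hl.not_isUnit (hcop.isUnit_of_dvd' (dvd_add hr hs) hlp)
    · have hlc : IsCoprime (l * l) (p ^ 4) := by
        have := (hl.coprime_iff_not_dvd.mpr hlp).pow_right (n := 4)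
        exact this.mul_left this
      have hl5 : l * l ∣ 5 := hlc.dvd_of_dvd_mul_right (h ▸ mul_dvd_mul hr hs)
      exact hl.not_isUnit ((Int.prime_iff_natAbs_prime.mpr (by norm_num) :
        Prime (5 : ℤ)).squarefree l hl5)

theorem exists_eq_mul_of_mul_eq_pow_four {t s p : ℤ} (hp : p ≠ 0)
    (h : t * s = p ^ 4) (hcop : IsCoprime t s) :
    ∃ a b : ℤ, p = a * b ∧ ((t = a ^ 4 ∧ s = b ^ 4) ∨ (t = -a ^ 4 ∧ s = -b ^ 4)) := by
  obtain ⟨a, ha⟩ := exists_associated_pow_of_mul_eq_pow' hcop h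
  obtain ⟨b, hb⟩ := exists_associated_pow_of_mul_eq_pow' hcop.symm (mul_comm t s ▸ h)
  have hpos : 0 < p ^ 4 := by positivity
  have hab : 0 ≤ (a * b) ^ 4 := by positivity
  obtain ⟨hsign, hpow⟩ : ((t = a ^ 4 ∧ s = b ^ 4) ∨ (t = -a ^ 4 ∧ s = -b ^ 4)) ∧
      p ^ 4 = (a * b) ^ 4 := by
    rcases Int.associated_iff.mp ha.symm with rfl | rfl <;>
      rcases Int.associated_iff.mp hb.symm with rfl | rfl
    · exact ⟨.inl ⟨rfl, rfl⟩, by linarith [mul_pow a b 4]⟩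
    · linarith [mul_pow a b 4]
    · linarith [mul_pow a b 4]
    · exact ⟨.inr ⟨rfl, rfl⟩, by linarith [mul_pow a b 4]⟩
  rcases pow_eq_pow_iff_cases.mp hpow with h0 | hp' | ⟨hp', -⟩
  · omega
  · exact ⟨a, b, hp', hsign⟩
  · refine ⟨-a, b, by rw [hp', neg_mul], ?_⟩
    rwa [Even.neg_pow (by decide)]

theorem exists_add_eq_of_mul_eq_five_mul_pow_four {r s p : ℤ} (hp : p ≠ 0)
    (h : r * s = 5 * p ^ 4) (hcop : IsCoprime (r + s) p) :
    ∃ a b : ℤ, p = a * b ∧ (r + s = 5 * a ^ 4 + b ^ 4 ∨ r + s = -(5 * a ^ 4 + b ^ 4)) := by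
  have hrs := isCoprime_of_mul_eq_five_mul_pow_four hp h hcop
  have h5 : Prime (5 : ℤ) := Int.prime_iff_natAbs_prime.mpr (by norm_num)
  wlog hr : (5 : ℤ) ∣ r generalizing r s
  · have hs := (h5.dvd_or_dvd (Dvd.intro _ h.symm)).resolve_left hr
    simpa only [add_comm s r] using
      this (mul_comm r s ▸ h) (add_comm r s ▸ hcop) hrs.symm hs
  obtain ⟨t, rfl⟩ := hr
  obtain ⟨a, b, hpab, ⟨rfl, rfl⟩ | ⟨rfl, rfl⟩⟩ :=
    exists_eq_mul_of_mul_eq_pow_four (t := t) (s := s) hp (by linarith) hrs.of_mul_left_right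
  · exact ⟨a, b, hpab, .inl rfl⟩
  · exact ⟨a, b, hpab, .inr (by ring)⟩

theorem not_odd_iff_odd_of_odd_five_mul_pow_four_add {a b : ℤ}
    (h : Odd (5 * a ^ 4 + b ^ 4)) : ¬(Odd a ↔ Odd b) := by
  simp only [Int.odd_add, Int.odd_mul, Int.even_pow, Int.odd_pow] at h
  grind

/-- If `P, Q` are nonzero coprime integers with `U 5 (P, Q)` a perfect square,
then there are integers `a, b` with `(P, Q)` of one of the four stated shapes. -/
theorem lucasU_five_square (P Q : ℤ) (hP : P ≠ 0) (hQ : Q ≠ 0)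
    (hcop : IsCoprime P Q) (hsq : ∃ m : ℤ, lucasU P Q 5 = m ^ 2) :
    ∃ a b : ℤ,
      (P = 2 * a * b ∧ Q = 5 * a ^ 4 + 6 * a ^ 2 * b ^ 2 + b ^ 4 ∧
        ¬(Odd a ↔ Odd b)) ∨
      (P = 2 * a * b ∧ Q = -5 * a ^ 4 + 6 * a ^ 2 * b ^ 2 - b ^ 4 ∧
        ¬(Odd a ↔ Odd b)) ∨
      (P = a * b ∧ 4 * Q = 5 * a ^ 4 + 6 * a ^ 2 * b ^ 2 + b ^ 4 ∧
        Odd a ∧ Odd b) ∨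
      (P = a * b ∧ 4 * Q = -5 * a ^ 4 + 6 * a ^ 2 * b ^ 2 - b ^ 4 ∧
        Odd a ∧ Odd b) := by
  obtain ⟨m, hm⟩ := hsq
  have hU : P ^ 4 - 3 * P ^ 2 * Q + Q ^ 2 = m ^ 2 := by
    rw [← hm]
    simp only [lucasU]
    ring
  rcases Int.even_or_odd P with hPe | hPo
  · obtain ⟨p, rfl⟩ := even_iff_two_dvd.mp hPe
    have hQo : Odd Q := Int.isCoprime_two_left.mp hcop.of_mul_left_left
    have hmo : Odd m := by
      have : Odd (m ^ 2) := by
        rw [show m ^ 2 = 2 * (8 * p ^ 4 - 6 * p ^ 2 * Q) + Q ^ 2 by linarith]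
        exact (even_two_mul _).add_odd hQo.pow
      exact (Int.odd_pow' two_ne_zero).mp this
    obtain ⟨r, hr⟩ : (2 : ℤ) ∣ Q - 6 * p ^ 2 - m := by
      grind
    have hcop' : IsCoprime (r + (r + m)) p := by
      have : r + (r + m) = Q + p * (-6 * p) := by linarith
      rw [this]
      exact hcop.of_mul_left_right.symm.add_mul_left_left _
    obtain ⟨a, b, rfl, hab⟩ := exists_add_eq_of_mul_eq_five_mul_pow_four
      (right_ne_zero_of_mul hP) (by grind) hcop'
    have hpar : Odd (r + (r + m)) := by grind
    refine ⟨a, b, ?_⟩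
    rcases hab with hab | hab
    · refine .inl ⟨by ring, by linarith [mul_pow a b 2], ?_⟩
      rw [hab] at hpar
      exact not_odd_iff_odd_of_odd_five_mul_pow_four_add hpar
    · refine .inr (.inl ⟨by ring, by linarith [mul_pow a b 2], ?_⟩)
      rw [hab, odd_neg] at hpar
      exact not_odd_iff_odd_of_odd_five_mul_pow_four_add hpar
  · have hcop' : IsCoprime ((2 * Q - 3 * P ^ 2 - 2 * m) + (2 * Q - 3 * P ^ 2 + 2 * m)) P := by
      have h2 : IsCoprime (2 : ℤ) P := Int.isCoprime_two_left.mpr hPo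
      have : (2 * Q - 3 * P ^ 2 - 2 * m) + (2 * Q - 3 * P ^ 2 + 2 * m) =
          2 * (2 * Q) + P * (-6 * P) := by ring
      rw [this]
      exact (h2.mul_left (h2.mul_left hcop.symm)).add_mul_left_left _
    obtain ⟨a, b, rfl, hab⟩ := exists_add_eq_of_mul_eq_five_mul_pow_four hP
      (by linear_combination 4 * hU) hcop'
    obtain ⟨ha, hb⟩ := Int.odd_mul.mp hPo
    refine ⟨a, b, .inr (.inr ?_)⟩
    rcases hab with hab | hab
    · exact .inl ⟨rfl, by linarith [mul_pow a b 2], ha, hb⟩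
    · exact .inr ⟨rfl, by linarith [mul_pow a b 2], ha, hb⟩
end

section
/- Let P and Q be nonzero coprime integers such that U_6(P,Q) is a perfect square. Then there exist integers a, b, c such that one of the following seven cases holds: (1) P = a^2, P^2 − Q = b^2, and −2a^4 + 3b^2 = c^2; (2) P = a^2, P^2 − Q = −2b^2, and a^4 + 3b^2 = c^2; (3) P = −a^2, P^2 − Q = 2b^2, and a^4 − 3b^2 = c^2; (4) P = 3a^2, P^2 − Q = b^2, and −6a^4 + b^2 = c^2; (5) P = 3a^2, P^2 − Q = −b^2, and 6a^4 + b^2 = c^2; (6) P = 3a^2, P^2 − Q = 2b^2, and −3a^4 + b^2 = c^2; (7) P = 3a^2, P^2 − Q = −2b^2, and 3a^4 + b^2 = c^2. -/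
/-- If `x * y` is a square and every common divisor of `x` and `y` divides the prime `q`,
then `x` is, up to sign, a square or `q` times a square. -/
theorem Int.eq_sq_or_prime_mul_sq {x y m : ℤ} {q : ℕ} (hq : q.Prime) (hxy : x * y = m ^ 2)
    (h : ∀ d, d ∣ x → d ∣ y → d ∣ (q : ℤ)) :
    ∃ s : ℤ, x = s ^ 2 ∨ x = -s ^ 2 ∨ x = q * s ^ 2 ∨ x = -(q * s ^ 2) := by
  have hg : Int.gcd x y ∣ q :=
    Int.natCast_dvd_natCast.1 (h _ (Int.gcd_dvd_left ..) (Int.gcd_dvd_right ..))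
  have hq0 : (q : ℤ) ≠ 0 := by exact_mod_cast hq.ne_zero
  rcases (Nat.dvd_prime hq).1 hg with hg | hg
  · obtain ⟨s, hs | hs⟩ := Int.sq_of_isCoprime (Int.isCoprime_iff_gcd_eq_one.2 hg) hxy
    exacts [⟨s, .inl hs⟩, ⟨s, .inr (.inl hs)⟩]
  · obtain ⟨x', rfl⟩ : (q : ℤ) ∣ x := hg ▸ Int.gcd_dvd_left ..
    obtain ⟨y', rfl⟩ : (q : ℤ) ∣ y := hg ▸ Int.gcd_dvd_right ..
    have hgcd : Int.gcd x' y' = 1 := by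
      rw [Int.gcd_mul_left, Int.natAbs_natCast] at hg
      exact Nat.eq_of_mul_eq_mul_left hq.pos (by rw [hg, mul_one])
    obtain ⟨n, rfl⟩ : (q : ℤ) ∣ m :=
      (Int.pow_dvd_pow_iff two_ne_zero).1 ⟨x' * y', by rw [← hxy]; ring⟩
    have hn : x' * y' = n ^ 2 := by
      apply mul_left_cancel₀ (pow_ne_zero 2 hq0)
      linear_combination hxy
    obtain ⟨s, rfl | rfl⟩ := Int.sq_of_isCoprime (Int.isCoprime_iff_gcd_eq_one.2 hgcd) hn
    exacts [⟨s, .inr (.inr (.inl rfl))⟩, ⟨s, .inr (.inr (.inr (by ring)))⟩]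

/-- If `k` is squarefree and `k * t ^ 2 * z` is a square with `t ≠ 0`, then `z` is `k` times
a square. -/
theorem Int.eq_mul_sq_of_squarefree_mul_sq_mul {k t z m : ℤ} (hk : Squarefree k) (ht : t ≠ 0)
    (h : k * t ^ 2 * z = m ^ 2) : ∃ c : ℤ, z = k * c ^ 2 := by
  obtain ⟨n, rfl⟩ : t ∣ m := (Int.pow_dvd_pow_iff two_ne_zero).1 ⟨k * z, by rw [← h]; ring⟩
  have hn : k * z = n ^ 2 := by
    apply mul_left_cancel₀ (pow_ne_zero 2 ht)
    linear_combination h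
  obtain ⟨c, rfl⟩ : k ∣ n := (hk.dvd_pow_iff_dvd two_ne_zero).1 ⟨z, hn.symm⟩
  exact ⟨c, mul_left_cancel₀ hk.ne_zero (by linear_combination hn)⟩

/-- A sum of two integer squares is divisible by `3` only if both terms are. -/
theorem Int.three_dvd_of_three_dvd_sq_add_sq {x y : ℤ} (h : 3 ∣ x ^ 2 + y ^ 2) :
    3 ∣ x ∧ 3 ∣ y := by
  have key : ∀ x y : ZMod 3, x ^ 2 + y ^ 2 = 0 → x = 0 ∧ y = 0 := by decide
  simp only [← Nat.cast_ofNat (R := ℤ) (n := 3), ← ZMod.intCast_zmod_eq_zero_iff_dvd] at h ⊢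
  push_cast at h
  simpa using key _ _ (by simpa using h)

theorem Int.squarefree_of_natAbs_dvd_six {k : ℤ} (hk : k.natAbs ∣ 6) : Squarefree k :=
  Int.squarefree_natAbs.1 <| Squarefree.squarefree_of_dvd hk <| by
    rw [show 6 = 2 * 3 from rfl, Nat.squarefree_mul (by norm_num)]
    exact ⟨Nat.prime_two.squarefree, Nat.prime_three.squarefree⟩

theorem lucasU_six (P Q : ℤ) :
    lucasU P Q 6 = P * (P ^ 2 - Q) * (P ^ 2 - 3 * Q) := by
  simp only [lucasU]
  ring

/-- If `P, Q` are nonzero coprime integers with `U 6 (P, Q)` a perfect square,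
then one of seven cases holds. -/
theorem lucasU_six_square (P Q : ℤ) (hP : P ≠ 0) (hQ : Q ≠ 0)
    (hcop : IsCoprime P Q) (hsq : ∃ m : ℤ, lucasU P Q 6 = m ^ 2) :
    ∃ a b c : ℤ,
      (P = a ^ 2 ∧ P ^ 2 - Q = b ^ 2 ∧ -2 * a ^ 4 + 3 * b ^ 2 = c ^ 2) ∨
      (P = a ^ 2 ∧ P ^ 2 - Q = -2 * b ^ 2 ∧ a ^ 4 + 3 * b ^ 2 = c ^ 2) ∨
      (P = -a ^ 2 ∧ P ^ 2 - Q = 2 * b ^ 2 ∧ a ^ 4 - 3 * b ^ 2 = c ^ 2) ∨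
      (P = 3 * a ^ 2 ∧ P ^ 2 - Q = b ^ 2 ∧ -6 * a ^ 4 + b ^ 2 = c ^ 2) ∨
      (P = 3 * a ^ 2 ∧ P ^ 2 - Q = -b ^ 2 ∧ 6 * a ^ 4 + b ^ 2 = c ^ 2) ∨
      (P = 3 * a ^ 2 ∧ P ^ 2 - Q = 2 * b ^ 2 ∧ -3 * a ^ 4 + b ^ 2 = c ^ 2) ∨
      (P = 3 * a ^ 2 ∧ P ^ 2 - Q = -2 * b ^ 2 ∧ 3 * a ^ 4 + b ^ 2 = c ^ 2) := by
  obtain ⟨m, hm⟩ := hsq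
  rw [lucasU_six] at hm
  obtain ⟨R, hR⟩ : ∃ R, R = P ^ 2 - Q := ⟨_, rfl⟩
  obtain ⟨S, hS⟩ : ∃ S, S = P ^ 2 - 3 * Q := ⟨_, rfl⟩
  rw [← hR, ← hS] at hm
  rw [← hR]
  have hRS : S = 3 * R - 2 * P ^ 2 := by rw [hR, hS]; ring
  have hPR : IsCoprime P R := by
    have := (hcop.neg_right).add_mul_left_right P
    rwa [show -Q + P * P = R by rw [hR]; ring] at this
  clear hR hS hcop hQ
  have not_three (ha : 3 ∣ P) (hb : 3 ∣ R) : False := by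
    have := hPR.isUnit_of_dvd' ha hb
    rw [Int.isUnit_iff] at this
    lia
  have hdP : ∀ d, d ∣ P → d ∣ R * S → d ∣ ((3 : ℕ) : ℤ) := fun d h1 h2 => by
    have hc := hPR.of_isCoprime_of_dvd_left h1
    have h3 : d ∣ S := hc.dvd_of_dvd_mul_left h2
    refine hc.dvd_of_dvd_mul_right ?_
    have := dvd_add h3 (h1.mul_right (2 * P))
    rwa [show S + P * (2 * P) = (3 : ℕ) * R by rw [hRS]; push_cast; ring] at this
  have hdR : ∀ d, d ∣ R → d ∣ P * S → d ∣ ((2 : ℕ) : ℤ) := fun d h1 h2 => by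
    have hc := hPR.symm.of_isCoprime_of_dvd_left h1
    have h3 : d ∣ S := hc.dvd_of_dvd_mul_left h2
    refine (hc.pow_right (n := 2)).dvd_of_dvd_mul_right ?_
    have := dvd_sub (h1.mul_right 3) h3
    rwa [show R * 3 - S = (2 : ℕ) * P ^ 2 by rw [hRS]; push_cast; ring] at this
  by_cases hR0 : R = 0
  · subst hR0
    rw [isCoprime_zero_right, Int.isUnit_iff] at hPR
    rcases hPR with rfl | rfl
    · exact ⟨1, 0, 1, by norm_num⟩
    · exact ⟨1, 0, 1, by norm_num⟩
  obtain ⟨a, ha⟩ := Int.eq_sq_or_prime_mul_sq Nat.prime_three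
    (show P * (R * S) = m ^ 2 by rw [← hm]; ring) hdP
  obtain ⟨b, hb⟩ := Int.eq_sq_or_prime_mul_sq Nat.prime_two
    (show R * (P * S) = m ^ 2 by rw [← hm]; ring) hdR
  push_cast at ha hb
  have ha0 : a ≠ 0 := by rintro rfl; simp_all
  have hb0 : b ≠ 0 := by rintro rfl; simp_all
  have hab : a * b ≠ 0 := mul_ne_zero ha0 hb0
  have ha4 : 0 < a ^ 4 := by positivity
  have hb2 : 0 < b ^ 2 := by positivity
  have get_c (k : ℤ) (hk : k.natAbs ∣ 6) (h : P * R = k * (a * b) ^ 2) :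
      ∃ c : ℤ, 3 * R - 2 * P ^ 2 = k * c ^ 2 := by
    obtain ⟨c, hc⟩ := Int.eq_mul_sq_of_squarefree_mul_sq_mul
      (Int.squarefree_of_natAbs_dvd_six hk) hab (h ▸ hm)
    exact ⟨c, hRS ▸ hc⟩
  have hP3 : 3 ∣ a → 3 ∣ P := fun h => by
    rcases ha with ha | ha | ha | ha <;> simp [ha, h, dvd_pow]
  have hR3 : 3 ∣ b → 3 ∣ R := fun h => by
    rcases hb with hb | hb | hb | hb <;> simp [hb, h, dvd_pow, Dvd.dvd.mul_left]
  have descent {c k : ℤ} (h : c ^ 2 + (a ^ 2) ^ 2 = 3 * k) (hk : 3 ∣ a → 3 ∣ k → 3 ∣ b ^ 2) :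
      False := by
    obtain ⟨⟨x, rfl⟩, h2⟩ := Int.three_dvd_of_three_dvd_sq_add_sq ⟨k, h⟩
    replace h2 := Int.prime_three.dvd_of_dvd_pow h2
    obtain ⟨y, rfl⟩ := id h2
    refine not_three (hP3 h2) (hR3 (Int.prime_three.dvd_of_dvd_pow (hk h2 ?_)))
    exact ⟨x ^ 2 + 9 * y ^ 4, by linarith⟩
  rcases ha with ha | ha | ha | ha <;> rcases hb with hb | hb | hb | hb
  · obtain ⟨c, hc⟩ := get_c 1 (by decide) (by rw [ha, hb]; ring)
    rw [ha, hb] at hc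
    exact ⟨a, b, c, .inl ⟨by linarith, by linarith, by linarith⟩⟩
  · obtain ⟨c, hc⟩ := get_c (-1) (by decide) (by rw [ha, hb]; ring)
    rw [ha, hb] at hc
    refine (descent (c := c) (k := b ^ 2 + a ^ 4) (by linarith) fun h3 h => ?_).elim
    have := dvd_pow h3 four_ne_zero
    lia
  · obtain ⟨c, hc⟩ := get_c 2 (by decide) (by rw [ha, hb]; ring)
    rw [ha, hb] at hc
    refine (descent (c := c) (k := b ^ 2) (by linarith) fun h3 h => ?_).elim
    have := dvd_pow h3 four_ne_zero
    lia
  · obtain ⟨c, hc⟩ := get_c (-2) (by decide) (by rw [ha, hb]; ring)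
    rw [ha, hb] at hc
    exact ⟨a, b, c, .inr <| .inl ⟨by linarith, by linarith, by linarith⟩⟩
  · obtain ⟨c, hc⟩ := get_c (-1) (by decide) (by rw [ha, hb]; ring)
    rw [ha, hb] at hc
    refine (descent (c := c) (k := a ^ 4 - b ^ 2) (by linarith) fun h3 h => ?_).elim
    have := dvd_pow h3 four_ne_zero
    lia
  · obtain ⟨c, hc⟩ := get_c 1 (by decide) (by rw [ha, hb]; ring)
    rw [ha, hb] at hc
    nlinarith [sq_nonneg c]
  · obtain ⟨c, hc⟩ := get_c (-2) (by decide) (by rw [ha, hb]; ring)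
    rw [ha, hb] at hc
    exact ⟨a, b, c, .inr <| .inr <| .inl ⟨by linarith, by linarith, by linarith⟩⟩
  · obtain ⟨c, hc⟩ := get_c 2 (by decide) (by rw [ha, hb]; ring)
    rw [ha, hb] at hc
    nlinarith [sq_nonneg c]
  · obtain ⟨c, hc⟩ := get_c 3 (by decide) (by rw [ha, hb]; ring)
    rw [ha, hb] at hc
    exact ⟨a, b, c, .inr <| .inr <| .inr <| .inl ⟨by linarith, by linarith, by linarith⟩⟩
  · obtain ⟨c, hc⟩ := get_c (-3) (by decide) (by rw [ha, hb]; ring)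
    rw [ha, hb] at hc
    exact ⟨a, b, c, .inr <| .inr <| .inr <| .inr <| .inl
      ⟨by linarith, by linarith, by linarith⟩⟩
  · obtain ⟨c, hc⟩ := get_c 6 (by decide) (by rw [ha, hb]; ring)
    rw [ha, hb] at hc
    exact ⟨a, b, c, .inr <| .inr <| .inr <| .inr <| .inr <| .inl
      ⟨by linarith, by linarith, by linarith⟩⟩
  · obtain ⟨c, hc⟩ := get_c (-6) (by decide) (by rw [ha, hb]; ring)
    rw [ha, hb] at hc
    exact ⟨a, b, c, .inr <| .inr <| .inr <| .inr <| .inr <| .inr <|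
      ⟨by linarith, by linarith, by linarith⟩⟩
  · obtain ⟨c, hc⟩ := get_c (-3) (by decide) (by rw [ha, hb]; ring)
    rw [ha, hb] at hc
    have h3 : 3 ∣ b := (Int.three_dvd_of_three_dvd_sq_add_sq (x := c) ⟨2 * a ^ 4, by linarith⟩).2
    exact (not_three ⟨-a ^ 2, by rw [ha]; ring⟩ (hR3 h3)).elim
  · obtain ⟨c, hc⟩ := get_c 3 (by decide) (by rw [ha, hb]; ring)
    rw [ha, hb] at hc
    nlinarith [sq_nonneg c]
  · obtain ⟨c, hc⟩ := get_c (-6) (by decide) (by rw [ha, hb]; ring)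
    rw [ha, hb] at hc
    have h3 : 3 ∣ b := (Int.three_dvd_of_three_dvd_sq_add_sq (x := c) ⟨a ^ 4, by linarith⟩).2
    exact (not_three ⟨-a ^ 2, by rw [ha]; ring⟩ (hR3 h3)).elim
  · obtain ⟨c, hc⟩ := get_c 6 (by decide) (by rw [ha, hb]; ring)
    rw [ha, hb] at hc
    nlinarith [sq_nonneg c]
end

section
/- Let P and Q be coprime integers with P odd and Q nonzero, and suppose P(P^2 − 2Q)(P^4 − 4P^2Q + 2Q^2) is a perfect square. Then there exist positive integers a, b, c with a and b odd such that either: P = a^2, P^2 − 2Q = b^2, and −a^8 + 2a^4b^2 + b^4 = 2c^2; or P = a^2, P^2 − 2Q = −b^2, and −a^8 − 2a^4b^2 + b^4 = −2c^2. -/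
/-- An integer that is coprime to its cofactor in a square is plus or minus the square of a
nonnegative integer. -/
theorem exists_nonneg_sq_or_neg_sq {x y m : ℤ} (hxy : IsCoprime x y) (h : x * y = m ^ 2) :
    ∃ a : ℤ, 0 ≤ a ∧ (x = a ^ 2 ∨ x = -a ^ 2) := by
  obtain ⟨a, ha⟩ := Int.sq_of_isCoprime hxy h
  exact ⟨|a|, abs_nonneg a, by simpa using ha⟩

/-- A sum of two squares of integers, one of them odd, is not divisible by `4`. -/
theorem Odd.not_four_dvd_sq_add_sq {a b : ℤ} (ha : Odd a) : ¬ (4 : ℤ) ∣ a ^ 2 + b ^ 2 := by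
  have h1 := Int.sq_mod_four_eq_one_of_odd ha
  rcases Int.even_or_odd' b with ⟨k, rfl | rfl⟩ <;> ring_nf <;> omega


/-- If `P, Q` are coprime integers with `P` odd and `Q` nonzero such that
`P (P² − 2Q)(P⁴ − 4P²Q + 2Q²)` is a perfect square, then there are positive
odd integers `a, b` and a positive integer `c` realizing one of the two
auxiliary equations. -/
theorem u8_odd_case (P Q : ℤ) (hcop : IsCoprime P Q) (hodd : Odd P)
    (hQ : Q ≠ 0)
    (hsq : ∃ m : ℤ,
      P * (P ^ 2 - 2 * Q) * (P ^ 4 - 4 * P ^ 2 * Q + 2 * Q ^ 2) = m ^ 2) :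
    ∃ a b c : ℤ, 0 < a ∧ 0 < b ∧ 0 < c ∧ Odd a ∧ Odd b ∧
      ((P = a ^ 2 ∧ P ^ 2 - 2 * Q = b ^ 2 ∧
          -a ^ 8 + 2 * a ^ 4 * b ^ 2 + b ^ 4 = 2 * c ^ 2) ∨
       (P = a ^ 2 ∧ P ^ 2 - 2 * Q = -b ^ 2 ∧
          -a ^ 8 - 2 * a ^ 4 * b ^ 2 + b ^ 4 = -2 * c ^ 2)) := by
  obtain ⟨m, hm⟩ := hsq
  set y := P ^ 2 - 2 * Q with hy
  set z := P ^ 4 - 4 * P ^ 2 * Q + 2 * Q ^ 2 with hz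
  have two_z : 2 * z = -P ^ 4 + 2 * P ^ 2 * y + y ^ 2 := by rw [hy, hz]; ring
  have y_odd : Odd y := hodd.pow.sub_even (even_two_mul Q)
  have four_dvd : (4 : ℤ) ∣ z - y := by
    obtain ⟨k, hk⟩ := hodd
    obtain ⟨l, hl⟩ := Int.even_mul_succ_self Q
    have : z - y = 4 * (-P ^ 2 * Q + l + P ^ 2 * (k ^ 2 + k)) := by
      rw [hy, hz, hk]
      rw [show Q ^ 2 = 2 * l - Q by linear_combination hl]
      ring
    exact ⟨_, this⟩
  have P_two : IsCoprime P 2 := Int.isCoprime_two_right.mpr hodd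
  have P_y : IsCoprime P y := by
    have h : IsCoprime P (-(2 * Q) + P * P) :=
      (P_two.mul_right hcop).neg_right.add_mul_left_right P
    rwa [show -(2 * Q) + P * P = y by rw [hy]; ring] at h
  have P_z : IsCoprime P z := by
    have h := (P_two.mul_right (hcop.pow_right (n := 2))).add_mul_left_right (P ^ 3 - 4 * P * Q)
    rwa [show 2 * Q ^ 2 + P * (P ^ 3 - 4 * P * Q) = z by rw [hz]; ring] at h
  have y_z : IsCoprime y z := by
    have h := (P_y.symm.pow_right (n := 4)).neg_right.add_mul_left_right (2 * P ^ 2 + y)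
    rw [show -P ^ 4 + y * (2 * P ^ 2 + y) = 2 * z by rw [two_z]; ring] at h
    exact h.of_mul_right_right
  obtain ⟨a, ha, hPa⟩ := exists_nonneg_sq_or_neg_sq (P_y.mul_right P_z)
    (show P * (y * z) = m ^ 2 by rw [← hm]; ring)
  obtain ⟨b, hb, hyb⟩ := exists_nonneg_sq_or_neg_sq (P_y.symm.mul_right y_z)
    (show y * (P * z) = m ^ 2 by rw [← hm]; ring)
  obtain ⟨c, hc, hzc⟩ := exists_nonneg_sq_or_neg_sq (P_z.symm.mul_right y_z.symm)
    (show z * (P * y) = m ^ 2 by rw [← hm]; ring)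
  have z_ne : z ≠ 0 := by
    obtain ⟨k, hk⟩ := y_odd
    omega
  have a_odd : Odd a := by
    rcases hPa with h | h <;> simpa [h, Int.odd_pow] using hodd
  have b_odd : Odd b := by
    rcases hyb with h | h <;> simpa [h, Int.odd_pow] using y_odd
  have a_pos : 0 < a := lt_of_le_of_ne ha (by rintro rfl; simp at a_odd)
  have b_pos : 0 < b := lt_of_le_of_ne hb (by rintro rfl; simp at b_odd)
  have c_pos : 0 < c := lt_of_le_of_ne hc (by rintro rfl; simp at hzc; exact z_ne hzc)
  clear_value y z
  have same_sign : (y = b ^ 2 ∧ z = c ^ 2) ∨ (y = -b ^ 2 ∧ z = -c ^ 2) := by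
    have h := b_odd.not_four_dvd_sq_add_sq (b := c)
    omega
  have yz_pos : 0 < y * z := by
    rcases same_sign with ⟨rfl, rfl⟩ | ⟨rfl, rfl⟩
    · positivity
    · rw [neg_mul_neg]
      positivity
  have P_eq : P = a ^ 2 := by
    refine hPa.resolve_right fun h => ?_
    rw [h] at hm
    nlinarith [mul_pos (pow_pos a_pos 2) yz_pos, sq_nonneg m]
  refine ⟨a, b, c, a_pos, b_pos, c_pos, a_odd, b_odd, ?_⟩
  rcases same_sign with ⟨hyb, hzc⟩ | ⟨hyb, hzc⟩ <;> rw [hzc, hyb, P_eq] at two_z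
  · exact Or.inl ⟨P_eq, hyb, by linear_combination -two_z⟩
  · exact Or.inr ⟨P_eq, hyb, by linear_combination -two_z⟩
end
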